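/- Let n ≥ 2 and let λ₁, Λ₁, λ₂, Λ₂ be positive constants with λ_l ≤ Λ_l, and set N_l = (λ_l/Λ_l)(n−1) + 1 for l = 1, 2. Assume N₁ > 2, N₂ > 2, p > 1, q > 1, and that either 2(p+1)/(pq−1) ≥ N₁−2 or 2(q+1)/(pq−1) ≥ N₂−2. Then there is no pair of functions u₁, u₂ continuous on the closed half space, positive in ℝⁿ₊, vanishing on the boundary ∂ℝⁿ₊ = {xₙ = 0}, such that u₁ is a viscosity solution of M⁺_{λ₁,Λ₁}(D²u₁) + u₂^p = 0 in ℝⁿ₊ and u₂ is a viscosity solution of M⁺_{λ₂,Λ₂}(D²u₂) + u₁^q = 0 in ℝⁿ₊ (no boundedness assumption on u₁, u₂). -/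

import Mathlib

open scoped BigOperators

/-- The Pucci maximal operator `M⁺_{λ,Λ}`: for a symmetric matrix it equals
`Λ · (sum of positive eigenvalues) + λ · (sum of negative eigenvalues)`. -/
noncomputable def pucciMax (lam Lam : ℝ) {n : ℕ} (M : Matrix (Fin n) (Fin n) ℝ) : ℝ :=
  if h : M.IsHermitian then
    ∑ i, (Lam * max (h.eigenvalues i) 0 + lam * min (h.eigenvalues i) 0)
  else 0

/-- The Hessian matrix of `φ` at `x`. -/
noncomputable def hess {n : ℕ} (φ : EuclideanSpace ℝ (Fin n) → ℝ)
    (x : EuclideanSpace ℝ (Fin n)) : Matrix (Fin n) (Fin n) ℝ :=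
  fun i j => iteratedFDeriv ℝ 2 φ x ![EuclideanSpace.single i 1, EuclideanSpace.single j 1]

/-- `u` is a viscosity supersolution of `M⁺_{λ,Λ}(D²u) + g = 0` in `Ω`. -/
def PucciSupersol (lam Lam : ℝ) {n : ℕ} (Ω : Set (EuclideanSpace ℝ (Fin n)))
    (u g : EuclideanSpace ℝ (Fin n) → ℝ) : Prop :=
  ∀ x₀ ∈ Ω, ∀ φ : EuclideanSpace ℝ (Fin n) → ℝ, ContDiff ℝ 2 φ →
    IsLocalMin (fun x => u x - φ x) x₀ → pucciMax lam Lam (hess φ x₀) + g x₀ ≤ 0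

/-- `u` is a viscosity subsolution of `M⁺_{λ,Λ}(D²u) + g = 0` in `Ω`. -/
def PucciSubsol (lam Lam : ℝ) {n : ℕ} (Ω : Set (EuclideanSpace ℝ (Fin n)))
    (u g : EuclideanSpace ℝ (Fin n) → ℝ) : Prop :=
  ∀ x₀ ∈ Ω, ∀ φ : EuclideanSpace ℝ (Fin n) → ℝ, ContDiff ℝ 2 φ →
    IsLocalMax (fun x => u x - φ x) x₀ → 0 ≤ pucciMax lam Lam (hess φ x₀) + g x₀

open Filter Topology Metric
open scoped RealInnerProductSpace

/-- Euclidean space of dimension `n`. -/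
abbrev Euc (n : ℕ) := EuclideanSpace ℝ (Fin n)

/-- The second directional derivative of `φ` at `x` along `v`. -/
noncomputable def d2 {n : ℕ} (φ : Euc n → ℝ) (x v : Euc n) : ℝ :=
  fderiv ℝ (fderiv ℝ φ) x v v

theorem hess_apply {n : ℕ} (φ : Euc n → ℝ) (x : Euc n) (i j : Fin n) :
    hess φ x i j =
      fderiv ℝ (fderiv ℝ φ) x (EuclideanSpace.single i 1) (EuclideanSpace.single j 1) := by
  simp [hess, iteratedFDeriv_two_apply]

theorem hess_isHermitian {n : ℕ} {φ : Euc n → ℝ} {x : Euc n} (h : ContDiffAt ℝ 2 φ x) :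
    (hess φ x).IsHermitian := by
  have hs : IsSymmSndFDerivAt ℝ φ x := h.isSymmSndFDerivAt (by simp)
  ext i j
  simp only [Matrix.conjTranspose_apply, hess_apply, star_trivial]
  exact hs _ _

theorem bilin_eq_hess {n : ℕ} (φ : Euc n → ℝ) (x v w : Euc n) :
    fderiv ℝ (fderiv ℝ φ) x v w = v.ofLp ⬝ᵥ (hess φ x).mulVec w.ofLp := by
  have hv : ∀ v : Euc n, v = ∑ i, v i • EuclideanSpace.single i (1 : ℝ) := by
    intro v
    simpa using ((EuclideanSpace.basisFun (Fin n) ℝ).sum_repr v).symm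
  conv_lhs => rw [hv v, hv w]
  simp only [map_sum, map_smul, sum_apply, smul_apply,
    dotProduct, Matrix.mulVec, hess_apply, smul_eq_mul, Finset.mul_sum]
  rw [Finset.sum_comm]
  refine Finset.sum_congr rfl fun i _ => Finset.sum_congr rfl fun j _ => ?_
  ring

/-- Simultaneous diagonalisation of the Hessian quadratic form and evaluation of the
Pucci operator. -/
theorem exists_diag {n : ℕ} (lam Lam : ℝ) {φ : Euc n → ℝ} {x : Euc n}
    (h : ContDiffAt ℝ 2 φ x) :
    ∃ (b : OrthonormalBasis (Fin n) ℝ (Euc n)) (μ : Fin n → ℝ),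
      (∀ v, d2 φ x v = ∑ i, μ i * ⟪b i, v⟫ ^ 2) ∧
      pucciMax lam Lam (hess φ x) = ∑ i, (Lam * max (μ i) 0 + lam * min (μ i) 0) := by
  have hH := hess_isHermitian h
  refine ⟨hH.eigenvectorBasis, hH.eigenvalues, fun v => ?_, ?_⟩
  · set b := hH.eigenvectorBasis
    have key : ∀ w j, fderiv ℝ (fderiv ℝ φ) x w (b j) = hH.eigenvalues j * ⟪b j, w⟫ := by
      intro w j
      rw [bilin_eq_hess]
      have := hH.mulVec_eigenvectorBasis j
      change (hess φ x).mulVec (b j).ofLp = _ at this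
      rw [this]
      simp [PiLp.inner_apply, dotProduct, Finset.mul_sum, b, mul_left_comm]
    have hv := b.sum_repr' v
    calc d2 φ x v = fderiv ℝ (fderiv ℝ φ) x v (∑ i, ⟪b i, v⟫ • b i) := by rw [hv, d2]
      _ = _ := by
        simp only [map_sum, map_smul, key, smul_eq_mul]
        exact Finset.sum_congr rfl fun i _ => by ring
  · rw [pucciMax, dif_pos hH]

theorem weighted_le_pucci_aux {lam Lam a s : ℝ} (h1 : lam ≤ a) (h2 : a ≤ Lam) :
    a * s ≤ Lam * max s 0 + lam * min s 0 := by
  rcases le_total 0 s with h | h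
  · rw [max_eq_left h, min_eq_right h]; nlinarith
  · rw [max_eq_right h, min_eq_left h]; nlinarith

/-- Linear operators with ellipticity in `[lam, Lam]` are bounded by the Pucci operator. -/
theorem sum_le_pucci {n : ℕ} {lam Lam : ℝ} {φ : Euc n → ℝ} {x : Euc n}
    (h : ContDiffAt ℝ 2 φ x) (b : OrthonormalBasis (Fin n) ℝ (Euc n)) (a : Fin n → ℝ)
    (ha : ∀ i, lam ≤ a i ∧ a i ≤ Lam) :
    ∑ i, a i * d2 φ x (b i) ≤ pucciMax lam Lam (hess φ x) := by
  obtain ⟨c, μ, hd, hp⟩ := exists_diag lam Lam h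
  rw [hp]
  have hsum : ∀ j, ∑ i, ⟪c j, b i⟫ ^ 2 = 1 := fun j => by
    rw [b.sum_sq_inner_left]; simp
  calc ∑ i, a i * d2 φ x (b i) = ∑ j, (∑ i, a i * ⟪c j, b i⟫ ^ 2) * μ j := by
        simp only [hd, Finset.mul_sum, Finset.sum_mul]
        rw [Finset.sum_comm]
        exact Finset.sum_congr rfl fun i _ => Finset.sum_congr rfl fun j _ => by ring
    _ ≤ _ := by
        refine Finset.sum_le_sum fun j _ => weighted_le_pucci_aux ?_ ?_
        · calc lam = ∑ i, lam * ⟪c j, b i⟫ ^ 2 := by rw [← Finset.mul_sum, hsum, mul_one]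
            _ ≤ _ := Finset.sum_le_sum fun i _ =>
              mul_le_mul_of_nonneg_right (ha i).1 (sq_nonneg _)
        · calc _ ≤ ∑ i, Lam * ⟪c j, b i⟫ ^ 2 := Finset.sum_le_sum fun i _ =>
              mul_le_mul_of_nonneg_right (ha i).2 (sq_nonneg _)
            _ = Lam := by rw [← Finset.mul_sum, hsum, mul_one]

/-- The Pucci operator is attained by a linear operator with ellipticity in `[lam, Lam]`. -/
theorem exists_sum_eq_pucci {n : ℕ} {lam Lam : ℝ} (hl : lam ≤ Lam) {φ : Euc n → ℝ} {x : Euc n}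
    (h : ContDiffAt ℝ 2 φ x) :
    ∃ (b : OrthonormalBasis (Fin n) ℝ (Euc n)) (a : Fin n → ℝ),
      (∀ i, lam ≤ a i ∧ a i ≤ Lam) ∧
      pucciMax lam Lam (hess φ x) = ∑ i, a i * d2 φ x (b i) := by
  obtain ⟨c, μ, hd, hp⟩ := exists_diag lam Lam h
  refine ⟨c, fun i => if 0 ≤ μ i then Lam else lam, fun i => ?_, ?_⟩
  · dsimp only; split_ifs <;> simp [hl]
  · rw [hp]
    refine Finset.sum_congr rfl fun i _ => ?_
    have : d2 φ x (c i) = μ i := by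
      rw [hd, Finset.sum_eq_single i]
      · simp
      · intro j _ hj
        rw [c.inner_eq_zero hj]; simp
      · simp
    rw [this]
    show _ = (if 0 ≤ μ i then Lam else lam) * μ i
    split_ifs with hi
    · simp [hi]
    · push Not at hi
      simp [hi.le]

/-- Lower bound of the Pucci operator using one distinguished direction. -/
theorem trace_add_le_pucci {n : ℕ} {lam Lam : ℝ} (hl : lam ≤ Lam) {φ : Euc n → ℝ} {x : Euc n}
    (h : ContDiffAt ℝ 2 φ x) {e : Euc n} (he : ‖e‖ ≤ 1)
    (b : OrthonormalBasis (Fin n) ℝ (Euc n)) :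
    lam * ∑ i, d2 φ x (b i) + (Lam - lam) * d2 φ x e ≤ pucciMax lam Lam (hess φ x) := by
  obtain ⟨c, μ, hd, hp⟩ := exists_diag lam Lam h
  rw [hp]
  have hsum : ∀ j, ∑ i, ⟪c j, b i⟫ ^ 2 = 1 := fun j => by
    rw [b.sum_sq_inner_left]; simp
  calc _ = ∑ j, (lam + (Lam - lam) * ⟪c j, e⟫ ^ 2) * μ j := by
        have : ∑ i, d2 φ x (b i) = ∑ j, μ j := by
          simp only [hd]
          rw [Finset.sum_comm]
          exact Finset.sum_congr rfl fun j _ => by rw [← Finset.mul_sum, hsum, mul_one]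
        rw [this, hd, Finset.mul_sum, Finset.mul_sum, ← Finset.sum_add_distrib]
        exact Finset.sum_congr rfl fun j _ => by ring
    _ ≤ _ := by
        refine Finset.sum_le_sum fun j _ => weighted_le_pucci_aux ?_ ?_
        · have := mul_nonneg (sub_nonneg.2 hl) (sq_nonneg ⟪c j, e⟫)
          linarith
        · have h1 : ⟪c j, e⟫ ^ 2 ≤ 1 := by
            have := abs_real_inner_le_norm (c j) e
            rw [c.norm_eq_one, one_mul] at this
            rw [sq_le_one_iff_abs_le_one]; linarith
          nlinarith

theorem pucci_add_le {n : ℕ} {lam Lam : ℝ} (hl : lam ≤ Lam) {φ ψ : Euc n → ℝ} {x : Euc n}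
    (hφ : ContDiffAt ℝ 2 φ x) (hψ : ContDiffAt ℝ 2 ψ x) :
    pucciMax lam Lam (hess (fun y => φ y + ψ y) x) ≤
      pucciMax lam Lam (hess φ x) + pucciMax lam Lam (hess ψ x) := by
  obtain ⟨b, a, ha, he⟩ := exists_sum_eq_pucci hl (hφ.add hψ)
  have hd : ∀ v, d2 (fun y => φ y + ψ y) x v = d2 φ x v + d2 ψ x v := by
    intro v
    have h1 : ∀ᶠ y in 𝓝 x, fderiv ℝ (fun y => φ y + ψ y) y = fderiv ℝ φ y + fderiv ℝ ψ y := by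
      filter_upwards [hφ.eventually (by simp), hψ.eventually (by simp)] with y h1 h2
      exact fderiv_add (h1.differentiableAt (by simp)) (h2.differentiableAt (by simp))
    have h2 : fderiv ℝ (fderiv ℝ (fun y => φ y + ψ y)) x
        = fderiv ℝ (fderiv ℝ φ) x + fderiv ℝ (fderiv ℝ ψ) x := by
      rw [Filter.EventuallyEq.fderiv_eq h1]
      exact fderiv_add
        ((hφ.fderiv_right (m := 1) (by norm_num)).differentiableAt (by simp))
        ((hψ.fderiv_right (m := 1) (by norm_num)).differentiableAt (by simp))
    simp [d2, h2]
  have he' : pucciMax lam Lam (hess (fun y => φ y + ψ y) x)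
      = ∑ i, a i * d2 (fun y => φ y + ψ y) x (b i) := he
  rw [he']
  simp only [hd, mul_add, Finset.sum_add_distrib]
  exact add_le_add (sum_le_pucci hφ b a ha) (sum_le_pucci hψ b a ha)

theorem hess_congr {n : ℕ} {φ ψ : Euc n → ℝ} {x : Euc n} (h : φ =ᶠ[𝓝 x] ψ) :
    hess φ x = hess ψ x := by
  ext i j
  simp only [hess]
  rw [(h.iteratedFDeriv ℝ 2).eq_of_nhds]

theorem exists_contDiff_eventuallyEq {n : ℕ} {φ : Euc n → ℝ} {x : Euc n}
    (h : ContDiffAt ℝ 2 φ x) : ∃ ψ : Euc n → ℝ, ContDiff ℝ 2 ψ ∧ ψ =ᶠ[𝓝 x] φ := by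
  obtain ⟨r, hr, hb⟩ := Metric.eventually_nhds_iff_ball.1 (h.eventually (by simp))
  let f : ContDiffBump x := ⟨r / 4, r / 2, by positivity, by linarith⟩
  refine ⟨fun y => f y * φ y, contDiff_iff_contDiffAt.2 fun y => ?_, ?_⟩
  · by_cases hy : y ∈ ball x r
    · exact (f.contDiff.contDiffAt).mul (hb y hy)
    · have : (fun y => f y * φ y) =ᶠ[𝓝 y] fun _ => 0 := by
        have h1 : y ∉ tsupport f := by
          rw [f.tsupport_eq]
          simp only [mem_ball, mem_closedBall, not_lt, not_le] at hy ⊢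
          change r / 2 < _
          linarith
        filter_upwards [notMem_tsupport_iff_eventuallyEq.1 h1] with z hz
        simp [hz]
      exact contDiffAt_const.congr_of_eventuallyEq this
  · filter_upwards [f.eventuallyEq_one] with y hy
    simp [hy]

theorem ContDiffAt.fderiv_two {n : ℕ} {φ : Euc n → ℝ} {x : Euc n} (h : ContDiffAt ℝ 2 φ x) :
    DifferentiableAt ℝ (fderiv ℝ φ) x :=
  (h.fderiv_right (m := 1) (by norm_num)).differentiableAt (by simp)

/-- The second directional derivative computed along a line. -/
theorem d2_eq_of_hasDerivAt {n : ℕ} {φ : Euc n → ℝ} {x v : Euc n} (h : ContDiffAt ℝ 2 φ x)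
    {g : ℝ → ℝ} {c : ℝ} (h1 : ∀ᶠ t in 𝓝 (0 : ℝ), HasDerivAt (fun s : ℝ => φ (x + s • v)) (g t) t)
    (h2 : HasDerivAt g c 0) : d2 φ x v = c := by
  have hl : ∀ t : ℝ, HasDerivAt (fun s : ℝ => x + s • v) v t := fun t => by
    simpa using ((hasDerivAt_id t).smul_const v).const_add x
  have hc : Tendsto (fun s : ℝ => x + s • v) (𝓝 0) (𝓝 x) := by
    simpa using (hl 0).continuousAt.tendsto
  have h3 : (fun t : ℝ => fderiv ℝ φ (x + t • v) v) =ᶠ[𝓝 0] g := by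
    filter_upwards [h1, hc.eventually (h.eventually (by simp))] with t ht hd
    have := (hd.differentiableAt (by simp)).hasFDerivAt.comp_hasDerivAt t (hl t)
    exact this.unique ht
  have h4 : HasFDerivAt (fderiv ℝ φ) (fderiv ℝ (fderiv ℝ φ) x) (x + (0 : ℝ) • v) := by
    simpa using h.fderiv_two.hasFDerivAt
  have h5 := h4.comp_hasDerivAt (0 : ℝ) (hl 0)
  have h6 : HasDerivAt (fun t : ℝ => fderiv ℝ φ (x + t • v) v)
      (fderiv ℝ (fderiv ℝ φ) x v v) 0 := by
    simpa using h5.clm_apply (hasDerivAt_const (0 : ℝ) v)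
  exact h6.unique (h2.congr_of_eventuallyEq h3)

theorem d2_add {n : ℕ} {φ ψ : Euc n → ℝ} {x : Euc n} (hφ : ContDiffAt ℝ 2 φ x)
    (hψ : ContDiffAt ℝ 2 ψ x) (v : Euc n) :
    d2 (fun y => φ y + ψ y) x v = d2 φ x v + d2 ψ x v := by
  have h1 : ∀ᶠ y in 𝓝 x, fderiv ℝ (fun y => φ y + ψ y) y = fderiv ℝ φ y + fderiv ℝ ψ y := by
    filter_upwards [hφ.eventually (by simp), hψ.eventually (by simp)] with y h1 h2
    exact fderiv_add (h1.differentiableAt (by simp)) (h2.differentiableAt (by simp))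
  have h2 : fderiv ℝ (fderiv ℝ (fun y => φ y + ψ y)) x
      = fderiv ℝ (fderiv ℝ φ) x + fderiv ℝ (fderiv ℝ ψ) x := by
    rw [Filter.EventuallyEq.fderiv_eq h1]
    exact fderiv_add hφ.fderiv_two hψ.fderiv_two
  simp [d2, h2]

theorem d2_comp_affine {n : ℕ} {φ : Euc n → ℝ} {x a : Euc n} (L : Euc n →L[ℝ] Euc n)
    (h : ContDiffAt ℝ 2 φ (a + L x)) (m : ℝ) (v : Euc n) :
    d2 (fun z => m * φ (a + L z)) x v = m * d2 φ (a + L x) (L v) := by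
  have hA : ContDiff ℝ 2 (fun z => a + L z) := contDiff_const.add L.contDiff
  have hφA : ContDiffAt ℝ 2 (fun z => m * φ (a + L z)) x :=
    contDiffAt_const.mul (h.comp x hA.contDiffAt)
  have hl : ∀ t : ℝ, HasDerivAt (fun s : ℝ => (a + L x) + s • L v) (L v) t := fun t => by
    simpa using ((hasDerivAt_id t).smul_const (L v)).const_add (a + L x)
  have hc : Tendsto (fun s : ℝ => (a + L x) + s • L v) (𝓝 0) (𝓝 (a + L x)) := by
    simpa using (hl 0).continuousAt.tendsto
  refine d2_eq_of_hasDerivAt hφA (g := fun t => m * fderiv ℝ φ ((a + L x) + t • L v) (L v)) ?_ ?_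
  · filter_upwards [hc.eventually (h.eventually (by simp))] with t hd
    have := ((hd.differentiableAt (by simp)).hasFDerivAt.comp_hasDerivAt t (hl t)).const_mul m
    exact this.congr_of_eventuallyEq (Eventually.of_forall fun s => by simp [add_assoc])
  · have h4 : HasFDerivAt (fderiv ℝ φ) (fderiv ℝ (fderiv ℝ φ) (a + L x))
        ((a + L x) + (0 : ℝ) • L v) := by
      simpa using h.fderiv_two.hasFDerivAt
    have h5 := h4.comp_hasDerivAt (0 : ℝ) (hl 0)
    have := (h5.clm_apply (hasDerivAt_const (0 : ℝ) (L v))).const_mul m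
    simpa [d2] using this

theorem d2_const_mul {n : ℕ} {φ : Euc n → ℝ} {x : Euc n} (h : ContDiffAt ℝ 2 φ x) (m : ℝ)
    (v : Euc n) : d2 (fun z => m * φ z) x v = m * d2 φ x v := by
  simpa using d2_comp_affine (a := 0) (ContinuousLinearMap.id ℝ (Euc n)) (by simpa using h) m v

theorem d2_smul {n : ℕ} (φ : Euc n → ℝ) (x v : Euc n) (c : ℝ) :
    d2 φ x (c • v) = c ^ 2 * d2 φ x v := by
  simp [d2]; ring

theorem hasDerivAt_norm_sq_line {n : ℕ} (x c v : Euc n) (t : ℝ) :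
    HasDerivAt (fun s : ℝ => ‖x + s • v - c‖ ^ 2) (2 * ⟪x + t • v - c, v⟫) t := by
  have : HasDerivAt (fun s : ℝ => x + s • v - c) v t := by
    simpa using (((hasDerivAt_id t).smul_const v).const_add x).sub_const c
  exact this.norm_sq

/-- Hessian of a function of the squared distance. -/
theorem d2_radial {n : ℕ} {h h' : ℝ → ℝ} {h'' : ℝ} {x c : Euc n}
    (hC : ContDiffAt ℝ 2 h (‖x - c‖ ^ 2))
    (h1 : ∀ᶠ s in 𝓝 (‖x - c‖ ^ 2), HasDerivAt h (h' s) s)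
    (h2 : HasDerivAt h' h'' (‖x - c‖ ^ 2)) (v : Euc n) :
    ContDiffAt ℝ 2 (fun y => h (‖y - c‖ ^ 2)) x ∧
    d2 (fun y => h (‖y - c‖ ^ 2)) x v =
      4 * h'' * ⟪x - c, v⟫ ^ 2 + 2 * h' (‖x - c‖ ^ 2) * ‖v‖ ^ 2 := by
  have hN : ContDiff ℝ 2 (fun y : Euc n => ‖y - c‖ ^ 2) :=
    (contDiff_id.sub contDiff_const).norm_sq ℝ
  have hcd : ContDiffAt ℝ 2 (fun y => h (‖y - c‖ ^ 2)) x := hC.comp x hN.contDiffAt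
  refine ⟨hcd, ?_⟩
  have hl := hasDerivAt_norm_sq_line x c v
  have hc : Tendsto (fun s : ℝ => ‖x + s • v - c‖ ^ 2) (𝓝 0) (𝓝 (‖x - c‖ ^ 2)) := by
    simpa using (hl 0).continuousAt.tendsto
  refine d2_eq_of_hasDerivAt hcd
    (g := fun t => h' (‖x + t • v - c‖ ^ 2) * (2 * ⟪x + t • v - c, v⟫)) ?_ ?_
  · filter_upwards [hc.eventually h1] with t ht
    exact ht.comp t (hl t)
  · have e1 : HasDerivAt (fun s : ℝ => x + s • v - c) v (0 : ℝ) := by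
      simpa using (((hasDerivAt_id (0 : ℝ)).smul_const v).const_add x).sub_const c
    have e2 : HasDerivAt (fun s : ℝ => 2 * ⟪x + s • v - c, v⟫) (2 * ‖v‖ ^ 2) 0 := by
      have := (e1.inner ℝ (hasDerivAt_const (0 : ℝ) v)).const_mul 2
      simpa using this
    have e3 : HasDerivAt (fun s : ℝ => h' (‖x + s • v - c‖ ^ 2))
        (h'' * (2 * ⟪x - c, v⟫)) 0 := by
      have h2' : HasDerivAt h' h'' (‖x + (0 : ℝ) • v - c‖ ^ 2) := by simpa using h2
      exact (h2'.comp (0 : ℝ) (hl 0)).congr_deriv (by simp)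
    exact (e3.mul e2).congr_deriv (by simp; ring)

theorem d2_norm_sq {n : ℕ} (k : ℝ) (x c v : Euc n) :
    d2 (fun y => k * ‖y - c‖ ^ 2) x v = 2 * k * ‖v‖ ^ 2 := by
  have := (d2_radial (h := fun s => k * s) (h' := fun _ => k) (h'' := 0) (x := x) (c := c)
    (by fun_prop) (Eventually.of_forall fun s => by simpa using (hasDerivAt_id s).const_mul k)
    (hasDerivAt_const _ _) v).2
  simpa using this

theorem contDiff_norm_sq_sub {n : ℕ} (k : ℝ) (c : Euc n) :
    ContDiff ℝ 2 (fun y : Euc n => k * ‖y - c‖ ^ 2) :=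
  contDiff_const.mul ((contDiff_id.sub contDiff_const).norm_sq ℝ)

/-- Hessian of a function of one linear coordinate. -/
theorem d2_linear {n : ℕ} {h h' : ℝ → ℝ} {h'' : ℝ} {x e : Euc n}
    (hC : ContDiffAt ℝ 2 h ⟪e, x⟫)
    (h1 : ∀ᶠ s in 𝓝 ⟪e, x⟫, HasDerivAt h (h' s) s)
    (h2 : HasDerivAt h' h'' ⟪e, x⟫) (v : Euc n) :
    ContDiffAt ℝ 2 (fun y => h ⟪e, y⟫) x ∧ d2 (fun y => h ⟪e, y⟫) x v = h'' * ⟪e, v⟫ ^ 2 := by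
  have hN : ContDiff ℝ 2 (fun y : Euc n => ⟪e, y⟫) := contDiff_const.inner ℝ contDiff_id
  have hcd : ContDiffAt ℝ 2 (fun y => h ⟪e, y⟫) x := hC.comp x hN.contDiffAt
  refine ⟨hcd, ?_⟩
  have hl : ∀ t : ℝ, HasDerivAt (fun s : ℝ => ⟪e, x + s • v⟫) ⟪e, v⟫ t := fun t => by
    have e1 : HasDerivAt (fun s : ℝ => x + s • v) v t := by
      simpa using ((hasDerivAt_id t).smul_const v).const_add x
    simpa using (hasDerivAt_const t e).inner ℝ e1
  have hc : Tendsto (fun s : ℝ => ⟪e, x + s • v⟫) (𝓝 0) (𝓝 ⟪e, x⟫) := by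
    simpa using (hl 0).continuousAt.tendsto
  refine d2_eq_of_hasDerivAt hcd (g := fun t => h' ⟪e, x + t • v⟫ * ⟪e, v⟫) ?_ ?_
  · filter_upwards [hc.eventually h1] with t ht
    exact ht.comp t (hl t)
  · have h2' : HasDerivAt h' h'' ⟪e, x + (0 : ℝ) • v⟫ := by simpa using h2
    exact ((h2'.comp (0 : ℝ) (hl 0)).mul_const ⟪e, v⟫).congr_deriv (by ring)

theorem d2_const {n : ℕ} (k : ℝ) (x v : Euc n) : d2 (fun _ => k) x v = 0 := by
  simp [d2]

theorem pucci_le_add_of_d2_le {n : ℕ} {lam Lam : ℝ} (h0 : 0 < lam) (hl : lam ≤ Lam)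
    {φ ψ : Euc n → ℝ} {x y : Euc n} (hφ : ContDiffAt ℝ 2 φ x) (hψ : ContDiffAt ℝ 2 ψ y)
    {k : ℝ} (hk : 0 ≤ k) (h : ∀ v, d2 ψ y v ≤ d2 φ x v + k * ‖v‖ ^ 2) :
    pucciMax lam Lam (hess ψ y) ≤ pucciMax lam Lam (hess φ x) + k * Lam * n := by
  obtain ⟨b, a, ha, he⟩ := exists_sum_eq_pucci hl hψ
  rw [he]
  calc ∑ i, a i * d2 ψ y (b i) ≤ ∑ i, (a i * d2 φ x (b i) + k * Lam) := by
        refine Finset.sum_le_sum fun i _ => ?_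
        have h1 := mul_le_mul_of_nonneg_left (h (b i)) (h0.le.trans (ha i).1)
        rw [b.norm_eq_one] at h1
        nlinarith [mul_le_mul_of_nonneg_left (ha i).2 hk]
    _ ≤ _ := by
        rw [Finset.sum_add_distrib]
        have := sum_le_pucci hφ b a ha
        simp; linarith

theorem pucci_le_of_d2_form {n : ℕ} {lam Lam : ℝ} (h0 : 0 < lam) (hl : lam ≤ Lam)
    {ψ : Euc n → ℝ} {y e : Euc n} (hψ : ContDiffAt ℝ 2 ψ y) (he1 : ‖e‖ = 1)
    {c k : ℝ} (hc : 0 ≤ c) (hk : 0 ≤ k)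
    (h : ∀ v, d2 ψ y v ≤ -c * ⟪e, v⟫ ^ 2 + k * ‖v‖ ^ 2) :
    pucciMax lam Lam (hess ψ y) ≤ -c * lam + k * Lam * n := by
  obtain ⟨b, a, ha, he⟩ := exists_sum_eq_pucci hl hψ
  rw [he]
  calc ∑ i, a i * d2 ψ y (b i) ≤ ∑ i, (-c * lam * ⟪e, b i⟫ ^ 2 + k * Lam) := by
        refine Finset.sum_le_sum fun i _ => ?_
        have h1 := mul_le_mul_of_nonneg_left (h (b i)) (h0.le.trans (ha i).1)
        rw [b.norm_eq_one] at h1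
        have h2 := mul_le_mul_of_nonneg_left (ha i).1 (mul_nonneg hc (sq_nonneg ⟪e, b i⟫))
        nlinarith [mul_le_mul_of_nonneg_left (ha i).2 hk]
    _ = _ := by
        rw [Finset.sum_add_distrib, ← Finset.mul_sum, b.sum_sq_inner_left, he1]
        simp; ring

theorem pucci_le_of_d2_isometry {n : ℕ} {lam Lam : ℝ} (hl : lam ≤ Lam)
    {φ ψ : Euc n → ℝ} {x y : Euc n} (hφ : ContDiffAt ℝ 2 φ x) (hψ : ContDiffAt ℝ 2 ψ y)
    {k : ℝ} (hk : 0 ≤ k) (Q : Euc n ≃ₗᵢ[ℝ] Euc n) (h : ∀ v, d2 ψ y v = k * d2 φ x (Q v)) :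
    pucciMax lam Lam (hess ψ y) ≤ k * pucciMax lam Lam (hess φ x) := by
  obtain ⟨b, a, ha, he⟩ := exists_sum_eq_pucci hl hψ
  rw [he]
  have := mul_le_mul_of_nonneg_left (sum_le_pucci hφ (b.map Q) a ha) hk
  refine le_trans (le_of_eq ?_) this
  rw [Finset.mul_sum]
  refine Finset.sum_congr rfl fun i _ => ?_
  simp [h]; ring

theorem pucci_comp_le {n : ℕ} {lam Lam : ℝ} (hl : lam ≤ Lam) {φ : Euc n → ℝ} {x a : Euc n}
    (Q : Euc n ≃ₗᵢ[ℝ] Euc n) {m c : ℝ} (hm : 0 ≤ m) (h : ContDiffAt ℝ 2 φ (a + c • Q x)) :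
    ContDiffAt ℝ 2 (fun z => m * φ (a + c • Q z)) x ∧
    pucciMax lam Lam (hess (fun z => m * φ (a + c • Q z)) x) ≤
      m * c ^ 2 * pucciMax lam Lam (hess φ (a + c • Q x)) := by
  let L : Euc n →L[ℝ] Euc n := c • (Q.toContinuousLinearEquiv : Euc n →L[ℝ] Euc n)
  have hL : ∀ z, L z = c • Q z := fun z => rfl
  have hA : ContDiff ℝ 2 (fun z => a + L z) := contDiff_const.add L.contDiff
  have hφA : ContDiffAt ℝ 2 (fun z => m * φ (a + L z)) x :=
    contDiffAt_const.mul (h.comp x hA.contDiffAt)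
  refine ⟨hφA, pucci_le_of_d2_isometry hl h hφA (by positivity) Q fun v => ?_⟩
  rw [d2_comp_affine L h, hL, hL, d2_smul]; ring

/-- Upper semicontinuity of the Pucci operator along a `C²` function. -/
theorem eventually_abs_d2_sub_le {n : ℕ} {φ : Euc n → ℝ} {x : Euc n} (h : ContDiffAt ℝ 2 φ x)
    {k : ℝ} (hk : 0 < k) : ∀ᶠ y in 𝓝 x, ∀ v, |d2 φ y v - d2 φ x v| ≤ k * ‖v‖ ^ 2 := by
  have hc : ContinuousAt (fderiv ℝ (fderiv ℝ φ)) x :=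
    ((h.fderiv_right (m := 1) (by norm_num)).fderiv_right (m := 0) (by norm_num)).continuousAt
  filter_upwards [hc.eventually (Metric.ball_mem_nhds (fderiv ℝ (fderiv ℝ φ) x) hk)] with y hd v
  replace hd : ‖fderiv ℝ (fderiv ℝ φ) y - fderiv ℝ (fderiv ℝ φ) x‖ < k := by
    have h := @dist_eq_norm (Euc n →L[ℝ] Euc n →L[ℝ] ℝ)
      ContinuousLinearMap.toSeminormedAddCommGroup
      (fderiv ℝ (fderiv ℝ φ) y) (fderiv ℝ (fderiv ℝ φ) x)
    exact lt_of_eq_of_lt h.symm hd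
  have h1 := (fderiv ℝ (fderiv ℝ φ) y - fderiv ℝ (fderiv ℝ φ) x).le_opNorm₂ v v
  have h2 : (fderiv ℝ (fderiv ℝ φ) y - fderiv ℝ (fderiv ℝ φ) x) v v
    = d2 φ y v - d2 φ x v := by simp [d2]
  rw [h2, Real.norm_eq_abs] at h1
  nlinarith [mul_le_mul_of_nonneg_right hd.le (sq_nonneg ‖v‖)]

theorem eventually_pucci_near {n : ℕ} {lam Lam : ℝ} (h0 : 0 < lam) (hl : lam ≤ Lam)
    {φ : Euc n → ℝ} {x : Euc n} (h : ContDiffAt ℝ 2 φ x) {ε : ℝ} (hε : 0 < ε) :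
    ∀ᶠ y in 𝓝 x, pucciMax lam Lam (hess φ y) ≤ pucciMax lam Lam (hess φ x) + ε ∧
      pucciMax lam Lam (hess φ x) ≤ pucciMax lam Lam (hess φ y) + ε := by
  have hL : 0 < Lam := h0.trans_le hl
  set k := ε / (Lam * (n + 1)) with hk
  have hk0 : 0 < k := by positivity
  have hkε : k * Lam * n ≤ ε := by
    rw [hk, div_mul_eq_mul_div, div_mul_eq_mul_div, div_le_iff₀ (by positivity)]
    nlinarith [mul_pos hε hL]
  filter_upwards [h.eventually (by simp), eventually_abs_d2_sub_le h hk0] with y hy hd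
  constructor
  · refine (pucci_le_add_of_d2_le h0 hl h hy hk0.le fun v => ?_).trans (by linarith)
    linarith [abs_le.1 (hd v)]
  · refine (pucci_le_add_of_d2_le h0 hl hy h hk0.le fun v => ?_).trans (by linarith)
    linarith [abs_le.1 (hd v)]

theorem eventually_pucci_le {n : ℕ} {lam Lam : ℝ} (h0 : 0 < lam) (hl : lam ≤ Lam)
    {φ : Euc n → ℝ} {x : Euc n} (h : ContDiffAt ℝ 2 φ x) {ε : ℝ} (hε : 0 < ε) :
    ∀ᶠ y in 𝓝 x, pucciMax lam Lam (hess φ y) ≤ pucciMax lam Lam (hess φ x) + ε :=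
  (eventually_pucci_near h0 hl h hε).mono fun _ h => h.1

/-- Pointwise viscosity subsolution property of `M⁺(D²u) + γ = 0` at `x`. -/
def SubAt (lam Lam : ℝ) {n : ℕ} (u : Euc n → ℝ) (x : Euc n) (γ : ℝ) : Prop :=
  ∀ φ : Euc n → ℝ, ContDiffAt ℝ 2 φ x → IsLocalMax (fun y => u y - φ y) x →
    0 ≤ pucciMax lam Lam (hess φ x) + γ

/-- Pointwise viscosity supersolution property of `M⁺(D²u) + γ = 0` at `x`. -/
def SuperAt (lam Lam : ℝ) {n : ℕ} (u : Euc n → ℝ) (x : Euc n) (γ : ℝ) : Prop :=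
  ∀ φ : Euc n → ℝ, ContDiffAt ℝ 2 φ x → IsLocalMin (fun y => u y - φ y) x →
    pucciMax lam Lam (hess φ x) + γ ≤ 0

theorem PucciSubsol.subAt {lam Lam : ℝ} {n : ℕ} {Ω : Set (Euc n)} {u g : Euc n → ℝ}
    (h : PucciSubsol lam Lam Ω u g) {x : Euc n} (hx : x ∈ Ω) : SubAt lam Lam u x (g x) := by
  intro φ hφ hm
  obtain ⟨ψ, hψ, he⟩ := exists_contDiff_eventuallyEq hφ
  rw [← hess_congr he]
  exact h x hx ψ hψ (hm.congr (by filter_upwards [he] with y hy; rw [hy]))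

theorem PucciSupersol.superAt {lam Lam : ℝ} {n : ℕ} {Ω : Set (Euc n)} {u g : Euc n → ℝ}
    (h : PucciSupersol lam Lam Ω u g) {x : Euc n} (hx : x ∈ Ω) : SuperAt lam Lam u x (g x) := by
  intro φ hφ hm
  obtain ⟨ψ, hψ, he⟩ := exists_contDiff_eventuallyEq hφ
  rw [← hess_congr he]
  exact h x hx ψ hψ (hm.congr (by filter_upwards [he] with y hy; rw [hy]))

theorem SubAt.congr {lam Lam : ℝ} {n : ℕ} {u v : Euc n → ℝ} {x : Euc n} {γ : ℝ}
    (h : SubAt lam Lam u x γ) (he : u =ᶠ[𝓝 x] v) : SubAt lam Lam v x γ :=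
  fun φ hφ hm => h φ hφ (hm.congr (by filter_upwards [he] with y hy; rw [hy]))

theorem SuperAt.congr {lam Lam : ℝ} {n : ℕ} {u v : Euc n → ℝ} {x : Euc n} {γ : ℝ}
    (h : SuperAt lam Lam u x γ) (he : u =ᶠ[𝓝 x] v) : SuperAt lam Lam v x γ :=
  fun φ hφ hm => h φ hφ (hm.congr (by filter_upwards [he] with y hy; rw [hy]))

theorem SuperAt.mono {lam Lam : ℝ} {n : ℕ} {u : Euc n → ℝ} {x : Euc n} {γ γ' : ℝ}
    (h : SuperAt lam Lam u x γ) (hγ : γ' ≤ γ) : SuperAt lam Lam u x γ' :=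
  fun φ hφ hm => by linarith [h φ hφ hm]

theorem SubAt.mono {lam Lam : ℝ} {n : ℕ} {u : Euc n → ℝ} {x : Euc n} {γ γ' : ℝ}
    (h : SubAt lam Lam u x γ) (hγ : γ ≤ γ') : SubAt lam Lam u x γ' :=
  fun φ hφ hm => by linarith [h φ hφ hm]

section scaling

variable {lam Lam : ℝ} {n : ℕ} {u : Euc n → ℝ} {a x : Euc n} {m c γ : ℝ}

theorem pullback_test (hl : lam ≤ Lam) (hm : 0 < m) (hc : c ≠ 0) {φ : Euc n → ℝ}
    (hφ : ContDiffAt ℝ 2 φ x) :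
    ∃ ψ : Euc n → ℝ, ContDiffAt ℝ 2 ψ (a + c • x) ∧ (∀ z, φ z = m * ψ (a + c • z)) ∧
      (∀ y, ψ y = m⁻¹ * φ (c⁻¹ • (y - a))) ∧
      pucciMax lam Lam (hess φ x) = m * c ^ 2 * pucciMax lam Lam (hess ψ (a + c • x)) := by
  have e : ∀ z, -(c⁻¹ • a) + c⁻¹ • (LinearIsometryEquiv.refl ℝ (Euc n)) (a + c • z) = z := by
    intro z
    simp [smul_add, smul_smul, inv_mul_cancel₀ hc]
  have h1 := pucci_comp_le (φ := φ) (x := a + c • x) (a := -(c⁻¹ • a)) hl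
    (LinearIsometryEquiv.refl ℝ (Euc n)) (m := m⁻¹) (c := c⁻¹) (by positivity) (by rwa [e])
  rw [e] at h1
  set ψ : Euc n → ℝ :=
    fun z => m⁻¹ * φ (-(c⁻¹ • a) + c⁻¹ • (LinearIsometryEquiv.refl ℝ (Euc n)) z) with hψ
  have e2 : ∀ z, φ z = m * ψ (a + c • z) := fun z => by
    simp only [hψ]; rw [e, mul_inv_cancel_left₀ hm.ne']
  refine ⟨ψ, h1.1, e2, fun y => ?_, le_antisymm ?_ ?_⟩
  · simp only [hψ, LinearIsometryEquiv.coe_refl, id_eq, smul_sub]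
    congr 2; abel
  · have h2 := (pucci_comp_le (φ := ψ) (x := x) (a := a) hl
      (LinearIsometryEquiv.refl ℝ (Euc n)) (m := m) (c := c) hm.le h1.1).2
    simp only [LinearIsometryEquiv.coe_refl, id_eq, ← e2] at h2
    exact h2
  · have h2 := mul_le_mul_of_nonneg_left h1.2 (show 0 ≤ m * c ^ 2 by positivity)
    refine h2.trans (le_of_eq ?_)
    field_simp

theorem tendsto_affine_inv (hc : c ≠ 0) :
    Tendsto (fun y => c⁻¹ • (y - a)) (𝓝 (a + c • x)) (𝓝 x) := by
  have : Continuous fun y : Euc n => c⁻¹ • (y - a) := by fun_prop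
  have h := this.tendsto (a + c • x)
  simpa [smul_smul, inv_mul_cancel₀ hc] using h

theorem SubAt.scale (hl : lam ≤ Lam) (hm : 0 < m) (hc : c ≠ 0) (h : SubAt lam Lam u (a + c • x) γ) :
    SubAt lam Lam (fun z => m * u (a + c • z)) x (m * c ^ 2 * γ) := by
  intro φ hφ hmax
  obtain ⟨ψ, h1, h2, -, h3⟩ := pullback_test (a := a) hl hm hc hφ
  have h4 := h ψ h1 (by
    have := (tendsto_affine_inv (a := a) (x := x) hc).eventually hmax
    filter_upwards [this] with y hy
    simp only [h2, smul_smul, mul_inv_cancel₀ hc, one_smul, add_sub_cancel] at hy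
    nlinarith)
  rw [h3]
  nlinarith [mul_nonneg (show 0 ≤ m * c ^ 2 by positivity) h4]

theorem SuperAt.scale (hl : lam ≤ Lam) (hm : 0 < m) (hc : c ≠ 0)
    (h : SuperAt lam Lam u (a + c • x) γ) :
    SuperAt lam Lam (fun z => m * u (a + c • z)) x (m * c ^ 2 * γ) := by
  intro φ hφ hmax
  obtain ⟨ψ, h1, h2, -, h3⟩ := pullback_test (a := a) hl hm hc hφ
  have h4 := h ψ h1 (by
    have := (tendsto_affine_inv (a := a) (x := x) hc).eventually hmax
    filter_upwards [this] with y hy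
    simp only [h2, smul_smul, mul_inv_cancel₀ hc, one_smul, add_sub_cancel] at hy
    nlinarith)
  rw [h3]
  nlinarith [mul_nonneg (show 0 ≤ m * c ^ 2 by positivity) (neg_nonneg.2 h4)]

end scaling

/-- A continuous function on a closed ball whose value at the centre is smaller than on the
sphere has an interior minimum. -/
theorem exists_interior_min {n : ℕ} {w : Euc n → ℝ} {x₀ : Euc n} {r : ℝ} (hr : 0 < r)
    (hw : ContinuousOn w (closedBall x₀ r)) (h : ∀ x ∈ sphere x₀ r, w x₀ < w x) :
    ∃ x ∈ ball x₀ r, (∀ y ∈ closedBall x₀ r, w x ≤ w y) ∧ IsLocalMin w x := by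
  obtain ⟨x, hx, hmin⟩ := (isCompact_closedBall x₀ r).exists_isMinOn ⟨x₀, by simp [hr.le]⟩ hw
  have hxb : x ∈ ball x₀ r := by
    by_contra hn
    have h1 : x ∈ sphere x₀ r := by
      simp only [mem_ball, not_lt, mem_closedBall, mem_sphere] at *
      exact le_antisymm hx hn
    exact absurd (hmin (show x₀ ∈ closedBall x₀ r by simp [hr.le])) (not_le.2 (h x h1))
  exact ⟨x, hxb, hmin, hmin.isLocalMin (closedBall_mem_nhds_of_mem hxb)⟩

theorem exists_interior_max {n : ℕ} {w : Euc n → ℝ} {x₀ : Euc n} {r : ℝ} (hr : 0 < r)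
    (hw : ContinuousOn w (closedBall x₀ r)) (h : ∀ x ∈ sphere x₀ r, w x < w x₀) :
    ∃ x ∈ ball x₀ r, (∀ y ∈ closedBall x₀ r, w y ≤ w x) ∧ IsLocalMax w x := by
  obtain ⟨x, hx, hm, hl⟩ := exists_interior_min (w := fun x => - w x) hr hw.neg
    fun x hx => neg_lt_neg (h x hx)
  exact ⟨x, hx, fun y hy => neg_le_neg_iff.1 (hm y hy), by simpa using hl.neg⟩

theorem d2_nonpos_of_isLocalMax {n : ℕ} {φ : Euc n → ℝ} {x : Euc n} (h : ContDiffAt ℝ 2 φ x)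
    (hm : IsLocalMax φ x) (v : Euc n) : d2 φ x v ≤ 0 := by
  by_contra! hpos
  have hl : ∀ t : ℝ, HasDerivAt (fun s : ℝ => x + s • v) v t := fun t => by
    simpa using ((hasDerivAt_id t).smul_const v).const_add x
  have hc : Tendsto (fun s : ℝ => x + s • v) (𝓝 0) (𝓝 x) := by
    simpa using (hl 0).continuousAt.tendsto
  have h1 : ∀ᶠ t in 𝓝 (0 : ℝ), HasDerivAt (fun s : ℝ => φ (x + s • v))
      (fderiv ℝ φ (x + t • v) v) t := by
    filter_upwards [hc.eventually (h.eventually (by simp))] with t hd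
    exact (hd.differentiableAt (by simp)).hasFDerivAt.comp_hasDerivAt t (hl t)
  have h4 : HasFDerivAt (fderiv ℝ φ) (fderiv ℝ (fderiv ℝ φ) x) (x + (0 : ℝ) • v) := by
    simpa using h.fderiv_two.hasFDerivAt
  have h5 := h4.comp_hasDerivAt (0 : ℝ) (hl 0)
  have h6 : HasDerivAt (fun t : ℝ => fderiv ℝ φ (x + t • v) v)
      (fderiv ℝ (fderiv ℝ φ) x v v) 0 := by
    simpa using h5.clm_apply (hasDerivAt_const (0 : ℝ) v)
  change 0 < fderiv ℝ (fderiv ℝ φ) x v v at hpos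
  have hdd : deriv (fun s : ℝ => φ (x + s • v)) =ᶠ[𝓝 0] fun t => fderiv ℝ φ (x + t • v) v := by
    filter_upwards [h1] with t ht using ht.deriv
  have hmax : IsLocalMax (fun s : ℝ => φ (x + s • v)) 0 := by
    have := hc.eventually hm
    simpa [IsLocalMax, IsMaxFilter] using this
  have hmin : IsLocalMin (fun s : ℝ => φ (x + s • v)) 0 := by
    refine isLocalMin_of_deriv_deriv_pos ?_ hmax.deriv_eq_zero h1.self_of_nhds.continuousAt
    rw [hdd.deriv_eq, h6.deriv]; exact hpos
  have hconst : (fun s : ℝ => φ (x + s • v)) =ᶠ[𝓝 0] fun _ => φ (x + (0 : ℝ) • v) := by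
    filter_upwards [hmax, hmin] with t a b using le_antisymm a b
  have h7 : (fun t : ℝ => fderiv ℝ φ (x + t • v) v) =ᶠ[𝓝 0] fun _ => 0 := by
    refine hdd.symm.trans (hconst.deriv.trans ?_)
    simp [Filter.EventuallyEq.refl]
  have := h6.unique ((hasDerivAt_const (0 : ℝ) (0 : ℝ)).congr_of_eventuallyEq h7)
  linarith

section polynomials

open MvPolynomial

variable {n : ℕ}

theorem totalDegree_pderiv_le {p : MvPolynomial (Fin n) ℝ} {d : ℕ} (i : Fin n)
    (h : p.totalDegree ≤ d + 1) : (pderiv i p).totalDegree ≤ d := by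
  rw [totalDegree, Finset.sup_le_iff]
  intro s hs
  rw [mem_support_iff, coeff_pderiv] at hs
  have h1 : s + Finsupp.single i 1 ∈ p.support := mem_support_iff.2 (left_ne_zero_of_mul hs)
  have h2 := (le_totalDegree h1).trans h
  rw [Finsupp.sum_add_index' (by simp) (by simp)] at h2
  simp at h2
  exact h2

/-- The function on Euclidean space attached to a polynomial in the coordinates with respect to an
orthonormal basis centred at `c`. -/
noncomputable def polyFun (b : OrthonormalBasis (Fin n) ℝ (Euc n)) (c : Euc n)
    (p : MvPolynomial (Fin n) ℝ) (x : Euc n) : ℝ :=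
  eval (fun i => ⟪b i, x - c⟫) p

theorem contDiff_polyFun (b : OrthonormalBasis (Fin n) ℝ (Euc n)) (c : Euc n)
    (p : MvPolynomial (Fin n) ℝ) {m : WithTop ℕ∞} : ContDiff ℝ m (polyFun b c p) := by
  unfold polyFun
  induction p using MvPolynomial.induction_on with
  | C a => simpa using contDiff_const
  | add p q hp hq => simpa using hp.add hq
  | mul_X p i hp =>
    simp only [map_mul, eval_X]
    exact hp.mul (contDiff_const.inner ℝ (contDiff_id.sub contDiff_const))

theorem hasDerivAt_polyFun (b : OrthonormalBasis (Fin n) ℝ (Euc n)) (c x : Euc n)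
    (p : MvPolynomial (Fin n) ℝ) (j : Fin n) (t : ℝ) :
    HasDerivAt (fun s : ℝ => polyFun b c p (x + s • b j))
      (polyFun b c (pderiv j p) (x + t • b j)) t := by
  unfold polyFun
  induction p using MvPolynomial.induction_on with
  | C a => simpa using hasDerivAt_const t a
  | add p q hp hq =>
    simp only [map_add]
    exact hp.add hq
  | mul_X p i hp =>
    have h1 : HasDerivAt (fun s : ℝ => ⟪b i, x + s • b j - c⟫) ⟪b i, b j⟫ t := by
      have : HasDerivAt (fun s : ℝ => x + s • b j - c) (b j) t := by
        simpa using (((hasDerivAt_id t).smul_const (b j)).const_add x).sub_const c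
      simpa using (hasDerivAt_const t (b i)).inner ℝ this
    have h2 := hp.mul h1
    simp only [map_mul, eval_X, Derivation.leibniz, smul_eq_mul, map_add, pderiv_X]
    refine h2.congr_deriv ?_
    have : ⟪b i, b j⟫ = eval (fun i => ⟪b i, x + t • b j - c⟫)
        (Pi.single (M := fun _ => MvPolynomial (Fin n) ℝ) j 1 i) := by
      by_cases hij : i = j
      · subst hij; simp
      · simp [hij, b.inner_eq_zero hij]
    rw [this]; ring

/-- The constant-coefficient linear operator `∑ aᵢ ∂²/∂bᵢ²`. -/
noncomputable def linOp (b : OrthonormalBasis (Fin n) ℝ (Euc n)) (a : Fin n → ℝ)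
    (φ : Euc n → ℝ) (x : Euc n) : ℝ :=
  ∑ i, a i * d2 φ x (b i)

/-- The algebraic counterpart of `linOp`. -/
noncomputable def polyOp (a : Fin n → ℝ) :
    MvPolynomial (Fin n) ℝ →ₗ[ℝ] MvPolynomial (Fin n) ℝ :=
  ∑ i, a i • ((pderiv (R := ℝ) i : MvPolynomial (Fin n) ℝ →ₗ[ℝ] MvPolynomial (Fin n) ℝ) ∘ₗ
    (pderiv (R := ℝ) i : MvPolynomial (Fin n) ℝ →ₗ[ℝ] MvPolynomial (Fin n) ℝ))

theorem polyOp_apply (a : Fin n → ℝ) (p : MvPolynomial (Fin n) ℝ) :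
    polyOp a p = ∑ i, a i • pderiv i (pderiv i p) := by
  simp [polyOp]

theorem linOp_polyFun (b : OrthonormalBasis (Fin n) ℝ (Euc n)) (a : Fin n → ℝ) (c x : Euc n)
    (p : MvPolynomial (Fin n) ℝ) : linOp b a (polyFun b c p) x = polyFun b c (polyOp a p) x := by
  have : ∀ i, d2 (polyFun b c p) x (b i) = polyFun b c (pderiv i (pderiv i p)) x := fun i =>
    d2_eq_of_hasDerivAt (contDiff_polyFun b c p).contDiffAt
      (Eventually.of_forall fun t => hasDerivAt_polyFun b c x p i t)
      (by simpa using hasDerivAt_polyFun b c x (pderiv i p) i 0)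
  rw [polyOp_apply]
  simp [linOp, this, polyFun, map_sum, smul_eval]

theorem linOp_nonpos_of_isLocalMax (b : OrthonormalBasis (Fin n) ℝ (Euc n)) {a : Fin n → ℝ}
    (ha : ∀ i, 0 < a i) {φ : Euc n → ℝ} {x : Euc n} (h : ContDiffAt ℝ 2 φ x)
    (hm : IsLocalMax φ x) : linOp b a φ x ≤ 0 :=
  Finset.sum_nonpos fun i _ =>
    mul_nonpos_of_nonneg_of_nonpos (ha i).le (d2_nonpos_of_isLocalMax h hm (b i))

theorem linOp_add (b : OrthonormalBasis (Fin n) ℝ (Euc n)) (a : Fin n → ℝ)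
    {φ ψ : Euc n → ℝ} {x : Euc n} (h : ContDiffAt ℝ 2 φ x) (h' : ContDiffAt ℝ 2 ψ x) :
    linOp b a (fun y => φ y + ψ y) x = linOp b a φ x + linOp b a ψ x := by
  simp [linOp, d2_add h h', mul_add, Finset.sum_add_distrib]

theorem linOp_const_mul (b : OrthonormalBasis (Fin n) ℝ (Euc n)) (a : Fin n → ℝ)
    {φ : Euc n → ℝ} {x : Euc n} (h : ContDiffAt ℝ 2 φ x) (m : ℝ) :
    linOp b a (fun y => m * φ y) x = m * linOp b a φ x := by
  simp only [linOp, d2_const_mul h, Finset.mul_sum]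
  exact Finset.sum_congr rfl fun i _ => by ring

theorem linOp_const (b : OrthonormalBasis (Fin n) ℝ (Euc n)) (a : Fin n → ℝ) (k : ℝ) (x : Euc n) :
    linOp b a (fun _ => k) x = 0 := by
  simp [linOp, d2_const]

theorem linOp_norm_sq (b : OrthonormalBasis (Fin n) ℝ (Euc n)) (a : Fin n → ℝ) (k : ℝ)
    (c x : Euc n) : linOp b a (fun y => k * ‖y - c‖ ^ 2) x = 2 * k * ∑ i, a i := by
  simp only [linOp, d2_norm_sq, Finset.mul_sum, b.norm_eq_one]
  exact Finset.sum_congr rfl fun i _ => by ring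

theorem sum_pos_of_forall_pos (hn : 0 < n) {a : Fin n → ℝ} (ha : ∀ i, 0 < a i) :
    0 < ∑ i, a i :=
  Finset.sum_pos (fun i _ => ha i) ⟨⟨0, hn⟩, by simp⟩

theorem linOp_maximum_principle (hn : 0 < n) (b : OrthonormalBasis (Fin n) ℝ (Euc n))
    {a : Fin n → ℝ} (ha : ∀ i, 0 < a i) {w : Euc n → ℝ} (hw : ContDiff ℝ 2 w) {c : Euc n} {r : ℝ}
    (hL : ∀ x ∈ ball c r, 0 ≤ linOp b a w x) (hs : ∀ x ∈ sphere c r, w x ≤ 0) :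
    ∀ x ∈ closedBall c r, w x ≤ 0 := by
  intro x₁ hx₁
  by_contra! hpos
  set ε := w x₁ / (2 * (r ^ 2 + 1)) with hε
  have hε0 : 0 < ε := by positivity
  have hεr : ε * r ^ 2 < w x₁ := by
    rw [hε, div_mul_eq_mul_div, div_lt_iff₀ (by positivity)]
    nlinarith [sq_nonneg r]
  have hφ : ContDiff ℝ 2 (fun y => w y + ε * ‖y - c‖ ^ 2) := hw.add (contDiff_norm_sq_sub ε c)
  obtain ⟨z, hz, hzmax⟩ := (isCompact_closedBall c r).exists_isMaxOn ⟨x₁, hx₁⟩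
    hφ.continuous.continuousOn
  have h1 := hzmax hx₁
  simp only [Set.mem_ofPred_eq] at h1
  have hzb : z ∈ ball c r := by
    by_contra hn
    have h2 : ‖z - c‖ = r := by
      simp only [mem_ball, not_lt, mem_closedBall, dist_eq_norm] at *
      exact le_antisymm hz hn
    have h3 := hs z (by simpa [dist_eq_norm] using h2)
    rw [h2] at h1
    nlinarith [mul_nonneg hε0.le (sq_nonneg ‖x₁ - c‖)]
  have h4 := linOp_nonpos_of_isLocalMax b ha hφ.contDiffAt
    (hzmax.isLocalMax (closedBall_mem_nhds_of_mem hzb))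
  rw [linOp_add b a hw.contDiffAt (contDiff_norm_sq_sub ε c).contDiffAt, linOp_norm_sq] at h4
  have := hL z hzb
  have := mul_pos (mul_pos two_pos hε0) (sum_pos_of_forall_pos hn ha)
  linarith

theorem polyFun_sum_sq (b : OrthonormalBasis (Fin n) ℝ (Euc n)) (c x : Euc n) :
    polyFun b c (∑ i, X i ^ 2) x = ‖x - c‖ ^ 2 := by
  simp [polyFun, b.sum_sq_inner_right]

theorem eq_zero_of_polyFun_ball (b : OrthonormalBasis (Fin n) ℝ (Euc n)) (c : Euc n) {r : ℝ}
    (hr : 0 < r) {p : MvPolynomial (Fin n) ℝ} (h : ∀ x ∈ ball c r, polyFun b c p x = 0) :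
    p = 0 := by
  have hc : Continuous (fun y : Fin n → ℝ => c + ∑ i, y i • b i) := by fun_prop
  have h0 : (fun y : Fin n → ℝ => c + ∑ i, y i • b i) 0 = c := by simp
  have hnear := hc.continuousAt.eventually (show ball c r ∈ 𝓝 ((fun y : Fin n → ℝ =>
    c + ∑ i, y i • b i) 0) by rw [h0]; exact ball_mem_nhds c hr)
  obtain ⟨δ, hδ, hb⟩ := Metric.eventually_nhds_iff.1 hnear
  refine funext_set (fun _ => ball (0 : ℝ) δ) (fun _ => ?_) fun y hy => ?_
  · exact (infinite_of_mem_nhds (0 : ℝ) (ball_mem_nhds 0 hδ))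
  · have h1 : dist y 0 < δ := by
      rw [dist_pi_lt_iff hδ]; intro i
      simpa using hy i (Set.mem_univ i)
    have h2 := h _ (hb h1)
    simp only [polyFun, add_sub_cancel_left] at h2
    have h3 : (fun i => ⟪b i, ∑ j, y j • b j⟫) = y := by
      ext i
      rw [inner_sum, Finset.sum_eq_single i]
      · simp [inner_smul_right]
      · intro j _ hj; simp [inner_smul_right, b.inner_eq_zero hj.symm]
      · simp
    rw [h3] at h2
    simpa using h2

/-- Solvability of the Dirichlet problem in a ball for polynomial data. -/
theorem exists_polyOp_eq (hn : 0 < n) {a : Fin n → ℝ} (ha : ∀ i, 0 < a i) {r : ℝ} (hr : 0 < r)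
    (f : MvPolynomial (Fin n) ℝ) :
    ∃ q, polyOp a ((C (r ^ 2) - ∑ i, X i ^ 2) * q) = f := by
  set d := f.totalDegree
  have hS : (C (r ^ 2) - ∑ i, X i ^ 2 : MvPolynomial (Fin n) ℝ).totalDegree ≤ 2 := by
    refine (totalDegree_sub _ _).trans (max_le (by rw [totalDegree_C]; exact Nat.zero_le _) ?_)
    refine (totalDegree_finsetSum _ _).trans (Finset.sup_le fun i _ => ?_)
    exact (totalDegree_pow _ _).trans (by simp)
  let T : restrictTotalDegree (Fin n) ℝ d →ₗ[ℝ] restrictTotalDegree (Fin n) ℝ d :=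
    { toFun := fun q => ⟨polyOp a ((C (r ^ 2) - ∑ i, X i ^ 2) * (q : MvPolynomial (Fin n) ℝ)), by
        rw [mem_restrictTotalDegree, polyOp_apply]
        have hq := (mem_restrictTotalDegree _ _ _).1 q.2
        have h1 := (totalDegree_mul (C (r ^ 2) - ∑ i, X i ^ 2) (q : MvPolynomial (Fin n) ℝ)).trans
          (add_le_add hS hq)
        refine (totalDegree_finsetSum _ _).trans (Finset.sup_le fun i _ => ?_)
        refine (totalDegree_smul_le _ _).trans (totalDegree_pderiv_le i (totalDegree_pderiv_le i ?_))
        omega⟩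
      map_add' := fun q q' => by ext1; simp only [Submodule.coe_add, mul_add, map_add]
      map_smul' := fun k q => by ext1; simp only [Submodule.coe_smul, mul_smul_comm, map_smul, RingHom.id_apply] }
  have hinj : Function.Injective T := by
    rw [← LinearMap.ker_eq_bot, LinearMap.ker_eq_bot']
    intro q hq
    have hq' : polyOp a ((C (r ^ 2) - ∑ i, X i ^ 2) * (q : MvPolynomial (Fin n) ℝ)) = 0 := congrArg Subtype.val hq
    let b := EuclideanSpace.basisFun (Fin n) ℝ
    have hfac : ∀ q' : MvPolynomial (Fin n) ℝ, ∀ x, polyFun b 0 ((C (r ^ 2) - ∑ i, X i ^ 2) * q') x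
        = (r ^ 2 - ‖x‖ ^ 2) * polyFun b 0 q' x := by
      intro q' x
      have := polyFun_sum_sq b 0 x
      simp only [polyFun, sub_zero] at this ⊢
      rw [map_mul, map_sub, this, eval_C]
    have hmax : ∀ q' : MvPolynomial (Fin n) ℝ, polyOp a ((C (r ^ 2) - ∑ i, X i ^ 2) * q') = 0 →
        ∀ x ∈ closedBall (0 : Euc n) r, (r ^ 2 - ‖x‖ ^ 2) * polyFun b 0 q' x ≤ 0 := by
      intro q' hq' x hx
      rw [← hfac]
      refine linOp_maximum_principle hn b ha (contDiff_polyFun b 0 _) (fun z _ => ?_)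
        (fun z hz => ?_) x hx
      · rw [linOp_polyFun, hq']; simp [polyFun]
      · rw [hfac]
        simp only [mem_sphere_zero_iff_norm] at hz
        simp [hz]
    have hz : (q : MvPolynomial (Fin n) ℝ) = 0 := by
      refine eq_zero_of_polyFun_ball b 0 hr fun x hx => ?_
      have h1 := hmax q hq' x (ball_subset_closedBall hx)
      have h2 := hmax (-q) (by rw [mul_neg, map_neg, hq', neg_zero]) x (ball_subset_closedBall hx)
      have h3 : polyFun b 0 (-(q : MvPolynomial (Fin n) ℝ)) x = - polyFun b 0 q x := by
        simp [polyFun]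
      rw [h3] at h2
      have h4 : 0 < r ^ 2 - ‖x‖ ^ 2 := by
        simp only [mem_ball_zero_iff] at hx
        nlinarith [norm_nonneg x]
      have h5 : (r ^ 2 - ‖x‖ ^ 2) * polyFun b 0 q x = 0 := by linarith
      exact (mul_eq_zero.1 h5).resolve_left h4.ne'
    exact Subtype.ext hz
  obtain ⟨q, hq⟩ := LinearMap.injective_iff_surjective.1 hinj
    ⟨f, (mem_restrictTotalDegree _ _ _).2 le_rfl⟩
  exact ⟨q, congrArg Subtype.val hq⟩

/-- Polynomials are dense in the continuous functions on a closed ball. -/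
theorem exists_polyFun_near (b : OrthonormalBasis (Fin n) ℝ (Euc n)) (c : Euc n) (r : ℝ)
    (f : C(closedBall c r, ℝ)) {ε : ℝ} (hε : 0 < ε) :
    ∃ p, ∀ x : closedBall c r, |polyFun b c p x - f x| < ε := by
  have : CompactSpace (closedBall c r) := isCompact_iff_compactSpace.1 (isCompact_closedBall c r)
  let F : MvPolynomial (Fin n) ℝ →ₐ[ℝ] C(closedBall c r, ℝ) :=
    aeval fun i => ⟨fun x => ⟪b i, (x : Euc n) - c⟫, by fun_prop⟩
  have hF : ∀ p x, F p x = polyFun b c p x := by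
    intro p x
    simp only [F, polyFun]
    induction p using MvPolynomial.induction_on with
    | C a => simp
    | add p q hp hq => simp [hp, hq]
    | mul_X p i hp => simp [hp]
  obtain ⟨⟨g, p, rfl⟩, hg⟩ := ContinuousMap.exists_mem_subalgebra_near_continuous_of_separatesPoints
    F.range (by
      intro x y hxy
      have : ∃ i, ⟪b i, (x : Euc n) - c⟫ ≠ ⟪b i, (y : Euc n) - c⟫ := by
        by_contra! h
        refine hxy (Subtype.ext (sub_left_injective (b := c) ?_))
        dsimp only
        rw [← b.sum_repr' ((x : Euc n) - c), ← b.sum_repr' ((y : Euc n) - c)]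
        simp only [h]
      obtain ⟨i, hi⟩ := this
      refine ⟨F (X i), ⟨F (X i), ⟨X i, rfl⟩, rfl⟩, ?_⟩
      rw [hF, hF]
      simpa [polyFun] using hi) f f.continuous ε hε
  exact ⟨p, fun x => by rw [← hF]; exact hg x⟩

/-- Approximate solvability of the Dirichlet problem for `linOp` in a ball. -/
theorem exists_linOp_eq_near (hn : 0 < n) (b : OrthonormalBasis (Fin n) ℝ (Euc n))
    {a : Fin n → ℝ} (ha : ∀ i, 0 < a i) (c : Euc n) {r : ℝ} (hr : 0 < r)
    (f : C(closedBall c r, ℝ)) (γ : ℝ) {ε : ℝ} (hε : 0 < ε) :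
    ∃ h : Euc n → ℝ, ContDiff ℝ 2 h ∧ (∀ x, linOp b a h x = γ) ∧
      ∀ x : closedBall c r, (x : Euc n) ∈ sphere c r → |h x - f x| < ε := by
  obtain ⟨p, hp⟩ := exists_polyFun_near b c r f hε
  obtain ⟨q, hq⟩ := exists_polyOp_eq hn ha hr (polyOp a p - C γ)
  refine ⟨polyFun b c (p - (C (r ^ 2) - ∑ i, X i ^ 2) * q), contDiff_polyFun _ _ _, fun x => ?_,
    fun x hx => ?_⟩
  · rw [linOp_polyFun, map_sub, hq]; simp [polyFun]
  · have h1 := polyFun_sum_sq b c (x : Euc n)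
    have h2 : polyFun b c (p - (C (r ^ 2) - ∑ i, X i ^ 2) * q) x = polyFun b c p x := by
      simp only [polyFun] at h1 ⊢
      rw [map_sub, map_mul, map_sub, h1, eval_C]
      rw [mem_sphere, dist_eq_norm] at hx
      simp [hx]
    rw [h2]; exact hp x

end polynomials

section comparison

variable {n : ℕ} {b : OrthonormalBasis (Fin n) ℝ (Euc n)} {a : Fin n → ℝ}

/-- Functions on a closed ball lying above every `C²` subsolution of `linOp φ + γ = 0` which they
dominate on the sphere. -/
def compSet (b : OrthonormalBasis (Fin n) ℝ (Euc n)) (a : Fin n → ℝ) (y : Euc n) (r γ : ℝ) :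
    Set C(closedBall y r, ℝ) :=
  {f | ∀ h : Euc n → ℝ, ContDiff ℝ 2 h → (∀ x ∈ ball y r, -γ ≤ linOp b a h x) →
    (∀ x : closedBall y r, (x : Euc n) ∈ sphere y r → h x ≤ f x) → ∀ x : closedBall y r, h x ≤ f x}

theorem isClosed_compSet (y : Euc n) (r γ : ℝ) : IsClosed (compSet b a y r γ) := by
  have : CompactSpace (closedBall y r) := isCompact_iff_compactSpace.1 (isCompact_closedBall y r)
  refine isClosed_of_closure_subset fun f hf h hh hL hs x => le_of_forall_pos_le_add fun ε hε => ?_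
  obtain ⟨g, hg, hd⟩ := Metric.mem_closure_iff.1 hf (ε / 2) (by positivity)
  have hd' : ∀ z, |f z - g z| < ε / 2 := fun z => by
    have := (ContinuousMap.dist_apply_le_dist z).trans_lt hd
    rwa [Real.dist_eq] at this
  have h1 := hg (fun z => h z + -(ε / 2)) (hh.add contDiff_const) (fun z hz => by
    rw [linOp_add b a hh.contDiffAt contDiffAt_const, linOp_const, add_zero]
    exact hL z hz) (fun z hz => by
    have := hs z hz
    have := abs_lt.1 (hd' z)
    linarith) x
  have := abs_lt.1 (hd' x)
  linarith

theorem convex_compSet (hn : 0 < n) (ha : ∀ i, 0 < a i) (y : Euc n) {r : ℝ} (hr : 0 < r) (γ : ℝ) :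
    Convex ℝ (compSet b a y r γ) := by
  intro f₁ h₁ f₂ h₂ s t hs ht hst h hh hL hle x
  rcases ht.eq_or_lt with rfl | ht
  · have : s = 1 := by linarith
    subst this
    simpa using h₁ h hh hL (by simpa using hle) x
  refine le_of_forall_pos_le_add fun ε hε => ?_
  set η := ε / (2 * (s + 1)) with hη
  have hη0 : 0 < η := by positivity
  have hsη : 2 * s * η ≤ ε := by
    rw [hη, mul_div_assoc', div_le_iff₀ (by positivity)]; nlinarith
  obtain ⟨g, hg, hgL, hgs⟩ := exists_linOp_eq_near hn b ha y hr
    (f₁ - ContinuousMap.const _ η) (-γ) hη0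
  have hg1 := h₁ g hg (fun z _ => (hgL z).ge) (fun z hz => by
    have := abs_lt.1 (hgs z hz)
    simp at this; linarith)
  have hk : ContDiff ℝ 2 (fun z => t⁻¹ * (h z + ((-s) * g z + -(2 * s * η)))) :=
    contDiff_const.mul (hh.add ((contDiff_const.mul hg).add contDiff_const))
  have h2 := h₂ _ hk (fun z hz => by
    rw [linOp_const_mul b a (hh.add ((contDiff_const.mul hg).add contDiff_const)).contDiffAt,
      linOp_add b a hh.contDiffAt ((contDiff_const.mul hg).add contDiff_const).contDiffAt,
      linOp_add b a (contDiff_const.mul hg).contDiffAt contDiffAt_const, linOp_const,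
      linOp_const_mul b a hg.contDiffAt, hgL, inv_mul_eq_div, le_div_iff₀ ht]
    have := hL z hz
    have : s = 1 - t := by linarith
    subst this
    linarith) (fun z hz => by
    rw [inv_mul_eq_div, div_le_iff₀ ht]
    have h3 := hle z hz
    have h4 := abs_lt.1 (hgs z hz)
    simp at h3 h4
    nlinarith) x
  rw [inv_mul_eq_div, div_le_iff₀ ht] at h2
  have h5 := mul_le_mul_of_nonneg_left (hg1 x) hs
  simp
  linarith

theorem mem_compSet_of_superAt {lam Lam : ℝ} (h0 : 0 < lam) (hn : 0 < n)
    (ha : ∀ i, lam ≤ a i ∧ a i ≤ Lam) {y : Euc n} {r γ : ℝ} {w : Euc n → ℝ} (hw : Continuous w)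
    (hS : ∀ x ∈ ball y r, SuperAt lam Lam w x γ) :
    (⟨fun x => w x, by fun_prop⟩ : C(closedBall y r, ℝ)) ∈ compSet b a y r γ := by
  intro h hh hL hs x
  change h x ≤ w x
  by_contra! hlt
  set η := h x - w x with hη
  have hη0 : 0 < η := by linarith
  set ε := η / (2 * (r ^ 2 + 1)) with hε
  have hε0 : 0 < ε := by positivity
  have hεr : ε * r ^ 2 < η := by
    rw [hε, div_mul_eq_mul_div, div_lt_iff₀ (by positivity)]
    nlinarith [sq_nonneg r]
  have hφ : ContDiff ℝ 2 (fun z => h z + ε * ‖z - y‖ ^ 2) := hh.add (contDiff_norm_sq_sub ε y)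
  obtain ⟨z, hz, hzmin⟩ := (isCompact_closedBall y r).exists_isMinOn ⟨x, x.2⟩
    (hw.sub hφ.continuous).continuousOn
  have h1 := hzmin x.2
  simp only [Set.mem_ofPred_eq, Pi.sub_apply] at h1
  have hzb : z ∈ ball y r := by
    by_contra hn
    have h2 : ‖z - y‖ = r := by
      simp only [mem_ball, not_lt, mem_closedBall, dist_eq_norm] at *
      exact le_antisymm hz hn
    have h3 : h z ≤ w z := hs ⟨z, hz⟩ (by simpa [dist_eq_norm] using h2)
    rw [h2] at h1
    nlinarith [mul_nonneg hε0.le (sq_nonneg ‖(x : Euc n) - y‖)]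
  have h4 := hS z hzb _ hφ.contDiffAt (hzmin.isLocalMin (closedBall_mem_nhds_of_mem hzb))
  have h5 := sum_le_pucci hφ.contDiffAt b a ha (x := z)
  have h6 := linOp_add b a hh.contDiffAt (contDiff_norm_sq_sub ε y).contDiffAt (x := z)
  rw [linOp_norm_sq] at h6
  change linOp b a _ z ≤ _ at h5
  have := hL z hzb
  have := mul_pos (mul_pos two_pos hε0) (sum_pos_of_forall_pos hn fun i => h0.trans_le (ha i).1)
  linarith

theorem linOp_le_of_mem_compSet (hn : 0 < n) (ha : ∀ i, 0 < a i) {y : Euc n} {r₁ γ : ℝ}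
    (hr₁ : 0 < r₁) {V : Euc n → ℝ} (hV : ContDiff ℝ 2 V)
    (hS : ∀ r, 0 < r → r ≤ r₁ →
      (⟨fun x => V x, by have := hV.continuous; fun_prop⟩ : C(closedBall y r, ℝ)) ∈
        compSet b a y r γ) :
    linOp b a V y ≤ -γ := by
  by_contra! hlt
  have hA := sum_pos_of_forall_pos hn ha
  set A := ∑ i, a i
  set κ := (linOp b a V y + γ) / (4 * A) with hκ
  have hκ0 : 0 < κ := div_pos (by linarith) (by positivity)
  have hκA : 4 * κ * A = linOp b a V y + γ := by rw [hκ]; field_simp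
  have hc : Continuous (linOp b a V) := by
    unfold linOp d2
    have : Continuous (fderiv ℝ (fderiv ℝ V)) :=
      ((hV.fderiv_right (m := 1) (by norm_num)).fderiv_right (m := 0) (by norm_num)).continuous
    refine continuous_finsetSum _ fun i _ => continuous_const.mul ?_
    exact (this.clm_apply continuous_const).clm_apply continuous_const
  have hnear := hc.continuousAt.eventually (lt_mem_nhds (show -γ + 2 * κ * A < linOp b a V y by
    nlinarith [mul_pos hκ0 hA]))
  obtain ⟨δ, hδ, hb⟩ := Metric.eventually_nhds_iff_ball.1 hnear
  set r := min δ r₁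
  have hr : 0 < r := lt_min hδ hr₁
  have hN : ContDiff ℝ 2 (fun z : Euc n => (-κ) * ‖z - y‖ ^ 2 + κ * r ^ 2) :=
    (contDiff_norm_sq_sub _ y).add contDiff_const
  have h1 := hS r hr (min_le_right _ _) (fun z => V z + ((-κ) * ‖z - y‖ ^ 2 + κ * r ^ 2))
    (hV.add hN) (fun z hz => by
      rw [linOp_add b a hV.contDiffAt hN.contDiffAt,
        linOp_add b a (contDiff_norm_sq_sub _ y).contDiffAt contDiffAt_const, linOp_const,
        linOp_norm_sq]
      have := hb z (ball_subset_ball (min_le_left _ _) hz)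
      linarith) (fun z hz => by
      rw [mem_sphere, dist_eq_norm] at hz
      simp [hz]) ⟨y, by simp [hr.le]⟩
  simp at h1
  have := mul_pos hκ0 (pow_pos hr 2)
  linarith

end comparison

section mollification

open MeasureTheory

variable {n : ℕ} {b : OrthonormalBasis (Fin n) ℝ (Euc n)} {a : Fin n → ℝ}

theorem convolution_mem_compSet (hn : 0 < n) (ha : ∀ i, 0 < a i) {y : Euc n} {r γ : ℝ}
    (hr : 0 < r) {v : Euc n → ℝ} (hv : Continuous v) (ρ : ContDiffBump (0 : Euc n))
    {V : Euc n → ℝ} (hVc : Continuous V) (hV : ∀ x, V x = ∫ t, ρ.normed volume t * v (x - t))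
    (hS : ∀ t ∈ ball (0 : Euc n) ρ.rOut,
      (⟨fun x => v (x - t), by fun_prop⟩ : C(closedBall y r, ℝ)) ∈ compSet b a y r γ) :
    (⟨fun x => V x, by fun_prop⟩ : C(closedBall y r, ℝ)) ∈ compSet b a y r γ := by
  have : CompactSpace (closedBall y r) := isCompact_iff_compactSpace.1 (isCompact_closedBall y r)
  let F : C(Euc n, C(closedBall y r, ℝ)) :=
    ContinuousMap.curry ⟨fun p : Euc n × closedBall y r => v (p.2 - p.1), by fun_prop⟩
  have hF : ∀ t x, F t x = v (x - t) := fun t x => rfl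
  let ρ' : Euc n → NNReal := fun t => (ρ.normed volume t).toNNReal
  have hρ' : ∀ t, (ρ' t : ℝ) = ρ.normed volume t := fun t => Real.coe_toNNReal _ (ρ.nonneg_normed t)
  have hρc : Continuous ρ' := continuous_real_toNNReal.comp ρ.continuous_normed
  have hρm : Measurable ρ' := hρc.measurable
  let μ : Measure (Euc n) := volume.withDensity fun t => ρ' t
  have h_integrable : Integrable (fun t => ρ' t • F t) volume := by
    refine Continuous.integrable_of_hasCompactSupport ?_ ?_
    · exact hρc.smul F.continuous
    · refine ρ.hasCompactSupport_normed (μ := volume) |>.mono fun t ht => ?_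
      rw [Function.mem_support] at ht ⊢
      intro h0
      apply ht
      have : ρ' t = 0 := by ext; exact (hρ' t).trans h0
      simp [this]
  have hFint : Integrable F μ := (integrable_withDensity_iff_integrable_smul hρm).2 h_integrable
  have hprob : IsProbabilityMeasure μ := ⟨by
    have h1 : ∫⁻ t, ENNReal.ofReal (ρ.normed volume t) = ENNReal.ofReal 1 := by
      rw [← ρ.integral_normed (μ := volume), ofReal_integral_eq_lintegral_ofReal ρ.integrable_normed
        (Eventually.of_forall ρ.nonneg_normed)]
    rw [withDensity_apply _ MeasurableSet.univ, Measure.restrict_univ]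
    rw [ENNReal.ofReal_one] at h1
    rw [← h1]
    refine lintegral_congr fun t => ?_
    rfl⟩
  have hae : ∀ᵐ t ∂μ, F t ∈ compSet b a y r γ := by
    have : ∀ᵐ t ∂μ, t ∈ ball (0 : Euc n) ρ.rOut := by
      rw [ae_withDensity_iff (by fun_prop)]
      refine Eventually.of_forall fun t ht => ?_
      rw [← ρ.support_normed_eq (μ := volume), Function.mem_support]
      intro h0
      apply ht
      have : ρ' t = 0 := by ext; exact (hρ' t).trans h0
      simp [this]
    filter_upwards [this] with t ht using hS t ht
  have hmem := (convex_compSet hn ha y hr γ).integral_mem (isClosed_compSet y r γ) hae hFint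
  convert hmem using 1
  ext x
  rw [ContinuousMap.integral_apply hFint, integral_withDensity_eq_integral_smul hρm]
  rw [ContinuousMap.coe_mk, hV]
  refine integral_congr_ae (Eventually.of_forall fun t => ?_)
  change _ = (ρ' t : ℝ) * v (x - t)
  rw [hρ']

/-- Smooth approximation of viscosity supersolutions by convolution. -/
theorem exists_smooth_supersolution {lam Lam : ℝ} (h0 : 0 < lam) (hl : lam ≤ Lam) (hn : 0 < n)
    {v g : Euc n → ℝ} (hv : Continuous v) (hg : Continuous g) {y₀ : Euc n} {r₀ : ℝ} (hr₀ : 0 < r₀)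
    (hS : ∀ y ∈ ball y₀ r₀, SuperAt lam Lam v y (g y)) {ε : ℝ} (hε : 0 < ε) :
    ∃ V : Euc n → ℝ, ContDiff ℝ 2 V ∧ ∀ y ∈ ball y₀ (r₀ / 2),
      |V y - v y| ≤ ε ∧ pucciMax lam Lam (hess V y) + g y ≤ ε := by
  have huc : ∀ {f : Euc n → ℝ}, Continuous f → ∃ δ > 0, ∀ x ∈ closedBall y₀ r₀,
      ∀ z ∈ closedBall y₀ r₀, dist x z < δ → dist (f x) (f z) < ε := fun hf =>
    Metric.uniformContinuousOn_iff.1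
      ((isCompact_closedBall y₀ r₀).uniformContinuousOn_of_continuous hf.continuousOn) ε hε
  obtain ⟨δ₁, hδ₁, hv'⟩ := huc hv
  obtain ⟨δ₂, hδ₂, hg'⟩ := huc hg
  set δ := min (min δ₁ δ₂) r₀ / 4 with hδ
  have hδ0 : 0 < δ := by positivity
  have hm1 : 4 * δ ≤ δ₁ := by
    rw [hδ]; linarith [min_le_left (min δ₁ δ₂) r₀, min_le_left δ₁ δ₂]
  have hm2 : 4 * δ ≤ δ₂ := by
    rw [hδ]; linarith [min_le_left (min δ₁ δ₂) r₀, min_le_right δ₁ δ₂]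
  have hm3 : 4 * δ ≤ r₀ := by rw [hδ]; linarith [min_le_right (min δ₁ δ₂) r₀]
  let ρ : ContDiffBump (0 : Euc n) := ⟨δ / 2, δ, by positivity, by linarith⟩
  have hρ : ρ.rOut = δ := rfl
  set V : Euc n → ℝ := MeasureTheory.convolution (ρ.normed volume) v
    (ContinuousLinearMap.lsmul ℝ ℝ) volume with hVdef
  have hVs : ContDiff ℝ 2 V := by
    exact_mod_cast ρ.hasCompactSupport_normed.contDiff_convolution_left (n := 2) _
      ρ.contDiff_normed hv.locallyIntegrable
  have hV : ∀ x, V x = ∫ t, ρ.normed volume t * v (x - t) := fun x => rfl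
  refine ⟨V, hVs, fun y hy => ⟨?_, ?_⟩⟩
  · rw [← Real.dist_eq]
    refine ρ.dist_normed_convolution_le hv.aestronglyMeasurable fun x hx => (hv' x ?_ y ?_ ?_).le
    · rw [mem_ball, hρ] at hx
      rw [mem_ball] at hy
      rw [mem_closedBall]
      linarith [dist_triangle x y y₀]
    · exact closedBall_subset_closedBall (by linarith) (ball_subset_closedBall hy)
    · rw [mem_ball, hρ] at hx; linarith
  · obtain ⟨b, a, ha, he⟩ := exists_sum_eq_pucci hl (hVs.contDiffAt (x := y))
    have ha0 : ∀ i, 0 < a i := fun i => h0.trans_le (ha i).1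
    have key := linOp_le_of_mem_compSet (b := b) (γ := g y - ε) hn ha0 hδ0 hVs (y := y)
      fun r hr hrδ => convolution_mem_compSet hn ha0 hr hv ρ hVs.continuous hV fun t ht => by
        refine mem_compSet_of_superAt h0 hn ha (w := fun x => v (x - t)) (by fun_prop) fun x hx => ?_
        rw [mem_ball, hρ, dist_zero_right] at ht
        rw [mem_ball] at hx hy
        have h1 : dist (x - t) x = ‖t‖ := by rw [dist_eq_norm]; simp
        have h2 : dist (x - t) y < 2 * δ := by linarith [dist_triangle (x - t) x y]
        have h3 : dist (x - t) y₀ < r₀ := by linarith [dist_triangle (x - t) y y₀]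
        have h4 := hS (x - t) h3
        have h5 := hg' (x - t) h3.le y (by rw [mem_closedBall]; linarith) (by linarith)
        rw [Real.dist_eq] at h5
        have h6 := SuperAt.scale (u := v) (a := -t) (m := 1) (c := 1) (x := x) (γ := g (x - t))
          hl one_pos one_ne_zero (by rw [one_smul, neg_add_eq_sub]; exact h4)
        simp only [one_smul, neg_add_eq_sub, one_mul, one_pow] at h6
        exact h6.mono (by linarith [(abs_lt.1 h5).1])
    have : pucciMax lam Lam (hess V y) = linOp b a V y := he
    linarith

end mollification

/-- Comparison of a viscosity subsolution with a viscosity supersolution composed with an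
isometry: at a local maximum of `u - v ∘ R - ψ`, the test function `ψ` controls the difference of
the right-hand sides. -/
theorem viscosity_difference {lam Lam : ℝ} (h0 : 0 < lam) (hl : lam ≤ Lam) {n : ℕ} (hn : 0 < n)
    {u v f g ψ : Euc n → ℝ} (hu : Continuous u) (hv : Continuous v) (hf : Continuous f)
    (hg : Continuous g) {x₀ y₀ : Euc n} (hsub : ∀ᶠ x in 𝓝 x₀, SubAt lam Lam u x (f x))
    (hsup : ∀ᶠ y in 𝓝 y₀, SuperAt lam Lam v y (g y)) (Q : Euc n ≃ₗᵢ[ℝ] Euc n)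
    (hψ : ContDiffAt ℝ 2 ψ x₀)
    (hmax : IsLocalMax (fun x => u x - v (y₀ + Q (x - x₀)) - ψ x) x₀) :
    g y₀ - f x₀ ≤ pucciMax lam Lam (hess ψ x₀) := by
  suffices H : ∀ ε > 0, g y₀ - f x₀ ≤ pucciMax lam Lam (hess ψ x₀) + ε * (4 + 2 * Lam * n) by
    refine le_of_forall_pos_le_add fun ε hε => ?_
    have hp : 0 < 4 + 2 * Lam * n := by have := h0.trans_le hl; positivity
    have := H (ε / (4 + 2 * Lam * n)) (by positivity)
    rwa [div_mul_cancel₀ _ hp.ne'] at this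
  intro ε hε
  set ψ' : Euc n → ℝ := fun x => ψ x + ε * ‖x - x₀‖ ^ 2 with hψ'
  have hψ'C : ContDiffAt ℝ 2 ψ' x₀ := hψ.add (contDiff_norm_sq_sub ε x₀).contDiffAt
  have hψ'p : pucciMax lam Lam (hess ψ' x₀) ≤ pucciMax lam Lam (hess ψ x₀) + 2 * ε * Lam * n :=
    pucci_le_add_of_d2_le h0 hl hψ hψ'C (by positivity) fun v => by
      rw [hψ', d2_add hψ (contDiff_norm_sq_sub ε x₀).contDiffAt, d2_norm_sq]
  have hR : Continuous fun x => y₀ + Q (x - x₀) := by fun_prop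
  have hRx : y₀ + Q (x₀ - x₀) = y₀ := by simp
  have hgR : ∀ᶠ x in 𝓝 x₀, g y₀ - ε < g (y₀ + Q (x - x₀)) := by
    refine (hg.comp hR).continuousAt.eventually (lt_mem_nhds ?_)
    simp [hε]
  have hfx : ∀ᶠ x in 𝓝 x₀, f x < f x₀ + ε :=
    hf.continuousAt.eventually (gt_mem_nhds (by linarith))
  obtain ⟨r₀, hr₀, hS⟩ := Metric.eventually_nhds_iff_ball.1 hsup
  obtain ⟨r₁, hr₁, hE⟩ := Metric.eventually_nhds_iff_ball.1
    (((hsub.and hgR).and (hfx.and (eventually_pucci_le h0 hl hψ'C hε))).and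
      ((hψ'C.eventually (by simp)).and hmax))
  set r := min (r₁ / 2) (r₀ / 4)
  have hr : 0 < r := by positivity
  have hrr₁ : closedBall x₀ r ⊆ ball x₀ r₁ :=
    closedBall_subset_ball ((min_le_left _ _).trans_lt (by linarith))
  have hrr₀ : ∀ x ∈ closedBall x₀ r, y₀ + Q (x - x₀) ∈ ball y₀ (r₀ / 2) := fun x hx => by
    rw [mem_closedBall, dist_eq_norm] at hx
    rw [mem_ball, dist_eq_norm, add_sub_cancel_left, LinearIsometryEquiv.norm_map]
    linarith [min_le_right (r₁ / 2) (r₀ / 4)]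
  set η := min ε (ε * r ^ 2 / 4)
  have hη : 0 < η := by positivity
  have hη2 : 2 * η < ε * r ^ 2 := by
    have : 0 < ε * r ^ 2 := by positivity
    linarith [min_le_right ε (ε * r ^ 2 / 4)]
  obtain ⟨V, hV, hVn⟩ := exists_smooth_supersolution h0 hl hn hv hg hr₀ hS hη
  have hcont : ContinuousOn (fun x => u x - V (y₀ + Q (x - x₀)) - ψ' x) (closedBall x₀ r) :=
    ((hu.sub (hV.continuous.comp hR)).continuousOn).sub fun x hx =>
      ((hE x (hrr₁ hx)).2.1.continuousAt).continuousWithinAt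
  obtain ⟨x, hx, -, hxm⟩ := exists_interior_max hr hcont fun x hx => by
    have hx' := sphere_subset_closedBall hx
    have h1 := (hE x (hrr₁ hx')).2.2
    have h2 := abs_le.1 (hVn _ (hrr₀ x hx')).1
    have h3 := abs_le.1 (hVn _ (hrr₀ x₀ (mem_closedBall_self hr.le))).1
    rw [mem_sphere, dist_eq_norm] at hx
    change u x - V _ - (ψ x + ε * ‖x - x₀‖ ^ 2) <
      u x₀ - V (y₀ + Q (x₀ - x₀)) - (ψ x₀ + ε * ‖x₀ - x₀‖ ^ 2)
    simp only [hRx] at h1 h3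
    rw [hRx, hx, sub_self, norm_zero]
    linarith
  have hx' := ball_subset_closedBall hx
  obtain ⟨⟨⟨e1, e2⟩, e3, e4⟩, e5, -⟩ := hE x (hrr₁ hx')
  have hVc : ContDiffAt ℝ 2 V ((y₀ - Q x₀) + (1 : ℝ) • Q x) := hV.contDiffAt
  obtain ⟨hc1, hc2⟩ := pucci_comp_le hl Q zero_le_one hVc
  have h1 := e1 _ (hc1.add e5) (by
    refine hxm.congr (Eventually.of_forall fun z => ?_)
    simp only [one_mul, one_smul, map_sub]
    rw [sub_add_eq_add_sub y₀, add_sub_assoc]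
    ring)
  have h2 := pucci_add_le hl hc1 e5
  have h3 := (hVn _ (hrr₀ x hx')).2
  have hp : (y₀ - Q x₀) + (1 : ℝ) • Q x = y₀ + Q (x - x₀) := by rw [one_smul, map_sub]; abel
  rw [hp] at hc2
  have h4 : η ≤ ε := min_le_left _ _
  change 0 ≤ pucciMax lam Lam (hess (fun y => 1 * V (y₀ - Q x₀ + (1 : ℝ) • Q y) + ψ' y) x) + f x
    at h1
  linarith

theorem exists_reflection {n : ℕ} {e : Euc n} (he : ‖e‖ = 1) :
    ∃ Q : Euc n ≃ₗᵢ[ℝ] Euc n, ∀ v, Q v = v - (2 * ⟪e, v⟫) • e := by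
  refine ⟨(ℝ ∙ e)ᗮ.reflection, fun v => ?_⟩
  rw [Submodule.reflection_orthogonal_apply, Submodule.reflection_singleton_apply, he]
  simp [mul_smul, two_smul]

theorem pucci_profile_le {lam Lam : ℝ} (h0 : 0 < lam) (hl : lam ≤ Lam) {n : ℕ} {e x z : Euc n}
    (he : ‖e‖ = 1) {h h' : ℝ → ℝ} {c k : ℝ} (hC : ContDiffAt ℝ 2 h ⟪e, x⟫)
    (h1 : ∀ᶠ s in 𝓝 ⟪e, x⟫, HasDerivAt h (h' s) s) (h2 : HasDerivAt h' (-c) ⟪e, x⟫)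
    (hc : 0 ≤ c) (hk : 0 ≤ k) :
    ContDiffAt ℝ 2 (fun y => h ⟪e, y⟫ + k * ‖y - z‖ ^ 2) x ∧
    pucciMax lam Lam (hess (fun y => h ⟪e, y⟫ + k * ‖y - z‖ ^ 2) x) ≤
      -c * lam + 2 * k * Lam * n := by
  have hl := d2_linear hC h1 h2
  have hN := (contDiff_norm_sq_sub k z).contDiffAt (x := x)
  refine ⟨(hl 0).1.add hN, ?_⟩
  refine pucci_le_of_d2_form h0 ‹_› ((hl 0).1.add hN) he hc (by positivity) fun v => ?_
  rw [d2_add (hl 0).1 hN, (hl v).2, d2_norm_sq]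

theorem pucci_quadratic_profile_le {lam Lam : ℝ} (h0 : 0 < lam) (hl : lam ≤ Lam) {n : ℕ}
    {e : Euc n} (x z : Euc n) (he : ‖e‖ = 1) {L k : ℝ} (c m : ℝ) (hL : 0 ≤ L) (hk : 0 ≤ k) :
    ContDiffAt ℝ 2 (fun y => L * (2 * (c + m * ⟪e, y⟫) - (c + m * ⟪e, y⟫) ^ 2) +
      k * ‖y - z‖ ^ 2) x ∧
    pucciMax lam Lam (hess (fun y => L * (2 * (c + m * ⟪e, y⟫) - (c + m * ⟪e, y⟫) ^ 2) +
      k * ‖y - z‖ ^ 2) x) ≤ -(2 * L * m ^ 2) * lam + 2 * k * Lam * n := by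
  have haff : ∀ s : ℝ, HasDerivAt (fun s => c + m * s) m s := fun s => by
    simpa using ((hasDerivAt_id s).const_mul m).const_add c
  exact pucci_profile_le h0 hl he (h := fun s => L * (2 * (c + m * s) - (c + m * s) ^ 2))
    (h' := fun s => L * (2 * m - 2 * (c + m * s) * m)) (by fun_prop)
    (Eventually.of_forall fun s => by
      refine ((((haff s).const_mul 2).sub ((haff s).pow 2)).const_mul L).congr_deriv ?_
      norm_num)
    (by
      refine (((((haff _).const_mul 2).mul_const m).const_sub (2 * m)).const_mul L).congr_deriv ?_
      ring) (by positivity) hk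

/-- Local Lipschitz estimate for nonnegative solutions in a half space, uniform up to the boundary,
on which they vanish. -/
theorem exists_lipschitz_bound {lam Lam : ℝ} (h0 : 0 < lam) (hl : lam ≤ Lam) {n : ℕ} (hn : 0 < n)
    {K F : ℝ} (hK : 0 ≤ K) (hF : 0 ≤ F) :
    ∃ L, 0 ≤ L ∧ ∀ (e : Euc n) (d : ℝ) (u f : Euc n → ℝ) (z : Euc n), ‖e‖ = 1 → Continuous u →
      Continuous f → (∀ x, 0 ≤ u x) → (∀ x, ⟪e, x⟫ ≤ -d → u x = 0) →
      (∀ x ∈ ball z 2, u x ≤ K ∧ 0 ≤ f x ∧ f x ≤ F) →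
      (∀ x ∈ ball z 2, -d < ⟪e, x⟫ → SubAt lam Lam u x (f x) ∧ SuperAt lam Lam u x (f x)) →
      ∀ y, ‖y - z‖ ≤ 1 → u z - u y ≤ L * ‖y - z‖ := by
  have hLam : 0 < Lam := h0.trans_le hl
  set L := K + (2 * K * Lam * n + F + 1) / (2 * lam) with hLdef
  have hX : 0 < (2 * K * Lam * n + F + 1) / (2 * lam) := by positivity
  have hL0 : 0 < L := by positivity
  have hLK : K ≤ L := by linarith
  have hLl : 2 * K * Lam * n + F < 2 * L * lam := by
    have : (2 * K * Lam * n + F + 1) / (2 * lam) * (2 * lam) = 2 * K * Lam * n + F + 1 :=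
      div_mul_cancel₀ _ (by positivity)
    nlinarith [mul_nonneg hK h0.le]
  refine ⟨2 * L, by positivity, fun e d u f z he hu hf hu0 hub hbd hsol y hy => ?_⟩
  set A : Set (Euc n × Euc n) := {w | ‖w.1 - z‖ ≤ 1 ∧ ‖w.1 - w.2‖ ≤ 1} with hA
  have hAc : IsCompact A := by
    refine IsCompact.of_isClosed_subset
      ((isCompact_closedBall z 1).prod (isCompact_closedBall z 2)) ?_ ?_
    · exact (isClosed_le (by fun_prop : Continuous fun w : Euc n × Euc n => ‖w.1 - z‖)
        continuous_const).inter (isClosed_le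
        (by fun_prop : Continuous fun w : Euc n × Euc n => ‖w.1 - w.2‖) continuous_const)
    · rintro ⟨x, y⟩ ⟨h1, h2⟩
      refine ⟨by simpa [dist_eq_norm] using h1, ?_⟩
      rw [mem_closedBall, dist_eq_norm]
      have := norm_sub_le_norm_sub_add_norm_sub y x z
      rw [norm_sub_rev y x] at this
      simp only at h1 h2
      linarith
  set Φ : Euc n × Euc n → ℝ := fun w => u w.1 - u w.2 -
    L * (2 * ‖w.1 - w.2‖ - ‖w.1 - w.2‖ ^ 2) - K * ‖w.1 - z‖ ^ 2 with hΦ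
  have hΦc : Continuous Φ := by fun_prop
  have hzy : ((z, y) : Euc n × Euc n) ∈ A := ⟨by simp, by rwa [norm_sub_rev]⟩
  obtain ⟨⟨x₀, y₀⟩, ⟨hx₀, hxy₀⟩, hmax⟩ := hAc.exists_isMaxOn ⟨_, hzy⟩ hΦc.continuousOn
  simp only at hx₀ hxy₀
  rcases le_or_gt (Φ (x₀, y₀)) 0 with hle | hpos
  · have h1 : Φ (z, y) ≤ 0 := (hmax hzy).trans hle
    simp only [hΦ, sub_self, norm_zero] at h1
    rw [norm_sub_rev z y] at h1
    nlinarith [sq_nonneg ‖y - z‖]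
  exfalso
  simp only [hΦ] at hpos
  set r := ‖x₀ - y₀‖ with hr
  have hr0 : 0 ≤ r := norm_nonneg _
  have hφ0 : 0 ≤ L * (2 * r - r ^ 2) := mul_nonneg hL0.le (by nlinarith)
  have hz0 : 0 ≤ K * ‖x₀ - z‖ ^ 2 := by positivity
  have hux₀ : 0 < u x₀ := by linarith [hu0 y₀]
  have hx₀D : -d < ⟪e, x₀⟫ := by
    by_contra! h
    exact hux₀.ne' (hub _ h)
  have hx₀2 : x₀ ∈ ball z 2 := by rw [mem_ball, dist_eq_norm]; linarith
  have hx₀K : u x₀ ≤ K := (hbd x₀ hx₀2).1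
  have hx₀1 : ‖x₀ - z‖ < 1 := by
    refine lt_of_le_of_ne hx₀ fun h => ?_
    rw [h] at hpos
    linarith [hu0 y₀]
  have hr1 : r < 1 := by
    refine lt_of_le_of_ne hxy₀ fun h => ?_
    rw [h] at hpos
    linarith [hu0 y₀]
  have hrpos : 0 < r := by
    refine lt_of_le_of_ne hr0 fun h => ?_
    have : x₀ = y₀ := by rwa [eq_comm, hr, norm_sub_eq_zero_iff] at h
    rw [← h, this] at hpos
    rw [this] at hz0
    linarith
  have hy₀2 : y₀ ∈ ball z 2 := by
    rw [mem_ball, dist_eq_norm]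
    have := norm_sub_le_norm_sub_add_norm_sub y₀ x₀ z
    rw [norm_sub_rev y₀ x₀] at this
    linarith
  have hD : IsOpen {x : Euc n | x ∈ ball z 2 ∧ -d < ⟪e, x⟫} :=
    isOpen_ball.inter (isOpen_lt continuous_const
      (by fun_prop : Continuous fun x : Euc n => ⟪e, x⟫))
  have hnear1 : ∀ᶠ x in 𝓝 x₀, ‖x - z‖ < 1 :=
    (by fun_prop : Continuous fun x => ‖x - z‖).continuousAt.eventually (gt_mem_nhds hx₀1)
  have hu0f := (hbd x₀ hx₀2).2.2
  rcases lt_or_ge (-d) ⟪e, y₀⟫ with hy₀D | hy₀D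
  · set e₁ : Euc n := r⁻¹ • (x₀ - y₀) with he₁
    have he₁n : ‖e₁‖ = 1 := by
      rw [he₁, norm_smul, norm_inv, Real.norm_of_nonneg hr0]
      exact inv_mul_cancel₀ hrpos.ne'
    have hre : r • e₁ = x₀ - y₀ := by rw [he₁, smul_inv_smul₀ hrpos.ne']
    obtain ⟨Q, hQ⟩ := exists_reflection he₁n
    obtain ⟨hψC, hψp⟩ := pucci_quadratic_profile_le h0 hl x₀ z he₁n (r - 2 * ⟪e₁, x₀⟫) 2 hL0.le hK
    have hdiff : ∀ x, x - (y₀ + Q (x - x₀)) = (r - 2 * ⟪e₁, x₀⟫ + 2 * ⟪e₁, x⟫) • e₁ := fun x => by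
      rw [hQ, inner_sub_right, add_smul, sub_smul, hre]
      module
    have hspos : ∀ᶠ x in 𝓝 x₀, 0 < r - 2 * ⟪e₁, x₀⟫ + 2 * ⟪e₁, x⟫ :=
      (by fun_prop : Continuous fun x => r - 2 * ⟪e₁, x₀⟫ + 2 * ⟪e₁, x⟫).continuousAt.eventually
        (lt_mem_nhds (by linarith))
    have hs1 : ∀ᶠ x in 𝓝 x₀, r - 2 * ⟪e₁, x₀⟫ + 2 * ⟪e₁, x⟫ < 1 :=
      (by fun_prop : Continuous fun x => r - 2 * ⟪e₁, x₀⟫ + 2 * ⟪e₁, x⟫).continuousAt.eventually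
        (gt_mem_nhds (by linarith))
    have := viscosity_difference h0 hl hn hu hu hf hf (x₀ := x₀) (y₀ := y₀)
      ((hD.eventually_mem ⟨hx₀2, hx₀D⟩).mono fun x hx => (hsol x hx.1 hx.2).1)
      ((hD.eventually_mem ⟨hy₀2, hy₀D⟩).mono fun x hx => (hsol x hx.1 hx.2).2) Q hψC (by
        filter_upwards [hnear1, hspos, hs1] with x hx hxs hx1
        have hn : ‖x - (y₀ + Q (x - x₀))‖ = r - 2 * ⟪e₁, x₀⟫ + 2 * ⟪e₁, x⟫ := by
          rw [hdiff, norm_smul, he₁n, mul_one, Real.norm_of_nonneg hxs.le]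
        have h1 : Φ (x, y₀ + Q (x - x₀)) ≤ Φ (x₀, y₀) :=
          hmax ⟨hx.le, by simp only [hn]; exact hx1.le⟩
        simp only [hΦ, hn, ← hr] at h1
        simp only [sub_self, map_zero, add_zero, sub_add_cancel]
        linarith)
    have hf0 := (hbd y₀ hy₀2).2.1
    nlinarith [mul_pos hL0 h0]
  · have hdr : ⟪e, x₀⟫ + d ≤ r := by
      have := real_inner_le_norm e (x₀ - y₀)
      rw [he, one_mul, inner_sub_right] at this
      linarith
    obtain ⟨hψC, hψp⟩ := pucci_quadratic_profile_le h0 hl x₀ z he d 1 hL0.le hK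
    have ht1 : ∀ᶠ x in 𝓝 x₀, d + 1 * ⟪e, x⟫ < 1 :=
      (by fun_prop : Continuous fun x => d + 1 * ⟪e, x⟫).continuousAt.eventually
        (gt_mem_nhds (by linarith))
    have := (hsol x₀ hx₀2 hx₀D).1 _ hψC (by
      filter_upwards [hnear1, ht1, hD.eventually_mem ⟨hx₀2, hx₀D⟩] with x hx ht hxD
      have hdiff : x - (x - (d + 1 * ⟪e, x⟫) • e) = (d + 1 * ⟪e, x⟫) • e := by abel
      have hn : ‖x - (x - (d + 1 * ⟪e, x⟫) • e)‖ = d + 1 * ⟪e, x⟫ := by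
        rw [hdiff, norm_smul, he, mul_one, Real.norm_of_nonneg (by linarith [hxD.2])]
      have h1 : Φ (x, x - (d + 1 * ⟪e, x⟫) • e) ≤ Φ (x₀, y₀) :=
        hmax ⟨hx.le, by simp only [hn]; exact ht.le⟩
      simp only [hΦ, hn, ← hr] at h1
      have h2 : u (x - (d + 1 * ⟪e, x⟫) • e) = 0 := hub _ (by
        rw [inner_sub_right, inner_smul_right, real_inner_self_eq_norm_sq, he]; linarith)
      rw [h2, hub y₀ hy₀D] at h1
      have h3 : L * (2 * (d + 1 * ⟪e, x₀⟫) - (d + 1 * ⟪e, x₀⟫) ^ 2) ≤ L * (2 * r - r ^ 2) := by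
        refine mul_le_mul_of_nonneg_left ?_ hL0.le
        nlinarith
      linarith)
    linarith

section stability

variable {lam Lam : ℝ} {n : ℕ} {v : Euc n → ℝ} {z₀ : Euc n} {γ : ℝ}

theorem SubAt.of_approx (h0 : 0 < lam) (hl : lam ≤ Lam)
    (H : ∀ ε > 0, ∃ r₀ > 0, ∀ η > 0, ∃ w : Euc n → ℝ, Continuous w ∧
      ∀ x ∈ ball z₀ r₀, |w x - v x| ≤ η ∧ SubAt lam Lam w x (γ + ε)) :
    SubAt lam Lam v z₀ γ := by
  intro φ hφ hmax
  have hp : 0 < 2 * Lam * n + 2 := by have := h0.trans_le hl; positivity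
  suffices H' : ∀ ε > 0, 0 ≤ pucciMax lam Lam (hess φ z₀) + γ + ε * (2 * Lam * n + 2) by
    refine le_of_forall_pos_le_add fun ε hε => ?_
    have := H' (ε / (2 * Lam * n + 2)) (by positivity)
    rwa [div_mul_cancel₀ _ hp.ne'] at this
  intro ε hε
  have hN := contDiff_norm_sq_sub ε z₀
  set φ' : Euc n → ℝ := fun x => φ x + ε * ‖x - z₀‖ ^ 2 with hφ'
  have hφ'C : ContDiffAt ℝ 2 φ' z₀ := hφ.add hN.contDiffAt
  have hφ'p : pucciMax lam Lam (hess φ' z₀) ≤ pucciMax lam Lam (hess φ z₀) + 2 * ε * Lam * n :=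
    pucci_le_add_of_d2_le h0 hl hφ hφ'C (by positivity) fun v => by
      rw [hφ', d2_add hφ hN.contDiffAt, d2_norm_sq]
  obtain ⟨r₀, hr₀, hw⟩ := H ε hε
  obtain ⟨r₁, hr₁, hE⟩ := Metric.eventually_nhds_iff_ball.1
    ((eventually_pucci_le h0 hl hφ'C hε).and ((hφ'C.eventually (by simp)).and hmax))
  set r := min r₁ r₀ / 2
  have hr : 0 < r := by positivity
  have hrr₁ : closedBall z₀ r ⊆ ball z₀ r₁ := closedBall_subset_ball
    ((half_lt_self (lt_min hr₁ hr₀)).trans_le (min_le_left _ _))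
  have hrr₀ : closedBall z₀ r ⊆ ball z₀ r₀ := closedBall_subset_ball
    ((half_lt_self (lt_min hr₁ hr₀)).trans_le (min_le_right _ _))
  obtain ⟨w, hwc, hwn⟩ := hw (ε * r ^ 2 / 4) (by positivity)
  obtain ⟨x, hx, -, hxm⟩ := exists_interior_max (w := fun x => w x - φ' x) hr
    (hwc.continuousOn.sub fun x hx => (hE x (hrr₁ hx)).2.1.continuousAt.continuousWithinAt)
    fun x hx => by
      have hx' := sphere_subset_closedBall hx
      have h1 := (hE x (hrr₁ hx')).2.2
      have h2 := abs_le.1 (hwn x (hrr₀ hx')).1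
      have h3 := abs_le.1 (hwn z₀ (mem_ball_self hr₀)).1
      rw [mem_sphere, dist_eq_norm] at hx
      simp only [hφ', hx, sub_self, norm_zero]
      have : 0 < ε * r ^ 2 := by positivity
      linarith
  have hx' := ball_subset_closedBall hx
  have h1 := (hwn x (hrr₀ hx')).2 φ' (hE x (hrr₁ hx')).2.1 hxm
  have h2 := (hE x (hrr₁ hx')).1
  linarith

theorem SuperAt.of_approx (h0 : 0 < lam) (hl : lam ≤ Lam)
    (H : ∀ ε > 0, ∃ r₀ > 0, ∀ η > 0, ∃ w : Euc n → ℝ, Continuous w ∧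
      ∀ x ∈ ball z₀ r₀, |w x - v x| ≤ η ∧ SuperAt lam Lam w x (γ - ε)) :
    SuperAt lam Lam v z₀ γ := by
  intro φ hφ hmin
  have hp : 0 < 2 * Lam * n + 2 := by have := h0.trans_le hl; positivity
  suffices H' : ∀ ε > 0, pucciMax lam Lam (hess φ z₀) + γ ≤ 0 + ε * (2 * Lam * n + 2) by
    refine le_of_forall_pos_le_add fun ε hε => ?_
    have := H' (ε / (2 * Lam * n + 2)) (by positivity)
    rwa [div_mul_cancel₀ _ hp.ne'] at this
  intro ε hε
  have hN := contDiff_norm_sq_sub (-ε) z₀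
  set φ' : Euc n → ℝ := fun x => φ x + (-ε) * ‖x - z₀‖ ^ 2 with hφ'
  have hφ'C : ContDiffAt ℝ 2 φ' z₀ := hφ.add hN.contDiffAt
  have hφ'p : pucciMax lam Lam (hess φ z₀) ≤ pucciMax lam Lam (hess φ' z₀) + 2 * ε * Lam * n :=
    pucci_le_add_of_d2_le h0 hl hφ'C hφ (by positivity) fun v => by
      rw [hφ', d2_add hφ hN.contDiffAt, d2_norm_sq]
      linarith
  obtain ⟨r₀, hr₀, hw⟩ := H ε hε
  obtain ⟨r₁, hr₁, hE⟩ := Metric.eventually_nhds_iff_ball.1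
    ((eventually_pucci_near h0 hl hφ'C hε).and ((hφ'C.eventually (by simp)).and hmin))
  set r := min r₁ r₀ / 2
  have hr : 0 < r := by positivity
  have hrr₁ : closedBall z₀ r ⊆ ball z₀ r₁ := closedBall_subset_ball
    ((half_lt_self (lt_min hr₁ hr₀)).trans_le (min_le_left _ _))
  have hrr₀ : closedBall z₀ r ⊆ ball z₀ r₀ := closedBall_subset_ball
    ((half_lt_self (lt_min hr₁ hr₀)).trans_le (min_le_right _ _))
  obtain ⟨w, hwc, hwn⟩ := hw (ε * r ^ 2 / 4) (by positivity)
  obtain ⟨x, hx, -, hxm⟩ := exists_interior_min (w := fun x => w x - φ' x) hr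
    (hwc.continuousOn.sub fun x hx => (hE x (hrr₁ hx)).2.1.continuousAt.continuousWithinAt)
    fun x hx => by
      have hx' := sphere_subset_closedBall hx
      have h1 := (hE x (hrr₁ hx')).2.2
      have h2 := abs_le.1 (hwn x (hrr₀ hx')).1
      have h3 := abs_le.1 (hwn z₀ (mem_ball_self hr₀)).1
      rw [mem_sphere, dist_eq_norm] at hx
      simp only [hφ', hx, sub_self, norm_zero]
      have : 0 < ε * r ^ 2 := by positivity
      linarith
  have hx' := ball_subset_closedBall hx
  have h1 := (hwn x (hrr₀ hx')).2 φ' (hE x (hrr₁ hx')).2.1 hxm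
  have h2 := (hE x (hrr₁ hx')).1.2
  linarith

end stability

/-- Coefficients of the system `M⁺(D²u_b) + u_{!b} ^ pw b = 0`, `b : Bool`. -/
structure PucciSystem where
  lam : Bool → ℝ
  Lam : Bool → ℝ
  pw : Bool → ℝ
  lam_pos : ∀ b, 0 < lam b
  lam_le : ∀ b, lam b ≤ Lam b
  one_lt_pw : ∀ b, 1 < pw b

namespace PucciSystem

variable (S : PucciSystem) {n : ℕ}

theorem pw_pos (b : Bool) : 0 < S.pw b := one_pos.trans (S.one_lt_pw b)

theorem Lam_pos (b : Bool) : 0 < S.Lam b := (S.lam_pos b).trans_le (S.lam_le b)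

/-- `u` solves the system at `x` in the viscosity sense. -/
def SolAt (u : Bool → Euc n → ℝ) (x : Euc n) : Prop :=
  ∀ b, SubAt (S.lam b) (S.Lam b) (u b) x (u (!b) x ^ S.pw b) ∧
    SuperAt (S.lam b) (S.Lam b) (u b) x (u (!b) x ^ S.pw b)

/-- Nonnegative continuous solutions of the system in `{-d < ⟪e, x⟫}`, extended by zero. -/
structure Sol (e : Euc n) (d : ℝ) (u : Bool → Euc n → ℝ) : Prop where
  cont : ∀ b, Continuous (u b)
  nonneg : ∀ b x, 0 ≤ u b x
  zero : ∀ b x, ⟪e, x⟫ ≤ -d → u b x = 0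
  solAt : ∀ x, -d < ⟪e, x⟫ → S.SolAt u x

variable {S}

theorem Sol.exists_lipschitz {K : ℝ} (hn : 0 < n) (hK : 0 ≤ K) :
    ∃ L, 0 ≤ L ∧ ∀ (e : Euc n) (d : ℝ) (u : Bool → Euc n → ℝ) (R : ℝ), ‖e‖ = 1 → S.Sol e d u →
      (∀ b, ∀ x ∈ ball (0 : Euc n) (R + 3), u b x ≤ K) →
      ∀ b, ∀ x ∈ ball (0 : Euc n) R, ∀ y, ‖y - x‖ ≤ 1 → |u b y - u b x| ≤ L * ‖y - x‖ := by
  choose L hL0 hL using fun b => exists_lipschitz_bound (S.lam_pos b) (S.lam_le b) hn hK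
    (Real.rpow_nonneg hK (S.pw b))
  have hLb : ∀ b, L b ≤ L false + L true := fun b => by
    cases b <;> [exact le_add_of_nonneg_right (hL0 _); exact le_add_of_nonneg_left (hL0 _)]
  refine ⟨L false + L true, add_nonneg (hL0 _) (hL0 _), fun e d u R he hu hb b x hx y hy => ?_⟩
  have key : ∀ z, dist z 0 < R + 1 → ∀ y, ‖y - z‖ ≤ 1 →
      u b z - u b y ≤ (L false + L true) * ‖y - z‖ := fun z hz y hy => by
    refine (hL b e d (u b) (fun x => u (!b) x ^ S.pw b) z he (hu.cont b)
      ((hu.cont _).rpow_const fun _ => Or.inr (S.pw_pos b).le) (hu.nonneg b) (hu.zero b)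
      (fun x hx => ?_) (fun x _ hxd => hu.solAt x hxd b) y hy).trans
      (mul_le_mul_of_nonneg_right (hLb b) (norm_nonneg _))
    have hx' : x ∈ ball (0 : Euc n) (R + 3) := by
      rw [mem_ball] at *
      linarith [dist_triangle x z 0]
    exact ⟨hb b x hx', Real.rpow_nonneg (hu.nonneg _ _) _,
      Real.rpow_le_rpow (hu.nonneg _ _) (hb _ x hx') (S.pw_pos b).le⟩
  rw [mem_ball] at hx
  rw [abs_le]
  constructor
  · linarith [key x (by linarith) y hy]
  · rw [norm_sub_rev] at hy ⊢
    refine key y ?_ x hy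
    rw [norm_sub_rev, ← dist_eq_norm] at hy
    linarith [dist_triangle y x 0]

/-- Compactness along an ultrafilter for locally bounded sequences of solutions. -/
theorem exists_limit (hn : 0 < n) (l : Ultrafilter ℕ) {e : Euc n} (he : ‖e‖ = 1) {d : ℕ → ℝ}
    {u : ℕ → Bool → Euc n → ℝ} (hu : ∀ k, S.Sol e (d k) (u k))
    (hb : ∀ R : ℝ, ∃ K : ℝ, ∀ᶠ k in l, ∀ b, ∀ x ∈ ball (0 : Euc n) R, u k b x ≤ K) :
    ∃ v : Bool → Euc n → ℝ, (∀ b, Continuous (v b)) ∧ (∀ b x, 0 ≤ v b x) ∧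
      (∀ b, TendstoLocallyUniformly (fun k => u k b) (v b) l) ∧
      ∀ x, ∀ ρ > 0, (∀ᶠ k in l, -d k + ρ < ⟪e, x⟫) → S.SolAt v x := by
  have hlim : ∀ b x, ∃ c, Tendsto (fun k => u k b x) l (𝓝 c) := fun b x => by
    obtain ⟨K, hK⟩ := hb (‖x‖ + 1)
    have hmem : ∀ᶠ k in l, u k b x ∈ Set.Icc 0 K := hK.mono fun k hk =>
      ⟨(hu k).nonneg b x, hk b x (by simp)⟩
    obtain ⟨c, -, hc⟩ := isCompact_Icc.ultrafilter_le_nhds (l.map fun k => u k b x)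
      (le_principal_iff.2 hmem)
    exact ⟨c, hc⟩
  choose v hv using hlim
  have hloc : ∀ R : ℝ, ∃ L, 0 ≤ L ∧ ∀ᶠ k in l, ∀ b, ∀ x ∈ ball (0 : Euc n) R, ∀ y,
      ‖y - x‖ ≤ 1 → |u k b y - u k b x| ≤ L * ‖y - x‖ := fun R => by
    obtain ⟨K, hK⟩ := hb (R + 3)
    obtain ⟨L, hL0, hL⟩ := Sol.exists_lipschitz (S := S) hn (le_max_right K 0)
    exact ⟨L, hL0, hK.mono fun k hk => hL e (d k) (u k) R he (hu k)
      fun b x hx => (hk b x hx).trans (le_max_left _ _)⟩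
  have hvL : ∀ R : ℝ, ∃ L, 0 ≤ L ∧ ∀ b, ∀ x ∈ ball (0 : Euc n) R, ∀ y,
      ‖y - x‖ ≤ 1 → |v b y - v b x| ≤ L * ‖y - x‖ := fun R => by
    obtain ⟨L, hL0, hL⟩ := hloc R
    exact ⟨L, hL0, fun b x hx y hy => le_of_tendsto ((hv b y).sub (hv b x)).abs
      (hL.mono fun k hk => hk b x hx y hy)⟩
  have hsmall : ∀ L : ℝ, 0 ≤ L → ∀ ε > 0, ∀ x : Euc n, ∀ᶠ y in 𝓝 x,
      ‖y - x‖ ≤ 1 ∧ L * ‖y - x‖ < ε := fun L hL0 ε hε x => by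
    have h1 : Tendsto (fun y => ‖y - x‖) (𝓝 x) (𝓝 0) := by
      have : Continuous fun y => ‖y - x‖ := by fun_prop
      simpa using this.tendsto x
    have h2 := h1.const_mul L
    rw [mul_zero] at h2
    exact ((h1.eventually (gt_mem_nhds one_pos)).mono fun _ h => h.le).and
      (h2.eventually (gt_mem_nhds hε))
  have hvc : ∀ b, Continuous (v b) := fun b => continuous_iff_continuousAt.2 fun x => by
    obtain ⟨L, hL0, hL⟩ := hvL (‖x‖ + 1)
    refine Metric.continuousAt_iff'.2 fun ε hε => ?_
    filter_upwards [hsmall L hL0 ε hε x] with y hy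
    rw [Real.dist_eq]
    exact (hL b x (by simp) y hy.1).trans_lt hy.2
  have hunif : ∀ b, TendstoLocallyUniformly (fun k => u k b) (v b) l := fun b => by
    refine Metric.tendstoLocallyUniformly_iff.2 fun ε hε x => ?_
    obtain ⟨L, hL0, hL⟩ := hvL (‖x‖ + 1)
    obtain ⟨L', hL0', hL'⟩ := hloc (‖x‖ + 1)
    refine ⟨_, (hsmall L hL0 (ε / 3) (by positivity) x).and
      (hsmall L' hL0' (ε / 3) (by positivity) x), ?_⟩
    filter_upwards [hL', Metric.tendsto_nhds.1 (hv b x) (ε / 3) (by positivity)] with k hk hkx y hy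
    rw [Real.dist_eq] at hkx ⊢
    have h1 := abs_le.1 (hL b x (by simp) y hy.1.1)
    have h2 := abs_le.1 (hk b x (by simp) y hy.2.1)
    have h3 := abs_lt.1 hkx
    exact abs_lt.2 ⟨by linarith [hy.1.2, hy.2.2], by linarith [hy.1.2, hy.2.2]⟩
  have hv0 : ∀ b x, 0 ≤ v b x := fun b x =>
    ge_of_tendsto' (hv b x) fun k => (hu k).nonneg b x
  refine ⟨v, hvc, hv0, hunif, fun x ρ hρ hx => ?_⟩
  have hcomp : ∀ b, ∀ r, ∀ η > 0, ∀ᶠ k in l, ∀ y ∈ ball x r, |u k b y - v b y| < η :=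
    fun b r η hη => by
      have := tendstoLocallyUniformly_iff_forall_isCompact.1 (hunif b) _ (isCompact_closedBall x r)
      filter_upwards [Metric.tendstoUniformlyOn_iff.1 this η hη] with k hk y hy
      have := hk y (ball_subset_closedBall hy)
      rwa [dist_comm, Real.dist_eq] at this
  have happ : ∀ b, ∀ ε > 0, ∃ r₀ > 0, ∀ η > 0, ∃ w : Euc n → ℝ, Continuous w ∧
      ∀ y ∈ ball x r₀, |w y - v b y| ≤ η ∧
        SubAt (S.lam b) (S.Lam b) w y (v (!b) x ^ S.pw b + ε) ∧
        SuperAt (S.lam b) (S.Lam b) w y (v (!b) x ^ S.pw b - ε) := fun b ε hε => by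
    have hpc : ContinuousAt (fun s : ℝ => s ^ S.pw b) (v (!b) x) :=
      Real.continuousAt_rpow_const _ _ (Or.inr (S.pw_pos b).le)
    obtain ⟨δ, hδ, hpδ⟩ := Metric.eventually_nhds_iff_ball.1
      (hpc.eventually (Metric.ball_mem_nhds _ hε))
    obtain ⟨r₁, hr₁, hvr⟩ := Metric.eventually_nhds_iff_ball.1
      ((hvc !b).continuousAt.eventually (Metric.ball_mem_nhds (v (!b) x) (half_pos hδ)))
    refine ⟨min r₁ ρ, lt_min hr₁ hρ, fun η hη => ?_⟩
    obtain ⟨k, hk1, hk2, hk3⟩ := (hx.and ((hcomp b (min r₁ ρ) η hη).and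
      (hcomp (!b) (min r₁ ρ) _ (half_pos hδ)))).exists
    refine ⟨u k b, (hu k).cont b, fun y hy => ⟨(hk2 y hy).le, ?_⟩⟩
    have hyD : -d k < ⟪e, y⟫ := by
      have h1 := real_inner_le_norm e (x - y)
      rw [he, one_mul, inner_sub_right, norm_sub_rev, ← dist_eq_norm] at h1
      have := (mem_ball.1 hy).trans_le (min_le_right _ _)
      linarith
    have h1 := hvr y (ball_subset_ball (min_le_left _ _) hy)
    rw [Real.dist_eq] at h1
    have h2 := hpδ (u k (!b) y) (by
      rw [mem_ball, Real.dist_eq]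
      have := hk3 y hy
      have h3 := abs_sub_le (u k (!b) y) (v (!b) y) (v (!b) x)
      linarith)
    rw [Real.dist_eq] at h2
    have h3 := abs_lt.1 h2
    obtain ⟨h4, h5⟩ := (hu k).solAt y hyD b
    exact ⟨h4.mono (by linarith), h5.mono (by linarith)⟩
  intro b
  constructor
  · refine SubAt.of_approx (S.lam_pos b) (S.lam_le b) fun ε hε => ?_
    obtain ⟨r₀, hr₀, H⟩ := happ b ε hε
    refine ⟨r₀, hr₀, fun η hη => ?_⟩
    obtain ⟨w, hw, hw'⟩ := H η hη
    exact ⟨w, hw, fun y hy => ⟨(hw' y hy).1, (hw' y hy).2.1⟩⟩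
  · refine SuperAt.of_approx (S.lam_pos b) (S.lam_le b) fun ε hε => ?_
    obtain ⟨r₀, hr₀, H⟩ := happ b ε hε
    refine ⟨r₀, hr₀, fun η hη => ?_⟩
    obtain ⟨w, hw, hw'⟩ := H η hη
    exact ⟨w, hw, fun y hy => ⟨(hw' y hy).1, (hw' y hy).2.2⟩⟩

end PucciSystem

theorem d2_radial_rpow {n : ℕ} {x c : Euc n} (hx : x ≠ c) (m k : ℝ) (v : Euc n) :
    ContDiffAt ℝ 2 (fun y => m * (‖y - c‖ ^ 2) ^ (-k)) x ∧
    d2 (fun y => m * (‖y - c‖ ^ 2) ^ (-k)) x v = m * (‖x - c‖ ^ 2) ^ (-k - 1) * (2 * k) *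
      (2 * (k + 1) * (⟪x - c, v⟫ ^ 2 / ‖x - c‖ ^ 2) - ‖v‖ ^ 2) := by
  have ht : 0 < ‖x - c‖ ^ 2 := by
    have := norm_pos_iff.2 (sub_ne_zero.2 hx)
    positivity
  obtain ⟨h1, h2⟩ := d2_radial (h := fun t => m * t ^ (-k))
    (h' := fun t => m * (-k * t ^ (-k - 1)))
    (h'' := m * (-k * ((-k - 1) * (‖x - c‖ ^ 2) ^ (-k - 1 - 1))))
    (contDiffAt_const.mul (Real.contDiffAt_rpow_const_of_ne ht.ne'))
    ((lt_mem_nhds ht).mono fun t ht =>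
      (Real.hasDerivAt_rpow_const (Or.inl ht.ne')).const_mul m)
    (((Real.hasDerivAt_rpow_const (Or.inl ht.ne')).const_mul (-k)).const_mul m) v
  refine ⟨h1, h2.trans ?_⟩
  rw [Real.rpow_sub_one ht.ne' (-k - 1)]
  field_simp
  ring

theorem zero_le_pucci_add_neg {lam Lam : ℝ} (hl : lam ≤ Lam) {n : ℕ} {ψ : Euc n → ℝ} {x : Euc n}
    (hψ : ContDiffAt ℝ 2 ψ x) :
    0 ≤ pucciMax lam Lam (hess ψ x) + pucciMax lam Lam (hess (fun y => -ψ y) x) := by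
  refine le_trans ?_ (pucci_add_le hl hψ hψ.neg)
  have h := sum_le_pucci (lam := lam) (Lam := Lam) (φ := fun y => ψ y + -ψ y) (x := x)
    (hψ.add hψ.neg) (EuclideanSpace.basisFun (Fin n) ℝ) (fun _ => lam) fun _ => ⟨le_rfl, hl⟩
  simp only [add_neg_cancel, d2_const, mul_zero, Finset.sum_const_zero] at h ⊢
  exact h

/-- Viscosity supersolutions of `M⁻(D²w) ≤ 0`, stated through test functions `-ψ`. -/
def MinSuperAt (lam Lam : ℝ) {n : ℕ} (w : Euc n → ℝ) (x : Euc n) : Prop :=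
  ∀ ψ : Euc n → ℝ, ContDiffAt ℝ 2 ψ x → IsLocalMin (fun y => w y + ψ y) x →
    0 ≤ pucciMax lam Lam (hess ψ x)

theorem SuperAt.minSuperAt {lam Lam : ℝ} (hl : lam ≤ Lam) {n : ℕ} {u : Euc n → ℝ} {x : Euc n}
    {γ : ℝ} (h : SuperAt lam Lam u x γ) (hγ : 0 ≤ γ) : MinSuperAt lam Lam u x := by
  intro ψ hψ hm
  have h1 := h (fun y => -ψ y) hψ.neg (by simpa using hm)
  linarith [zero_le_pucci_add_neg hl hψ]

theorem MinSuperAt.pos_of_mem_ball {lam Lam : ℝ} (h0 : 0 < lam) (hl : lam ≤ Lam) {n : ℕ}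
    {w : Euc n → ℝ} {y : Euc n} {R : ℝ} (hw : ContinuousOn w (closedBall y R))
    (hw0 : ∀ x ∈ closedBall y R, 0 ≤ w x) (hS : ∀ x ∈ closedBall y R, MinSuperAt lam Lam w x)
    (hy : 0 < w y) : ∀ x ∈ ball y R, 0 < w x := by
  intro z hz
  have hR : 0 < R := Metric.pos_of_mem_ball hz
  have hwy : ContinuousAt w y := hw.continuousAt (closedBall_mem_nhds y hR)
  obtain ⟨s₀, hs₀, hs₀w⟩ := Metric.eventually_nhds_iff_ball.1
    (hwy.eventually (lt_mem_nhds (half_lt_self hy)))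
  set s := min s₀ R / 2 with hsdef
  have hs : 0 < s := by positivity
  have hss₀ : s < s₀ := (half_lt_self (lt_min hs₀ hR)).trans_le (min_le_left _ _)
  rcases lt_or_ge (dist z y) s with hzs | hzs
  · exact (half_pos hy).trans (hs₀w z (hzs.trans hss₀))
  set k : ℝ := Lam * n / lam with hk
  have hLam : 0 < Lam := h0.trans_le hl
  have hk0 : 0 ≤ k := by positivity
  have hkl : k * lam = Lam * n := div_mul_cancel₀ _ h0.ne'
  set k' := k + 1 with hk'
  have hk'0 : 0 < k' := by positivity
  set ε := w y / 2 * (s ^ 2) ^ k' with hε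
  have hε0 : 0 < ε := by positivity
  set c := ε * (R ^ 2) ^ (-k') with hc
  set ψ : Euc n → ℝ := fun x => (-ε) * (‖x - y‖ ^ 2) ^ (-k') + c with hψ
  have hA : IsCompact (closedBall y R \ ball y s) := (isCompact_closedBall y R).diff isOpen_ball
  have hne : ∀ x ∈ closedBall y R \ ball y s, x ≠ y := fun x hx h => hx.2 (h ▸ mem_ball_self hs)
  have hψC : ∀ x, x ≠ y → ContDiffAt ℝ 2 ψ x := fun x hx =>
    (d2_radial_rpow hx (-ε) k' 0).1.add contDiffAt_const
  have hzA : z ∈ closedBall y R \ ball y s := ⟨ball_subset_closedBall hz, by simpa using hzs⟩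
  obtain ⟨x, hx, hmin⟩ := hA.exists_isMinOn ⟨z, hzA⟩ (f := fun x => w x + ψ x)
    ((hw.mono Set.sdiff_subset).add fun x hx => (hψC x (hne x hx)).continuousAt.continuousWithinAt)
  have hxy := hne x hx
  have hval : 0 ≤ w x + ψ x := by
    rcases (mem_closedBall.1 hx.1).eq_or_lt with hxR | hxR
    · have : ψ x = 0 := by
        rw [dist_eq_norm] at hxR
        simp only [hψ, hxR, hc]
        ring
      rw [this, add_zero]
      exact hw0 x hx.1
    rcases (not_lt.1 fun h => hx.2 (mem_ball.2 h)).eq_or_lt with hxs | hxs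
    · have h1 : w y / 2 < w x := hs₀w x (by rw [mem_ball, ← hxs]; exact hss₀)
      have h2 : ψ x = - (w y / 2) + c := by
        rw [dist_eq_norm] at hxs
        simp only [hψ, ← hxs, hε]
        rw [neg_mul, mul_assoc, ← Real.rpow_add (by positivity), add_neg_cancel, Real.rpow_zero,
          mul_one]
      have h3 : 0 < c := by positivity
      linarith
    · exfalso
      have hnhds : closedBall y R \ ball y s ∈ 𝓝 x := by
        filter_upwards [isOpen_ball.mem_nhds (mem_ball.2 hxR),
          isClosed_closedBall.isOpen_compl.mem_nhds (show x ∈ (closedBall y s)ᶜ by simpa using hxs)]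
          with p h1 h2
        exact ⟨ball_subset_closedBall h1, fun h => h2 (ball_subset_closedBall h)⟩
      have h1 := hS x hx.1 ψ (hψC x hxy) (hmin.isLocalMin hnhds)
      set m := 2 * ε * k' * (‖x - y‖ ^ 2) ^ (-k' - 1) with hm
      have hnx : 0 < ‖x - y‖ := norm_pos_iff.2 (sub_ne_zero.2 hxy)
      have hm0 : 0 < m := by positivity
      have h2 := pucci_le_of_d2_form h0 hl (hψC x hxy) (e := (‖x - y‖⁻¹) • (x - y))
        (c := m * (2 * (k' + 1))) (k := m) (by
          rw [norm_smul, norm_inv, norm_norm, inv_mul_cancel₀ hnx.ne']) (by positivity) hm0.le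
        fun v => by
          rw [hψ, d2_add (d2_radial_rpow hxy (-ε) k' v).1 contDiffAt_const, d2_const,
            (d2_radial_rpow hxy (-ε) k' v).2, inner_smul_left, hm]
          refine le_of_eq ?_
          simp only [map_inv₀, conj_trivial]
          field_simp
          ring
      have h3 : 0 < m * (2 * (k' + 1) * lam - Lam * n) := by
        refine mul_pos hm0 ?_
        rw [hk']
        have : 0 ≤ Lam * n := by positivity
        linarith
      linarith
  have h1 := hval.trans (hmin hzA)
  have h2 : ψ z < 0 := by
    have hzy : 0 < ‖z - y‖ := norm_pos_iff.2 (sub_ne_zero.2 (hne z hzA))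
    rw [mem_ball, dist_eq_norm] at hz
    have : (R ^ 2) ^ (-k') < (‖z - y‖ ^ 2) ^ (-k') :=
      Real.rpow_lt_rpow_of_neg (by positivity) (by gcongr) (by linarith)
    simp only [hψ, hc]
    nlinarith
  simp only at h1
  linarith

/-- Strong minimum principle. -/
theorem strong_minimum_principle {lam Lam : ℝ} (h0 : 0 < lam) (hl : lam ≤ Lam) {n : ℕ}
    {D : Set (Euc n)} (hDo : IsOpen D) (hDc : IsPreconnected D) {w : Euc n → ℝ}
    (hw : ContinuousOn w D) (hw0 : ∀ x ∈ D, 0 ≤ w x) (hS : ∀ x ∈ D, MinSuperAt lam Lam w x)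
    (hpos : ∃ x ∈ D, 0 < w x) : ∀ x ∈ D, 0 < w x := by
  obtain ⟨x₀, hx₀, hx₀w⟩ := hpos
  have hU : IsOpen (D ∩ w ⁻¹' Set.Ioi 0) := hw.isOpen_inter_preimage hDo isOpen_Ioi
  have := hDc.subset_of_closure_inter_subset hU ⟨x₀, hx₀, hx₀, hx₀w⟩ fun z ⟨hz, hzD⟩ => by
    obtain ⟨R, hR, hRD⟩ := Metric.isOpen_iff.1 hDo z hzD
    obtain ⟨y, ⟨-, hyw⟩, hzy⟩ := Metric.mem_closure_iff.1 hz (R / 2) (half_pos hR)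
    have hsub : closedBall y (R / 2) ⊆ D := fun x hx => hRD (by
      rw [mem_closedBall] at hx
      rw [mem_ball]
      rw [dist_comm] at hzy
      linarith [dist_triangle x y z])
    exact ⟨hzD, MinSuperAt.pos_of_mem_ball h0 hl (hw.mono hsub) (fun x hx => hw0 x (hsub hx))
      (fun x hx => hS x (hsub hx)) hyw z hzy⟩
  exact fun x hx => (this hx).2

theorem rpow_sub_rpow_le {a b p : ℝ} (ha : 0 ≤ a) (hb : 0 ≤ b) (hp : 1 < p) :
    a ^ p - b ^ p ≤ p * a ^ (p - 1) * (a - b) := by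
  rcases ha.eq_or_lt with rfl | ha
  · rw [Real.zero_rpow (by linarith), Real.zero_rpow (by linarith)]
    simpa using Real.rpow_nonneg hb p
  have h1 := one_add_mul_self_le_rpow_one_add (s := b / a - 1) (by
    have : 0 ≤ b / a := by positivity
    linarith) hp.le
  rw [add_sub_cancel, Real.div_rpow hb ha.le, le_div_iff₀ (by positivity)] at h1
  rw [Real.rpow_sub_one ha.ne']
  have h2 : (1 + p * (b / a - 1)) * a ^ p = a ^ p - p * (a ^ p / a) * (a - b) := by
    field_simp
    ring
  linarith

theorem pucci_exp_profile_le {lam Lam : ℝ} (h0 : 0 < lam) (hl : lam ≤ Lam) {n : ℕ}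
    {e : Euc n} (x z : Euc n) (he : ‖e‖ = 1) {J k : ℝ} (B μ : ℝ) (hJ : 0 ≤ J) (hk : 0 ≤ k) :
    ContDiffAt ℝ 2 (fun y => J * (2 - Real.exp (-B * (μ - ⟪e, y⟫))) + k * ‖y - z‖ ^ 2) x ∧
    pucciMax lam Lam (hess (fun y => J * (2 - Real.exp (-B * (μ - ⟪e, y⟫))) +
      k * ‖y - z‖ ^ 2) x) ≤
      -(J * B ^ 2 * Real.exp (-B * (μ - ⟪e, x⟫))) * lam + 2 * k * Lam * n := by
  have hexp : ∀ s : ℝ, HasDerivAt (fun s => Real.exp (-B * (μ - s)))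
      (Real.exp (-B * (μ - s)) * B) s := fun s => by
    refine ((((hasDerivAt_id s).const_sub μ).const_mul (-B)).exp).congr_deriv ?_
    simp
  refine pucci_profile_le h0 hl he (h := fun s => J * (2 - Real.exp (-B * (μ - s))))
    (h' := fun s => J * -(Real.exp (-B * (μ - s)) * B)) (by fun_prop)
    (Eventually.of_forall fun s => ((hexp s).const_sub 2).const_mul J) ?_ (by positivity) hk
  refine (((hexp _).mul_const B).neg.const_mul J).congr_deriv ?_
  ring

namespace PucciSystem

variable {S : PucciSystem} {n : ℕ}

set_option maxHeartbeats 1000000 in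
theorem moving_plane_step (hn : 0 < n) {K : ℝ} (hK : 0 ≤ K) (M : ℝ) :
    ∃ c > 0, ∀ (e : Euc n) (u : Bool → Euc n → ℝ), ‖e‖ = 1 → S.Sol e 0 u → (∀ b x, u b x ≤ K) →
      ∀ μ ≤ M, (∃ b y, ⟪e, y⟫ ≤ μ ∧ u b (y + (2 * (μ - ⟪e, y⟫)) • e) < u b y) →
      ∃ b y y', 0 < ⟪e, y⟫ ∧ ⟪e, y⟫ ≤ μ - c ∧ u b (y + (2 * (μ - ⟪e, y⟫)) • e) < u b y ∧
        ‖y' - y‖ ≤ 1 ∧ c ≤ u (!b) y' := by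
  obtain ⟨B, hB1, hB⟩ : ∃ B : ℝ, 1 ≤ B ∧ ∀ b, 3 * (2 * S.pw b * K ^ (S.pw b - 1) + 1) <
      S.lam b * B ^ 2 := by
    have : ∀ᶠ B : ℝ in atTop, ∀ b, 3 * (2 * S.pw b * K ^ (S.pw b - 1) + 1) < S.lam b * B ^ 2 :=
      eventually_all.2 fun b => ((tendsto_pow_atTop two_ne_zero).const_mul_atTop
        (S.lam_pos b)).eventually_gt_atTop _
    exact ((eventually_ge_atTop 1).and this).exists
  have hB0 : 0 < B := by linarith
  set m : Bool → ℝ := fun b => S.lam b * B ^ 2 * Real.exp (-B * M) with hm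
  have hm0 : ∀ b, 0 < m b := fun b => by have := S.lam_pos b; positivity
  obtain ⟨δ, hδ0, hδ1, hδ⟩ : ∃ δ : ℝ, 0 < δ ∧ δ < 1 / 2 ∧ ∀ b,
      8 * δ * S.Lam b * n * (4 * B ^ 2) < min 1 (m b / 2) := by
    have h1 : ∀ᶠ δ : ℝ in 𝓝[>] 0, ∀ b, 8 * δ * S.Lam b * n * (4 * B ^ 2) < min 1 (m b / 2) := by
      refine eventually_all.2 fun b => ?_
      have hc : Continuous fun δ : ℝ => 8 * δ * S.Lam b * n * (4 * B ^ 2) := by fun_prop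
      refine (hc.continuousAt.eventually (gt_mem_nhds ?_)).filter_mono nhdsWithin_le_nhds
      have := hm0 b
      simp [this]
    have h2 : ∀ᶠ δ : ℝ in 𝓝[>] 0, δ < 1 / 2 :=
      (gt_mem_nhds (by norm_num)).filter_mono nhdsWithin_le_nhds
    exact ((eventually_mem_nhdsWithin).and (h2.and h1)).exists
  obtain ⟨c, hc0, hcB, hc⟩ : ∃ c : ℝ, 0 < c ∧ c < 1 / (2 * B) ∧ ∀ b,
      2 * S.pw b * c ^ (S.pw b - 1) < m b / 2 := by
    have h1 : ∀ᶠ c : ℝ in 𝓝[>] 0, ∀ b, 2 * S.pw b * c ^ (S.pw b - 1) < m b / 2 := by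
      refine eventually_all.2 fun b => ?_
      have hp := S.one_lt_pw b
      have hc : Continuous fun c : ℝ => 2 * S.pw b * c ^ (S.pw b - 1) :=
        continuous_const.mul (continuous_id.rpow_const fun _ => Or.inr (by linarith))
      refine (hc.continuousAt.eventually (gt_mem_nhds ?_)).filter_mono nhdsWithin_le_nhds
      change 2 * S.pw b * (0 : ℝ) ^ (S.pw b - 1) < m b / 2
      rw [Real.zero_rpow (by linarith)]
      have := hm0 b
      linarith
    have h2 : ∀ᶠ δ : ℝ in 𝓝[>] 0, δ < 1 / (2 * B) :=
      (gt_mem_nhds (by positivity)).filter_mono nhdsWithin_le_nhds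
    exact ((eventually_mem_nhdsWithin).and (h2.and h1)).exists
  refine ⟨c, hc0, fun e u he hu huK μ hμ ⟨b₀, y₀, hy₀, hbad⟩ => ?_⟩
  set T : Euc n → Euc n := fun y => y + (2 * (μ - ⟪e, y⟫)) • e with hT
  set Ψ : Euc n → ℝ := fun y => 2 - Real.exp (-B * (μ - ⟪e, y⟫)) with hΨ
  have hΨ1 : ∀ y, ⟪e, y⟫ ≤ μ → 1 ≤ Ψ y := fun y hy => by
    have : Real.exp (-B * (μ - ⟪e, y⟫)) ≤ 1 := Real.exp_le_one_iff.2 (by nlinarith)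
    simp only [hΨ]; linarith
  have hΨ2 : ∀ y, Ψ y < 2 := fun y => by
    have := Real.exp_pos (-B * (μ - ⟪e, y⟫))
    simp only [hΨ]; linarith
  set G : Set ℝ := {r | ∃ b y, ⟪e, y⟫ ≤ μ ∧ r = (u b y - u b (T y)) / Ψ y} with hG
  have hGb : BddAbove G := ⟨K, by
    rintro r ⟨b, y, hy, rfl⟩
    rw [div_le_iff₀ (by linarith [hΨ1 y hy])]
    nlinarith [hΨ1 y hy, huK b y, hu.nonneg b (T y)]⟩
  set J := sSup G with hJ
  have hJle : ∀ b y, ⟪e, y⟫ ≤ μ → u b y - u b (T y) ≤ J * Ψ y := fun b y hy => by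
    rw [← div_le_iff₀ (by linarith [hΨ1 y hy])]
    exact le_csSup hGb ⟨b, y, hy, rfl⟩
  have hJ0 : 0 < J := (div_pos (sub_pos.2 hbad) (by linarith [hΨ1 y₀ hy₀])).trans_le
    (le_csSup hGb ⟨b₀, y₀, hy₀, rfl⟩)
  obtain ⟨_, ⟨b, y, hy, rfl⟩, hyJ⟩ := exists_lt_of_lt_csSup (s := G) ⟨_, b₀, y₀, hy₀, rfl⟩
    (show (1 - δ) * J < J by nlinarith)
  have hΨy := hΨ1 y hy
  rw [lt_div_iff₀ (by linarith)] at hyJ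
  have hyT : u b (T y) < u b y := by
    have : 0 < (1 - δ) * J * Ψ y := by
      have : 0 < 1 - δ := by linarith
      positivity
    linarith
  have hy0 : 0 < ⟪e, y⟫ := by
    by_contra! h
    have := hu.zero b y (by linarith)
    linarith [hu.nonneg b (T y)]
  have hTc : Continuous T := by fun_prop
  have hΨc : Continuous Ψ := by fun_prop
  set k := 4 * δ * J * (4 * B ^ 2) with hk
  have hk0 : 0 < k := by positivity
  have hA : IsCompact (closedBall y (1 / (2 * B)) ∩ {x | ⟪e, x⟫ ≤ μ}) :=
    (isCompact_closedBall _ _).inter_right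
      (isClosed_le (by fun_prop : Continuous fun x : Euc n => ⟪e, x⟫) continuous_const)
  obtain ⟨x, ⟨hx, hxμ⟩, hmax⟩ := hA.exists_isMaxOn
    ⟨y, mem_closedBall_self (by positivity), hy⟩
    (f := fun x => u b x - u b (T x) - (J * Ψ x + k * ‖x - y‖ ^ 2))
    (by have := hu.cont b; fun_prop)
  have hval : -(2 * δ * J) < u b x - u b (T x) - (J * Ψ x + k * ‖x - y‖ ^ 2) := by
    refine lt_of_lt_of_le ?_ (hmax ⟨mem_closedBall_self (by positivity), hy⟩)
    simp only [sub_self, norm_zero]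
    nlinarith [hΨ2 y, mul_pos hδ0 hJ0]
  have hkx : 0 ≤ k * ‖x - y‖ ^ 2 := by positivity
  have hux : 0 < u b x - u b (T x) := by nlinarith [hΨ1 x hxμ]
  have hx0 : 0 < ⟪e, x⟫ := by
    by_contra! h
    have := hu.zero b x (by linarith)
    linarith [hu.nonneg b (T x)]
  have hxμ' : ⟪e, x⟫ < μ := by
    refine lt_of_le_of_ne hxμ fun h => ?_
    simp [hT, h] at hux
  have hxρ : dist x y < 1 / (2 * B) := by
    refine lt_of_le_of_ne hx fun h => ?_
    rw [dist_eq_norm] at h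
    have h1 : k * ‖x - y‖ ^ 2 = 4 * δ * J := by
      rw [h, hk]
      field_simp
      norm_num
    have := hJle b x hxμ
    linarith [mul_pos hδ0 hJ0]
  have hTx : ⟪e, T x⟫ = 2 * μ - ⟪e, x⟫ := by
    simp only [hT, inner_add_right, inner_smul_right, real_inner_self_eq_norm_sq, he]
    ring
  obtain ⟨Q, hQ⟩ := exists_reflection he
  have hRT : ∀ z, T x + Q (z - x) = T z := fun z => by
    simp only [hT, hQ, inner_sub_right]
    module
  have hDo : IsOpen {x : Euc n | 0 < ⟪e, x⟫} :=
    isOpen_lt continuous_const (by fun_prop : Continuous fun x : Euc n => ⟪e, x⟫)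
  have hsolnear : ∀ z, 0 < ⟪e, z⟫ → ∀ᶠ z' in 𝓝 z, S.SolAt u z' := fun z hz =>
    (hDo.eventually_mem hz).mono fun z' hz' => hu.solAt z' (by simpa using hz')
  obtain ⟨hψC, hψp⟩ := pucci_exp_profile_le (S.lam_pos b) (S.lam_le b) x y he B μ hJ0.le hk0.le
  have hrc : Continuous fun z => u (!b) z ^ S.pw b :=
    (hu.cont _).rpow_const fun _ => Or.inr (S.pw_pos b).le
  have hdiff := viscosity_difference (S.lam_pos b) (S.lam_le b) hn (hu.cont b) (hu.cont b) hrc hrc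
    ((hsolnear x hx0).mono fun z hz => (hz b).1)
    ((hsolnear (T x) (by rw [hTx]; linarith)).mono fun z hz => (hz b).2) Q hψC (by
      filter_upwards [isOpen_ball.mem_nhds (mem_ball.2 hxρ),
        (isOpen_lt (by fun_prop : Continuous fun x : Euc n => ⟪e, x⟫)
          continuous_const).mem_nhds hxμ'] with z hz1 hz2
      have := hmax ⟨ball_subset_closedBall hz1, le_of_lt hz2⟩
      simp only [hRT]
      exact this)
  have htan := rpow_sub_rpow_le (hu.nonneg (!b) x) (hu.nonneg (!b) (T x)) (S.one_lt_pw b)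
  set a := u (!b) x with ha
  have ha0 : 0 ≤ a := hu.nonneg _ _
  have hpa : 0 ≤ S.pw b * a ^ (S.pw b - 1) := by
    have := S.pw_pos b
    positivity
  have h2J : a - u (!b) (T x) ≤ 2 * J := (hJle (!b) x hxμ).trans (by nlinarith [hΨ2 x])
  set E := Real.exp (-B * (μ - ⟪e, x⟫)) with hE
  have hmain : S.lam b * B ^ 2 * E ≤
      8 * δ * S.Lam b * n * (4 * B ^ 2) + 2 * S.pw b * a ^ (S.pw b - 1) := by
    refine le_of_mul_le_mul_left ?_ hJ0
    have := htan.trans (mul_le_mul_of_nonneg_left h2J hpa)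
    rw [hk] at hψp
    linarith
  have hδb := lt_min_iff.1 (hδ b)
  have hs : 1 / B < μ - ⟪e, x⟫ := by
    by_contra! h
    have h1 : Real.exp (-1) ≤ E := by
      rw [hE, Real.exp_le_exp]
      have := (le_div_iff₀ hB0).1 h
      linarith
    have h2 : a ^ (S.pw b - 1) ≤ K ^ (S.pw b - 1) :=
      Real.rpow_le_rpow ha0 (huK _ _) (by linarith [S.one_lt_pw b])
    have h3 := mul_le_mul_of_nonneg_left h2 (S.pw_pos b).le
    have h4 : 1 / 3 < Real.exp (-1) := by
      rw [Real.exp_neg, one_div]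
      exact inv_strictAnti₀ (Real.exp_pos 1) (by linarith [Real.exp_one_lt_d9])
    have h5 : 0 < S.lam b * B ^ 2 := by have := S.lam_pos b; positivity
    have h6 : S.lam b * B ^ 2 * (1 / 3) ≤ S.lam b * B ^ 2 * E :=
      mul_le_mul_of_nonneg_left (h4.le.trans h1) h5.le
    linarith [hB b, hmain, hδb.1, h3]
  refine ⟨b, y, x, hy0, ?_, hyT, ?_, ?_⟩
  · have h1 := real_inner_le_norm e (y - x)
    rw [he, one_mul, inner_sub_right, norm_sub_rev, ← dist_eq_norm] at h1
    have h2 : 1 / B = 1 / (2 * B) + 1 / (2 * B) := by field_simp; norm_num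
    linarith
  · rw [← dist_eq_norm]
    refine hxρ.le.trans ?_
    rw [div_le_one (by positivity)]
    linarith
  · by_contra! h
    have h1 : Real.exp (-B * M) ≤ E := by
      rw [hE, Real.exp_le_exp]
      nlinarith
    have h2 : a ^ (S.pw b - 1) ≤ c ^ (S.pw b - 1) :=
      Real.rpow_le_rpow ha0 h.le (by linarith [S.one_lt_pw b])
    have h3 := mul_le_mul_of_nonneg_left h2 (S.pw_pos b).le
    have h5 : 0 ≤ S.lam b * B ^ 2 := by have := S.lam_pos b; positivity
    have h6 : m b ≤ S.lam b * B ^ 2 * E := mul_le_mul_of_nonneg_left h1 h5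
    linarith [hc b]

end PucciSystem

theorem Ultrafilter.exists_tendsto_of_mem_compact {ι X : Type*} [TopologicalSpace X]
    (l : Ultrafilter ι) {f : ι → X} {K : Set X} (hK : IsCompact K) (hf : ∀ᶠ i in l, f i ∈ K) :
    ∃ x ∈ K, Tendsto f l (𝓝 x) :=
  hK.ultrafilter_le_nhds (l.map f) (le_principal_iff.2 hf)

namespace PucciSystem

variable {S : PucciSystem} {n : ℕ}

theorem pos_of_exists_pos {D : Set (Euc n)} (hDo : IsOpen D) (hDc : IsPreconnected D)
    {v : Bool → Euc n → ℝ} (hc : ∀ b, Continuous (v b)) (h0 : ∀ b x, 0 ≤ v b x)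
    (hS : ∀ x ∈ D, S.SolAt v x) (hex : ∃ b, ∃ x ∈ D, 0 < v b x) :
    ∀ b, ∀ x ∈ D, 0 < v b x := by
  have key : ∀ b, (∃ x ∈ D, 0 < v b x) → ∀ x ∈ D, 0 < v b x := fun b hb =>
    strong_minimum_principle (S.lam_pos b) (S.lam_le b) hDo hDc (hc b).continuousOn
      (fun x _ => h0 b x) (fun x hx => ((hS x hx b).2).minSuperAt (S.lam_le b)
        (Real.rpow_nonneg (h0 _ _) _)) hb
  obtain ⟨b, x, hx, hb⟩ := hex
  have hother : ∃ x ∈ D, 0 < v (!b) x := by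
    by_contra! h
    have h1 := (hS x hx (!b)).2 (fun _ => 0) contDiffAt_const (by
      filter_upwards [hDo.mem_nhds hx] with z hz
      have := h x hx
      have := h0 (!b) z
      linarith)
    have h2 := zero_le_pucci_add_neg (S.lam_le (!b)) (x := x)
      (contDiffAt_const (c := (0 : ℝ)) (𝕜 := ℝ) (n := 2))
    simp only [neg_zero] at h2
    rw [Bool.not_not] at h1
    have h3 := Real.rpow_pos_of_pos hb (S.pw (!b))
    linarith
  intro b'
  by_cases hbb : b' = b
  · exact hbb ▸ key b ⟨x, hx, hb⟩
  · rw [Bool.eq_not_of_ne hbb]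
    exact key _ hother

theorem SolAt.scale {u : Bool → Euc n → ℝ} {a x : Euc n} {m : Bool → ℝ} {c : ℝ}
    (hm : ∀ b, 0 < m b) (hc : c ≠ 0) (hmc : ∀ b, m b * c ^ 2 = m (!b) ^ S.pw b)
    (h0 : ∀ b z, 0 ≤ u b z) (h : S.SolAt u (a + c • x)) :
    S.SolAt (fun b z => m b * u b (a + c • z)) x := fun b => by
  rw [Real.mul_rpow (hm _).le (h0 _ _), ← hmc]
  exact ⟨(h b).1.scale (S.lam_le b) (hm b) hc, (h b).2.scale (S.lam_le b) (hm b) hc⟩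

theorem Sol.scale {e a : Euc n} {d c : ℝ} {u : Bool → Euc n → ℝ} {m : Bool → ℝ}
    (hm : ∀ b, 0 < m b) (hc : 0 < c) (hmc : ∀ b, m b * c ^ 2 = m (!b) ^ S.pw b)
    (h : S.Sol e d u) : S.Sol e ((d + ⟪e, a⟫) / c) (fun b z => m b * u b (a + c • z)) where
  cont b := by have := h.cont b; fun_prop
  nonneg b x := mul_nonneg (hm b).le (h.nonneg _ _)
  zero b x hx := by
    rw [← neg_div, le_div_iff₀ hc] at hx
    rw [h.zero b, mul_zero]
    rw [inner_add_right, inner_smul_right]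
    linarith
  solAt x hx := by
    rw [← neg_div, div_lt_iff₀ hc] at hx
    refine SolAt.scale hm hc.ne' hmc h.nonneg (h.solAt _ ?_)
    rw [inner_add_right, inner_smul_right]
    linarith

theorem Sol.translate {e : Euc n} {d : ℝ} {u : Bool → Euc n → ℝ} (h : S.Sol e d u) (a : Euc n) :
    S.Sol e (d + ⟪e, a⟫) (fun b z => u b (a + z)) := by
  simpa using h.scale (a := a) (m := fun _ => 1) (c := 1) (fun _ => one_pos) one_pos (by simp)

theorem isPreconnected_halfspace (e : Euc n) (c : ℝ) : IsPreconnected {x : Euc n | c < ⟪e, x⟫} :=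
  (convex_halfSpace_gt (innerₗ (Euc n) e).isLinear c).isPreconnected

theorem isOpen_halfspace (e : Euc n) (c : ℝ) : IsOpen {x : Euc n | c < ⟪e, x⟫} :=
  isOpen_lt continuous_const (by fun_prop : Continuous fun x : Euc n => ⟪e, x⟫)

/-- A positive solution lying below its reflection across `{⟪e, y⟫ = μ}` lies strictly below. -/
theorem reflection_strict (hn : 0 < n) {e : Euc n} (he : ‖e‖ = 1) {v : Bool → Euc n → ℝ}
    (hv : S.Sol e 0 v) (hpos : ∀ b x, 0 < ⟪e, x⟫ → 0 < v b x) {μ : ℝ}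
    (hμ : ∀ b y, ⟪e, y⟫ ≤ μ → v b y ≤ v b (y + (2 * (μ - ⟪e, y⟫)) • e)) (b : Bool) {y : Euc n}
    (h0 : 0 ≤ ⟪e, y⟫) (h1 : ⟪e, y⟫ < μ) : v b y < v b (y + (2 * (μ - ⟪e, y⟫)) • e) := by
  set T : Euc n → Euc n := fun y => y + (2 * (μ - ⟪e, y⟫)) • e with hT
  have hTi : ∀ x, ⟪e, T x⟫ = 2 * μ - ⟪e, x⟫ := fun x => by
    simp only [hT, inner_add_right, inner_smul_right, real_inner_self_eq_norm_sq, he]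
    ring
  rcases h0.eq_or_lt with h0 | h0
  · rw [hv.zero b y (by linarith)]
    exact hpos b (T y) (by rw [hTi]; linarith)
  have hTc : Continuous T := by fun_prop
  set D := {x : Euc n | 0 < ⟪e, x⟫} ∩ {x | ⟪e, x⟫ < μ} with hD
  have hDo : IsOpen D := (isOpen_halfspace e 0).inter
    (isOpen_lt (by fun_prop : Continuous fun x : Euc n => ⟪e, x⟫) continuous_const)
  have hDc : IsPreconnected D := ((convex_halfSpace_gt (innerₗ (Euc n) e).isLinear 0).inter
    (convex_halfSpace_lt (innerₗ (Euc n) e).isLinear μ)).isPreconnected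
  have hμ0 : 0 < μ := h0.trans h1
  obtain ⟨Q, hQ⟩ := exists_reflection he
  have hRT : ∀ x z, T x + Q (z - x) = T z := fun x z => by
    simp only [hT, hQ, inner_sub_right]
    module
  have hnear : ∀ z, 0 < ⟪e, z⟫ → ∀ᶠ z' in 𝓝 z, S.SolAt v z' := fun z hz =>
    ((isOpen_halfspace e 0).eventually_mem hz).mono fun z' hz' => hv.solAt z' (by simpa using hz')
  have hcb := hv.cont b
  have hw : Continuous fun x => v b (T x) - v b x := by fun_prop
  have hrc : Continuous fun z => v (!b) z ^ S.pw b :=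
    (hv.cont _).rpow_const fun _ => Or.inr (S.pw_pos b).le
  have := strong_minimum_principle (S.lam_pos b) (S.lam_le b) hDo hDc hw.continuousOn
    (fun x hx => sub_nonneg.2 (hμ b x (le_of_lt hx.2))) (fun x hx ψ hψ hmin => by
      have hx1 : 0 < ⟪e, x⟫ := hx.1
      have hx2 : ⟪e, x⟫ < μ := hx.2
      refine le_trans (sub_nonneg.2 (Real.rpow_le_rpow (hv.nonneg _ _) (hμ (!b) x hx2.le)
        (S.pw_pos b).le)) (viscosity_difference (S.lam_pos b) (S.lam_le b) hn (hv.cont b)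
          (hv.cont b) hrc hrc ((hnear x hx1).mono fun z hz => (hz b).1)
          ((hnear (T x) (by rw [hTi]; linarith)).mono fun z hz => (hz b).2) Q hψ ?_)
      filter_upwards [hmin] with z hz
      have h1 : v b x - v b (T x + Q (x - x)) - ψ x = -(v b (T x) - v b x + ψ x) := by
        rw [hRT]
        ring
      have h2 : v b z - v b (T x + Q (z - x)) - ψ z = -(v b (T z) - v b z + ψ z) := by
        rw [hRT]
        ring
      exact (h2.trans_le (neg_le_neg hz)).trans_eq h1.symm) ?_ y ⟨h0, h1⟩
  · linarith
  have h2 : 0 < v b (T 0) - v b 0 := by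
    rw [hv.zero b 0 (by simp), sub_zero]
    exact hpos b _ (by rw [hTi]; simpa using hμ0)
  have h3 : ∀ᶠ s : ℝ in 𝓝[>] 0, 0 < v b (T (s • e)) - v b (s • e) := by
    have hc : Continuous fun s : ℝ => v b (T (s • e)) - v b (s • e) := by fun_prop
    refine (hc.continuousAt.eventually (lt_mem_nhds ?_)).filter_mono nhdsWithin_le_nhds
    simpa using h2
  obtain ⟨s, hs0, hsμ, hs⟩ := ((eventually_mem_nhdsWithin).and
    (((gt_mem_nhds hμ0).filter_mono nhdsWithin_le_nhds).and h3)).exists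
  refine ⟨s • e, ?_, hs⟩
  have : ⟪e, s • e⟫ = s := by rw [inner_smul_right, real_inner_self_eq_norm_sq, he]; ring
  exact ⟨hs0.trans_eq this.symm, this.trans_lt hsμ⟩

theorem Sol.le_reflection (hn : 0 < n) {e : Euc n} (he : ‖e‖ = 1) {u : Bool → Euc n → ℝ}
    (hu : S.Sol e 0 u) {K : ℝ} (hK : ∀ b x, u b x ≤ K) (μ : ℝ) :
    ∀ b y, ⟪e, y⟫ ≤ μ → u b y ≤ u b (y + (2 * (μ - ⟪e, y⟫)) • e) := by
  set Bad := {μ : ℝ | ∃ b y, ⟪e, y⟫ ≤ μ ∧ u b (y + (2 * (μ - ⟪e, y⟫)) • e) < u b y} with hBad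
  by_contra! hcon
  have hne : Bad.Nonempty := ⟨μ, hcon⟩
  have hB0 : ∀ μ ∈ Bad, 0 < μ := by
    rintro μ ⟨b, y, hy, hlt⟩
    by_contra! h
    rw [hu.zero b y (by linarith)] at hlt
    exact hlt.not_ge (hu.nonneg _ _)
  have hbdd : BddBelow Bad := ⟨0, fun μ hμ => (hB0 μ hμ).le⟩
  set μ₀ := sInf Bad with hμ₀
  have hgood : ∀ b y, ⟪e, y⟫ ≤ μ₀ → u b y ≤ u b (y + (2 * (μ₀ - ⟪e, y⟫)) • e) := by
    intro b y hy
    rcases hy.eq_or_lt with h | h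
    · simp [h]
    have hc : Continuous fun μ : ℝ => u b (y + (2 * (μ - ⟪e, y⟫)) • e) := by
      have := hu.cont b
      fun_prop
    refine ge_of_tendsto (hc.continuousAt.tendsto.mono_left
      (nhdsWithin_le_nhds : 𝓝[<] μ₀ ≤ 𝓝 μ₀)) ?_
    filter_upwards [Ioo_mem_nhdsLT h] with μ hμ
    by_contra! hlt
    exact notMem_of_lt_csInf hμ.2 hbdd ⟨b, y, hμ.1.le, hlt⟩
  have hK0 : 0 ≤ K := (hu.nonneg true 0).trans (hK true 0)
  obtain ⟨c, hc0, hstep⟩ := moving_plane_step (S := S) hn hK0 (μ₀ + 1)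
  have hseq : ∀ k : ℕ, ∃ μ ∈ Bad, μ < μ₀ + 1 / ((k : ℝ) + 1) := fun k =>
    exists_lt_of_csInf_lt hne (by
      have : 0 < 1 / ((k : ℝ) + 1) := by positivity
      linarith)
  choose ν hνB hν using hseq
  have hν0 : ∀ k, μ₀ ≤ ν k := fun k => csInf_le hbdd (hνB k)
  have hν1 : ∀ k, ν k ≤ μ₀ + 1 := fun k => (hν k).le.trans (by
    have : 1 / ((k : ℝ) + 1) ≤ 1 := by
      rw [div_le_one (by positivity)]
      linarith [(Nat.cast_nonneg k : (0 : ℝ) ≤ k)]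
    linarith)
  choose β y y' hy0 hyc hlt hyy' hcu using fun k => hstep e u he hu hK (ν k) (hν1 k) (hνB k)
  set l : Ultrafilter ℕ := hyperfilter ℕ with hl
  have hνl : Tendsto ν l (𝓝 μ₀) := by
    have : Tendsto ν atTop (𝓝 μ₀) := by
      refine tendsto_of_tendsto_of_tendsto_of_le_of_le tendsto_const_nhds
        (h := fun k : ℕ => μ₀ + 1 / ((k : ℝ) + 1)) ?_ hν0 fun k => (hν k).le
      simpa using tendsto_const_nhds.add (tendsto_one_div_add_atTop_nhds_zero_nat (𝕜 := ℝ))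
    exact this.mono_left Nat.hyperfilter_le_atTop
  obtain ⟨b, hb⟩ : ∃ b, ∀ᶠ k in l, β k = b := by
    rcases (Ultrafilter.eventually_or (f := l) (p := fun k => β k = true)
      (q := fun k => β k = false)).1 (Eventually.of_forall fun k => by cases β k <;> simp)
      with h | h
    · exact ⟨_, h⟩
    · exact ⟨_, h⟩
  set a : ℕ → Euc n := fun k => y k - ⟪e, y k⟫ • e with ha
  have hea : ∀ k, ⟪e, a k⟫ = 0 := fun k => by
    simp only [ha, inner_sub_right, inner_smul_right, real_inner_self_eq_norm_sq, he]
    ring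
  have hU : ∀ k, S.Sol e 0 (fun b z => u b (a k + z)) := fun k => by
    simpa only [hea, add_zero] using hu.translate (a k)
  obtain ⟨v, hvc, hv0, hvl, hvS⟩ := exists_limit (S := S) hn l he hU
    fun R => ⟨K, Eventually.of_forall fun k b x _ => hK b _⟩
  have hpt : ∀ b x, Tendsto (fun k => u b (a k + x)) l (𝓝 (v b x)) := fun b x =>
    (hvl b).tendsto_comp (hvc b).continuousAt tendsto_const_nhds
  have hvsol : S.Sol e 0 v :=
    { cont := hvc
      nonneg := hv0
      zero := fun b x hx => tendsto_nhds_unique (hpt b x) (by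
        simp only [fun k => (hU k).zero b x hx]
        exact tendsto_const_nhds)
      solAt := fun x hx => by
        rw [neg_zero] at hx
        exact hvS x (⟪e, x⟫ / 2) (by linarith) (Eventually.of_forall fun _ => by linarith) }
  obtain ⟨t, ht, htl⟩ := l.exists_tendsto_of_mem_compact (isCompact_Icc (a := 0) (b := μ₀ + 1))
    (f := fun k => ⟪e, y k⟫) (Eventually.of_forall fun k =>
      ⟨(hy0 k).le, by linarith [hyc k, hν1 k]⟩)
  have htc : t ≤ μ₀ - c := le_of_tendsto_of_tendsto htl (hνl.sub_const c)
    (Eventually.of_forall hyc)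
  have hya : ∀ k, y k = a k + ⟪e, y k⟫ • e := fun k => by simp [ha]
  obtain ⟨w, -, hwl⟩ := l.exists_tendsto_of_mem_compact
    (isCompact_closedBall (0 : Euc n) (μ₀ + 2)) (f := fun k => y' k - a k)
    (Eventually.of_forall fun k => by
      rw [mem_closedBall_zero_iff]
      have h1 : y' k - a k = (y' k - y k) + ⟪e, y k⟫ • e := by
        simp only [ha]
        abel
      rw [h1]
      refine (norm_add_le _ _).trans ?_
      rw [norm_smul, he, Real.norm_of_nonneg (hy0 k).le]
      linarith [hyy' k, hyc k, hν1 k])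
  have hvw : c ≤ v (!b) w := by
    refine ge_of_tendsto ((hvl (!b)).tendsto_comp (hvc (!b)).continuousAt hwl) ?_
    filter_upwards [hb] with k hk
    simpa [hk] using hcu k
  have hvpos : ∀ b x, 0 < ⟪e, x⟫ → 0 < v b x := by
    refine pos_of_exists_pos (isOpen_halfspace e 0) (isPreconnected_halfspace e 0) hvc hv0
      (fun x hx => hvsol.solAt x (by simpa using hx)) ⟨!b, w, ?_, hc0.trans_le hvw⟩
    by_contra h
    have := hvsol.zero (!b) w (by simpa using h)
    linarith
  have hvgood : ∀ b y, ⟪e, y⟫ ≤ μ₀ → v b y ≤ v b (y + (2 * (μ₀ - ⟪e, y⟫)) • e) := fun b y hy =>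
    le_of_tendsto_of_tendsto (hpt b y) (hpt b _) (Eventually.of_forall fun k => by
      have h := hgood b (a k + y) (by rw [inner_add_right, hea, zero_add]; exact hy)
      rwa [inner_add_right, hea, zero_add, add_assoc] at h)
  have hte : ⟪e, t • e⟫ = t := by rw [inner_smul_right, real_inner_self_eq_norm_sq, he]; ring
  have hstrict := reflection_strict hn he hvsol hvpos hvgood b (y := t • e)
    (by rw [hte]; exact ht.1) (by rw [hte]; linarith)
  refine hstrict.not_ge ?_
  rw [hte]
  refine le_of_tendsto_of_tendsto ((hvl b).tendsto_comp (hvc b).continuousAt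
    ((htl.smul_const e).add (((hνl.sub htl).const_mul 2).smul_const e)))
    ((hvl b).tendsto_comp (hvc b).continuousAt (htl.smul_const e)) ?_
  filter_upwards [hb] with k hk
  have h := (hlt k).le
  rw [hk] at h
  simp only [← add_assoc, ← hya]
  exact h

theorem Sol.monotone (hn : 0 < n) {e : Euc n} (he : ‖e‖ = 1) {u : Bool → Euc n → ℝ}
    (hu : S.Sol e 0 u) {K : ℝ} (hK : ∀ b x, u b x ≤ K) (b : Bool) (x : Euc n) {t : ℝ}
    (ht : 0 ≤ t) : u b x ≤ u b (x + t • e) := by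
  have := hu.le_reflection hn he hK (⟪e, x⟫ + t / 2) b x (by linarith)
  rwa [show 2 * (⟪e, x⟫ + t / 2 - ⟪e, x⟫) = t by ring] at this

end PucciSystem

/-- The logarithmically corrected radial power is almost a subsolution. -/
theorem pucci_log_barrier {lam Lam : ℝ} (hl : lam ≤ Lam) {n : ℕ} {k c δ : ℝ}
    (hk : 0 < k) (hcrit : lam * ((n : ℝ) - 1) ≤ (2 * k + 1) * Lam) (hδ : 0 ≤ δ)
    (hδc : δ ≤ 2 * k * c) {x : Euc n} (hx : 1 ≤ ‖x‖) :
    ContDiffAt ℝ 2 (fun y : Euc n =>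
      (‖y‖ ^ 2) ^ (-k) * (c + δ / 2 * Real.log (‖y‖ ^ 2))) x ∧
    -(2 * k * δ * Lam) * (‖x‖ ^ 2) ^ (-k - 1) ≤ pucciMax lam Lam
      (hess (fun y : Euc n => (‖y‖ ^ 2) ^ (-k) * (c + δ / 2 * Real.log (‖y‖ ^ 2))) x) := by
  set ρ := ‖x‖ ^ 2 with hρ
  have hρ1 : 1 ≤ ρ := one_le_pow₀ hx
  have hρ0 : 0 < ρ := by linarith
  set A : ℝ → ℝ := fun s => k * c + k * (δ / 2) * Real.log s - δ / 2 with hA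
  have hA0 : 0 ≤ A ρ := by
    have : 0 ≤ k * (δ / 2) * Real.log ρ := by
      have := Real.log_nonneg hρ1
      positivity
    simp only [hA]
    linarith
  have hC : ContDiffAt ℝ 2 (fun s : ℝ => s ^ (-k) * (c + δ / 2 * Real.log s)) (‖x - 0‖ ^ 2) := by
    rw [sub_zero]
    exact (Real.contDiffAt_rpow_const_of_ne hρ0.ne').mul
      (contDiffAt_const.add (contDiffAt_const.mul (Real.contDiffAt_log.2 hρ0.ne')))
  have hd1 : ∀ s : ℝ, 0 < s → HasDerivAt (fun s : ℝ => s ^ (-k) * (c + δ / 2 * Real.log s))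
      (-(s ^ (-k - 1) * A s)) s := fun s hs => by
    refine ((Real.hasDerivAt_rpow_const (Or.inl hs.ne')).mul
      (((Real.hasDerivAt_log hs.ne').const_mul (δ / 2)).const_add c)).congr_deriv ?_
    have : s ^ (-k) = s ^ (-k - 1) * s := by
      rw [Real.rpow_sub_one hs.ne', div_mul_cancel₀ _ hs.ne']
    rw [this]
    simp only [hA]
    field_simp
    ring
  have hd2 : HasDerivAt (fun s : ℝ => -(s ^ (-k - 1) * A s))
      (ρ ^ (-k - 1) * ρ⁻¹ * ((k + 1) * A ρ - k * δ / 2)) (‖x - 0‖ ^ 2) := by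
    rw [sub_zero]
    refine ((Real.hasDerivAt_rpow_const (Or.inl hρ0.ne')).mul
      ((((Real.hasDerivAt_log hρ0.ne').const_mul (k * (δ / 2))).const_add (k * c)).sub_const
        (δ / 2))).neg.congr_deriv ?_
    have : ρ ^ (-k - 1 - 1) = ρ ^ (-k - 1) * ρ⁻¹ := by
      rw [Real.rpow_sub_one hρ0.ne', div_eq_mul_inv]
    rw [this]
    simp only [hA]
    ring
  have hmain := d2_radial (c := 0) hC ((lt_mem_nhds (by rw [sub_zero]; exact hρ0)).mono
    fun s hs => hd1 s hs) hd2
  simp only [sub_zero] at hmain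
  have hx0 : ‖x‖ ≠ 0 := by linarith
  refine ⟨(hmain 0).1, le_trans ?_ (trace_add_le_pucci hl (hmain 0).1 (e := ‖x‖⁻¹ • x)
    (by rw [norm_smul, norm_inv, norm_norm, inv_mul_cancel₀ hx0])
    (EuclideanSpace.basisFun (Fin n) ℝ))⟩
  rw [d2_smul, Finset.sum_congr rfl fun i _ => (hmain _).2, (hmain _).2, Finset.sum_add_distrib,
    ← Finset.mul_sum, ← Finset.mul_sum, OrthonormalBasis.sum_sq_inner_left]
  simp only [OrthonormalBasis.norm_eq_one, one_pow, Finset.sum_const, Finset.card_univ,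
    Fintype.card_fin, nsmul_eq_mul, mul_one, real_inner_self_eq_norm_sq, inv_pow]
  rw [← hρ]
  have hcoef : 0 ≤ A ρ * (2 * ((2 * k + 1) * Lam - lam * ((n : ℝ) - 1))) :=
    mul_nonneg hA0 (by linarith)
  have hpw : 0 < ρ ^ (-k - 1) := Real.rpow_pos_of_pos hρ0 _
  have key : lam * (4 * (ρ ^ (-k - 1) * ρ⁻¹ * ((k + 1) * A ρ - k * δ / 2)) * ρ +
      2 * -(ρ ^ (-k - 1) * A ρ) * n) + (Lam - lam) * (ρ⁻¹ *
      (4 * (ρ ^ (-k - 1) * ρ⁻¹ * ((k + 1) * A ρ - k * δ / 2)) * ρ ^ 2 +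
      2 * -(ρ ^ (-k - 1) * A ρ) * ρ)) = -(2 * k * δ * Lam) * ρ ^ (-k - 1) +
      ρ ^ (-k - 1) * (A ρ * (2 * ((2 * k + 1) * Lam - lam * ((n : ℝ) - 1)))) := by
    field_simp
    ring
  have h1 := key.symm.le
  have := mul_nonneg hpw.le hcoef
  linarith

theorem exterior_lower_bound {lam Lam : ℝ} (hl : lam ≤ Lam) {n : ℕ} {k c δ : ℝ}
    (hk : 0 < k) (hcrit : lam * ((n : ℝ) - 1) ≤ (2 * k + 1) * Lam) (hδ : 0 ≤ δ)
    (hδc : δ ≤ 2 * k * c) {w f : Euc n → ℝ} (hw : Continuous w) (hw0 : ∀ x, 0 < w x)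
    (hS : ∀ x, SuperAt lam Lam w x (f x)) (hc : ∀ x, ‖x‖ = 1 → c ≤ w x)
    (hf : ∀ x, 1 ≤ ‖x‖ → 2 * k * δ * Lam * (‖x‖ ^ 2) ^ (-k - 1) < f x) :
    ∀ x, 1 ≤ ‖x‖ → (‖x‖ ^ 2) ^ (-k) * (c + δ / 2 * Real.log (‖x‖ ^ 2)) ≤ w x := by
  intro x₁ hx₁
  by_contra! hlt
  set g : Euc n → ℝ := fun y => (‖y‖ ^ 2) ^ (-k) * (c + δ / 2 * Real.log (‖y‖ ^ 2)) with hg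
  have htend : Tendsto (fun r : ℝ => (r ^ 2) ^ (-k) * (c + δ / 2 * Real.log (r ^ 2))) atTop
      (𝓝 0) := by
    have h1 : Tendsto (fun s : ℝ => s ^ (-k) * (c + δ / 2 * Real.log s)) atTop (𝓝 0) := by
      have h2 := ((tendsto_rpow_neg_atTop hk).const_mul c).add
        ((isLittleO_log_rpow_atTop hk).tendsto_div_nhds_zero.const_mul (δ / 2))
      rw [mul_zero, mul_zero, add_zero] at h2
      refine h2.congr' ?_
      filter_upwards [eventually_gt_atTop 0] with s hs
      rw [Real.rpow_neg hs.le]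
      ring
    exact h1.comp (tendsto_pow_atTop two_ne_zero)
  have hlt' : w x₁ < g x₁ := hlt
  obtain ⟨R, hR1, hR⟩ := ((eventually_gt_atTop ‖x₁‖).and
    (htend.eventually (gt_mem_nhds (sub_pos.2 hlt)))).exists
  have hAc : IsCompact (closedBall (0 : Euc n) R ∩ {x | 1 ≤ ‖x‖}) :=
    (isCompact_closedBall _ _).inter_right (isClosed_le continuous_const continuous_norm)
  have hgc : ContinuousOn g {x | 1 ≤ ‖x‖} := fun x hx =>
    (pucci_log_barrier hl hk hcrit hδ hδc hx).1.continuousAt.continuousWithinAt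
  obtain ⟨x, ⟨hxR, hx1⟩, hmin⟩ := hAc.exists_isMinOn
    (f := fun x => w x - g x) ⟨x₁, by simpa using hR1.le, hx₁⟩
    (hw.continuousOn.sub (hgc.mono Set.inter_subset_right))
  have hx1 : 1 ≤ ‖x‖ := hx1
  rw [mem_closedBall_zero_iff] at hxR
  have hval : w x - g x ≤ w x₁ - g x₁ := hmin ⟨by simpa using hR1.le, hx₁⟩
  have hx1' : 1 < ‖x‖ := by
    refine lt_of_le_of_ne hx1 fun h => ?_
    have h1 := hc x h.symm
    have h2 : g x = c := by simp [hg, ← h]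
    linarith
  have hxR' : ‖x‖ < R := by
    refine lt_of_le_of_ne hxR fun h => ?_
    have h2 : g x < g x₁ - w x₁ := by
      simp only [hg, h]
      exact hR
    linarith [hw0 x]
  obtain ⟨hC, hP⟩ := pucci_log_barrier hl hk hcrit hδ hδc hx1
  have := hS x g hC (by
    filter_upwards [isOpen_ball.mem_nhds (mem_ball_zero_iff.2 hxR'),
      (isOpen_lt continuous_const continuous_norm).mem_nhds hx1'] with z hz1 hz2
    exact hmin ⟨ball_subset_closedBall hz1, le_of_lt hz2⟩)
  linarith [hf x hx1]

/-- A supersolution controls its right-hand side from below at twice the scale. -/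
theorem exists_source_le {lam Lam : ℝ} (h0 : 0 < lam) (hl : lam ≤ Lam) {n : ℕ} {w f : Euc n → ℝ}
    (hw : Continuous w) (hw0 : ∀ x, 0 < w x) (hS : ∀ x, SuperAt lam Lam w x (f x)) {r : ℝ}
    (hr : 0 < r) {x₀ : Euc n} (hx₀ : ‖x₀‖ ≤ r) :
    ∃ x, ‖x‖ ≤ 2 * r ∧ f x ≤ lam * n * w x₀ / r ^ 2 := by
  set κ := w x₀ / (3 * r ^ 2) with hκ
  have hκ0 : 0 < κ := by have := hw0 x₀; positivity
  set φ : Euc n → ℝ := fun x => 4 * r ^ 2 * κ + (-κ) * ‖x - 0‖ ^ 2 with hφ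
  have hr0 : r ≠ 0 := hr.ne'
  have hκr : 4 * r ^ 2 * κ = 4 / 3 * w x₀ := by
    rw [hκ]
    field_simp
  have hκr' : κ * r ^ 2 = w x₀ / 3 := by
    rw [hκ]
    field_simp
  have hq := contDiff_norm_sq_sub (n := n) (-κ) 0
  have hφC : ContDiff ℝ 2 φ := contDiff_const.add hq
  obtain ⟨x, hx, hmin⟩ := (isCompact_closedBall (0 : Euc n) (2 * r)).exists_isMinOn
    (f := fun x => w x - φ x) ⟨x₀, by rw [mem_closedBall_zero_iff]; linarith⟩
    (hw.sub hφC.continuous).continuousOn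
  have hval : w x - φ x ≤ w x₀ - φ x₀ := hmin (by rw [mem_closedBall_zero_iff]; linarith)
  rw [mem_closedBall_zero_iff] at hx
  have hx' : ‖x‖ < 2 * r := by
    refine lt_of_le_of_ne hx fun h => ?_
    have h1 : φ x = 0 := by
      simp only [hφ, sub_zero, h]
      ring
    have h2 : w x₀ ≤ φ x₀ := by
      have : κ * ‖x₀‖ ^ 2 ≤ κ * r ^ 2 := by gcongr
      simp only [hφ, sub_zero]
      linarith
    linarith [hw0 x]
  have h1 := hS x φ hφC.contDiffAt
    (hmin.isLocalMin (closedBall_mem_nhds_of_mem (mem_ball_zero_iff.2 hx')))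
  have h2 := trace_add_le_pucci hl hφC.contDiffAt (x := x) (e := 0) (by simp)
    (EuclideanSpace.basisFun (Fin n) ℝ)
  have h3 : ∀ v, d2 φ x v = -2 * κ * ‖v‖ ^ 2 := fun v => by
    rw [hφ, d2_add contDiffAt_const hq.contDiffAt, d2_const, d2_norm_sq]
    ring
  simp only [h3, OrthonormalBasis.norm_eq_one, one_pow, Finset.sum_const, Finset.card_univ,
    Fintype.card_fin, nsmul_eq_mul, mul_one, norm_zero] at h2
  refine ⟨x, hx, ?_⟩
  have h4 : lam * n * w x₀ / r ^ 2 = 3 * (lam * (n * κ)) := by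
    rw [hκ]
    field_simp
  have h5 : 0 ≤ lam * (n * κ) := by
    positivity
  rw [h4]
  linarith

namespace PucciSystem

variable (S : PucciSystem) {n : ℕ}

/-- The scaling exponents of the system. -/
noncomputable def scal (b : Bool) : ℝ := 2 * (S.pw b + 1) / (S.pw b * S.pw (!b) - 1)

theorem one_lt_pw_mul (b : Bool) : 1 < S.pw b * S.pw (!b) :=
  one_lt_mul_of_lt_of_le (S.one_lt_pw b) (S.one_lt_pw _).le

theorem scal_pos (b : Bool) : 0 < S.scal b :=
  div_pos (by linarith [S.pw_pos b]) (by linarith [S.one_lt_pw_mul b])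

theorem scal_add_two (b : Bool) : S.scal b + 2 = S.pw b * S.scal (!b) := by
  have h := S.one_lt_pw_mul b
  have h1 : S.pw b * S.pw (!b) - 1 ≠ 0 := by linarith
  have h2 : S.pw (!b) * S.pw b - 1 ≠ 0 := by linarith [mul_comm (S.pw b) (S.pw (!b))]
  rw [scal, scal, Bool.not_not]
  field_simp
  ring

variable {S}

/-- Iterating a superlinear inequality keeps a sequence bounded. -/
theorem bounded_of_rpow_succ_le {a : ℕ → ℝ} {C s : ℝ} (hs : 1 < s) (ha : ∀ k, 0 ≤ a k)
    (h : ∀ k, a (k + 1) ^ s ≤ C * a k) : ∃ X, ∀ k, a k ≤ X := by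
  obtain ⟨X, hX1, hX2, hX3⟩ := ((eventually_ge_atTop (1 : ℝ)).and ((eventually_ge_atTop (a 0)).and
    ((tendsto_rpow_atTop (sub_pos.2 hs)).eventually_ge_atTop C))).exists
  refine ⟨X, fun k => ?_⟩
  induction k with
  | zero => exact hX2
  | succ k ih =>
    have hX0 : 0 < X := by linarith
    have h1 : C * a k ≤ X ^ s :=
      calc C * a k ≤ X ^ (s - 1) * a k := mul_le_mul_of_nonneg_right hX3 (ha k)
        _ ≤ X ^ (s - 1) * X := mul_le_mul_of_nonneg_left ih (by positivity)
        _ = X ^ s := by rw [Real.rpow_sub_one hX0.ne', div_mul_cancel₀ _ hX0.ne']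
    exact (Real.rpow_le_rpow_iff (ha _) hX0.le (by linarith)).1 ((h k).trans h1)

theorem log_power_antitone {k c δ s r : ℝ} (hk : 0 < k) (hδ : 0 ≤ δ) (hδc : δ ≤ 2 * k * c)
    (hs : 1 ≤ s) (hsr : s ≤ r) :
    (r ^ 2) ^ (-k) * (c + δ / 2 * Real.log (r ^ 2)) ≤
      (s ^ 2) ^ (-k) * (c + δ / 2 * Real.log (s ^ 2)) := by
  set A := s ^ 2 with hA
  set B := r ^ 2 with hB
  have hA1 : 1 ≤ A := one_le_pow₀ hs
  have hAB : A ≤ B := by simp only [hA, hB]; gcongr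
  have hA0 : 0 < A := by linarith
  have hB0 : 0 < B := by linarith
  set t := B / A with ht
  have hBt : B = t * A := by rw [ht]; field_simp
  have ht1 : 1 ≤ t := (one_le_div hA0).2 hAB
  have ht0 : 0 < t := by linarith
  have h1 : k * Real.log t ≤ t ^ k - 1 := by
    have := Real.add_one_le_exp (Real.log t * k)
    rw [← Real.rpow_def_of_pos ht0] at this
    linarith
  have h2 : 0 ≤ δ / 2 * Real.log A := by
    have := Real.log_nonneg hA1
    positivity
  have h3 : 1 ≤ t ^ k := Real.one_le_rpow ht1 hk.le
  have hpA : 0 < A ^ (-k) := Real.rpow_pos_of_pos hA0 _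
  have hpt : 0 < t ^ k := by positivity
  rw [hBt, Real.mul_rpow ht0.le hA0.le, Real.log_mul ht0.ne' hA0.ne', Real.rpow_neg ht0.le,
    inv_mul_eq_div, div_mul_eq_mul_div, div_le_iff₀ hpt, mul_assoc]
  refine mul_le_mul_of_nonneg_left ?_ hpA.le
  have h4 : δ / 2 * Real.log t ≤ c * (t ^ k - 1) := by
    have hl0 := Real.log_nonneg ht1
    have h5 : δ / 2 * Real.log t ≤ k * c * Real.log t := by
      apply mul_le_mul_of_nonneg_right _ hl0
      linarith
    have hc : 0 ≤ c := by
      by_contra! h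
      nlinarith
    nlinarith
  nlinarith

theorem liouville_whole_space (hn : 0 < n) {u : Bool → Euc n → ℝ} (hc : ∀ b, Continuous (u b))
    (h0 : ∀ b x, 0 < u b x)
    (hS : ∀ b x, SuperAt (S.lam b) (S.Lam b) (u b) x (u (!b) x ^ S.pw b)) {b : Bool}
    (hcrit : S.lam b / S.Lam b * ((n : ℝ) - 1) - 1 ≤ S.scal b) : False := by
  have hmin : ∀ b (r : ℝ), ∃ m, 0 < m ∧ (∀ x, ‖x‖ ≤ |r| → m ≤ u b x) ∧
      ∃ x, ‖x‖ ≤ |r| ∧ u b x = m := fun b r => by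
    obtain ⟨x, hx, h⟩ := (isCompact_closedBall (0 : Euc n) |r|).exists_isMinOn
      ⟨0, mem_closedBall_self (abs_nonneg r)⟩ (hc b).continuousOn
    exact ⟨u b x, h0 b x, fun y hy => h (mem_closedBall_zero_iff.2 hy), x,
      mem_closedBall_zero_iff.1 hx, rfl⟩
  choose m hm0 hm hmx using hmin
  have hC : ∀ b r, 0 < r → m (!b) (2 * r) ^ S.pw b ≤ S.lam b * n * m b r / r ^ 2 := by
    intro b r hr
    obtain ⟨x₀, hx₀, hx₀m⟩ := hmx b r
    rw [abs_of_pos hr] at hx₀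
    obtain ⟨x, hx, hle⟩ := exists_source_le (S.lam_pos b) (S.lam_le b) (hc b) (h0 b) (hS b) hr hx₀
    rw [← hx₀m]
    refine le_trans (Real.rpow_le_rpow (hm0 _ _).le (hm _ _ x ?_) (S.pw_pos b).le) hle
    rwa [abs_of_pos (by positivity)]
  set k := S.scal b / 2 with hk
  have hk0 : 0 < k := half_pos (S.scal_pos b)
  have hcrit' : S.lam b * ((n : ℝ) - 1) ≤ (2 * k + 1) * S.Lam b := by
    have hL := S.Lam_pos b
    have : S.lam b * ((n : ℝ) - 1) = S.lam b / S.Lam b * ((n : ℝ) - 1) * S.Lam b := by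
      field_simp
    rw [this]
    exact mul_le_mul_of_nonneg_right (by rw [hk]; linarith) hL.le
  set c := m b 1 with hcdef
  have hcpos : 0 < c := hm0 b 1
  have hc1 : ∀ x, ‖x‖ ≤ 1 → c ≤ u b x := fun x hx => hm b 1 x (by simpa using hx)
  have hnpos : (0 : ℝ) < n := by exact_mod_cast hn
  have hstep : ∀ δ, 0 ≤ δ → δ ≤ 2 * k * c →
      (∀ x : Euc n, 1 ≤ ‖x‖ → 2 * k * δ * S.Lam b * (‖x‖ ^ 2) ^ (-k - 1) < u (!b) x ^ S.pw b) →
      ∀ r, 1 ≤ r → (r ^ 2) ^ (-k) * (c + δ / 2 * Real.log (r ^ 2)) ≤ m b r := by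
    intro δ hδ hδc hf r hr
    obtain ⟨x, hx, hxm⟩ := hmx b r
    rw [abs_of_pos (by linarith)] at hx
    rw [← hxm]
    rcases le_total ‖x‖ 1 with h | h
    · refine le_trans (log_power_antitone hk0 hδ hδc le_rfl hr) ?_
      simpa using hc1 x h
    · exact (log_power_antitone hk0 hδ hδc h hx).trans
        (exterior_lower_bound (S.lam_le b) hk0 hcrit' hδ hδc (hc b) (h0 b) (hS b)
          (fun x hx => hc1 x hx.le) hf x h)
  have hpow : ∀ r : ℝ, 0 < r → ∀ s : ℝ, (r ^ 2) ^ s = r ^ (2 * s) := fun r hr s => by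
    rw [← Real.rpow_natCast, ← Real.rpow_mul hr.le]
    norm_num
  have h1 : ∀ r, 1 ≤ r → c * r ^ (-S.scal b) ≤ m b r := fun r hr => by
    have := hstep 0 le_rfl (by positivity) (fun x _ => by
      simpa using Real.rpow_pos_of_pos (h0 (!b) x) _) r hr
    rw [hpow r (by linarith), hk] at this
    ring_nf at this ⊢
    exact this
  obtain ⟨η, hη0, hη⟩ : ∃ η > 0, ∀ r, 1 ≤ r → η * r ^ (-S.scal b - 2) ≤ m (!b) r ^ S.pw b := by
    set D := S.lam (!b) * n with hD
    have hD0 : 0 < D := mul_pos (S.lam_pos _) hnpos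
    set κ := (c * 2 ^ (-S.scal b)) ^ S.pw (!b) / D with hκ
    have hκ0 : 0 < κ := by positivity
    refine ⟨κ ^ S.pw b, by positivity, fun r hr => ?_⟩
    have hr0 : 0 < r := by linarith
    have h2 := hC (!b) r hr0
    rw [Bool.not_not] at h2
    have h3 : (c * (2 * r) ^ (-S.scal b)) ^ S.pw (!b) ≤ m b (2 * r) ^ S.pw (!b) :=
      Real.rpow_le_rpow (by positivity) (h1 (2 * r) (by linarith)) (S.pw_pos _).le
    have h4 : (c * (2 * r) ^ (-S.scal b)) ^ S.pw (!b) =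
        (c * 2 ^ (-S.scal b)) ^ S.pw (!b) * (r ^ (-S.scal (!b)) / r ^ 2) := by
      rw [Real.mul_rpow (by norm_num) hr0.le, ← mul_assoc, Real.mul_rpow (by positivity)
        (by positivity), ← Real.rpow_mul hr0.le, ← Real.rpow_natCast r 2, ← Real.rpow_sub hr0]
      have := S.scal_add_two (!b)
      rw [Bool.not_not] at this
      congr 2
      push_cast
      linarith
    have h5 : κ * r ^ (-S.scal (!b)) ≤ m (!b) r := by
      rw [hκ, div_mul_eq_mul_div, div_le_iff₀ hD0]
      have h6 := h4.symm.le.trans (h3.trans h2)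
      rw [mul_div_assoc', div_le_div_iff_of_pos_right (by positivity)] at h6
      linarith
    have h7 := Real.rpow_le_rpow (by positivity) h5 (S.pw_pos b).le
    rw [Real.mul_rpow hκ0.le (by positivity), ← Real.rpow_mul hr0.le] at h7
    have := S.scal_add_two b
    rwa [show -S.scal b - 2 = -S.scal (!b) * S.pw b by linarith]
  obtain ⟨δ, hδ0, hδc, hδη⟩ : ∃ δ > 0, δ ≤ 2 * k * c ∧ 2 * k * δ * S.Lam b < η := by
    have hL := S.Lam_pos b
    refine ⟨min (2 * k * c) (η / (2 * k * S.Lam b) / 2), by positivity, min_le_left _ _, ?_⟩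
    have : min (2 * k * c) (η / (2 * k * S.Lam b) / 2) ≤ η / (2 * k * S.Lam b) / 2 :=
      min_le_right _ _
    calc _ = 2 * k * S.Lam b * min (2 * k * c) (η / (2 * k * S.Lam b) / 2) := by ring
      _ ≤ 2 * k * S.Lam b * (η / (2 * k * S.Lam b) / 2) := by gcongr
      _ = η / 2 := by field_simp
      _ < η := by linarith
  have hlog := hstep δ hδ0.le hδc (fun x hx => by
    have hx0 : 0 < ‖x‖ := by linarith
    rw [hpow _ hx0, show 2 * (-k - 1) = -S.scal b - 2 by rw [hk]; ring]
    refine lt_of_lt_of_le (mul_lt_mul_of_pos_right hδη (by positivity)) ((hη _ hx).trans ?_)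
    exact Real.rpow_le_rpow (hm0 _ _).le (hm _ _ x (le_abs_self _)) (S.pw_pos b).le)
  obtain ⟨X, hX⟩ : ∃ X, ∀ j : ℕ, m b (4 ^ j) * (4 ^ j) ^ S.scal b ≤ X := by
    set A := S.lam b * n with hA
    set A' := S.lam (!b) * n with hA'
    have hA0 : 0 < A := mul_pos (S.lam_pos _) hnpos
    have hA0' : 0 < A' := mul_pos (S.lam_pos _) hnpos
    have hs := S.one_lt_pw_mul b
    rw [mul_comm] at hs
    refine bounded_of_rpow_succ_le (C := A' ^ S.pw b * A * 4 ^ (S.scal b * (S.pw (!b) * S.pw b)) /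
      4 ^ S.pw b) hs (fun j => mul_nonneg (hm0 _ _).le (by positivity)) fun j => ?_
    rw [pow_succ']
    set r : ℝ := 4 ^ j with hr
    have hr0 : 0 < r := by positivity
    have e1 := hC (!b) (2 * r) (by positivity)
    rw [Bool.not_not, ← mul_assoc, mul_pow, show (2 : ℝ) * 2 = 4 by norm_num,
      show (2 : ℝ) ^ 2 = 4 by norm_num, ← hA'] at e1
    have e2 := Real.rpow_le_rpow (Real.rpow_nonneg (hm0 _ _).le _) e1 (S.pw_pos b).le
    have hm2 := hm0 (!b) (2 * r)
    rw [Real.div_rpow (by positivity) (by positivity), Real.mul_rpow hA0'.le hm2.le,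
      Real.mul_rpow (x := 4) (by norm_num) (by positivity), hpow r hr0, ← Real.rpow_mul (hm0 _ _).le] at e2
    have e3 := hC b r hr0
    rw [← hA] at e3
    have hexp : S.scal b * (S.pw (!b) * S.pw b) = S.scal b + 2 + 2 * S.pw b := by
      have i1 := S.scal_add_two b
      have i2 := S.scal_add_two (!b)
      rw [Bool.not_not] at i2
      calc _ = S.pw b * (S.pw (!b) * S.scal b) := by ring
        _ = S.pw b * S.scal (!b) + 2 * S.pw b := by rw [← i2]; ring
        _ = _ := by rw [← i1]
    have hrr : r ^ (S.scal b * (S.pw (!b) * S.pw b)) = r ^ S.scal b * r ^ 2 * r ^ (2 * S.pw b) := by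
      rw [hexp, Real.rpow_add hr0, Real.rpow_add hr0]
      norm_num
    have hmr := hm0 b (4 * r)
    rw [Real.mul_rpow hmr.le (by positivity), ← Real.rpow_mul (by positivity),
      Real.mul_rpow (by norm_num) hr0.le, hrr]
    set F : ℝ := 4 ^ (S.scal b * (S.pw (!b) * S.pw b)) with hF
    have hF0 : 0 < F := by positivity
    calc _ ≤ A' ^ S.pw b * m (!b) (2 * r) ^ S.pw b / (4 ^ S.pw b * r ^ (2 * S.pw b)) *
          (F * (r ^ S.scal b * r ^ 2 * r ^ (2 * S.pw b))) := by gcongr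
      _ ≤ A' ^ S.pw b * (A * m b r / r ^ 2) / (4 ^ S.pw b * r ^ (2 * S.pw b)) *
          (F * (r ^ S.scal b * r ^ 2 * r ^ (2 * S.pw b))) := by gcongr
      _ = _ := by
        field_simp
  have hlim : Tendsto (fun j : ℕ => c + δ / 2 * ((j : ℝ) * Real.log 16)) atTop atTop :=
    tendsto_atTop_add_const_left _ _ ((tendsto_natCast_atTop_atTop.atTop_mul_const
      (Real.log_pos (by norm_num))).const_mul_atTop (by positivity))
  obtain ⟨j, hj⟩ := (hlim.eventually_gt_atTop X).exists
  have h4j : (1 : ℝ) ≤ 4 ^ j := one_le_pow₀ (by norm_num)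
  have h2 := hlog (4 ^ j) h4j
  rw [hpow _ (by positivity), show 2 * -k = -S.scal b by rw [hk]; ring,
    Real.rpow_neg (by positivity), inv_mul_le_iff₀ (by positivity)] at h2
  have h3 : Real.log ((4 ^ j) ^ 2) = (j : ℝ) * Real.log 16 := by
    rw [← pow_mul, mul_comm, pow_mul, Real.log_pow]
    norm_num
  rw [h3] at h2
  linarith [hX j, mul_comm (m b (4 ^ j)) ((4 ^ j) ^ S.scal b)]

end PucciSystem

namespace PucciSystem

variable {S : PucciSystem} {n : ℕ}

theorem liouville_half_space (hn : 0 < n) {e : Euc n} (he : ‖e‖ = 1) {u : Bool → Euc n → ℝ}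
    (hu : S.Sol e 0 u) (hpos : ∀ b x, 0 < ⟪e, x⟫ → 0 < u b x) {K : ℝ} (hK : ∀ b x, u b x ≤ K)
    {b : Bool} (hcrit : S.lam b / S.Lam b * ((n : ℝ) - 1) - 1 ≤ S.scal b) : False := by
  have hee : ∀ t : ℝ, ⟪e, t • e⟫ = t := fun t => by
    rw [inner_smul_right, real_inner_self_eq_norm_sq, he]
    ring
  have hU : ∀ k : ℕ, S.Sol e k (fun b z => u b ((k : ℝ) • e + z)) := fun k => by
    simpa only [hee, zero_add] using hu.translate ((k : ℝ) • e)
  obtain ⟨v, hvc, hv0, hvl, hvS⟩ := exists_limit (S := S) hn (hyperfilter ℕ) he hU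
    fun R => ⟨K, Eventually.of_forall fun k b x _ => hK b _⟩
  have hsol : ∀ x, S.SolAt v x := fun x => hvS x 1 one_pos (by
    have h : ∀ᶠ k : ℕ in atTop, -(k : ℝ) + 1 < ⟪e, x⟫ :=
      (tendsto_natCast_atTop_atTop.eventually_gt_atTop (1 - ⟪e, x⟫)).mono fun k hk => by linarith
    exact h.filter_mono Nat.hyperfilter_le_atTop)
  refine liouville_whole_space hn hvc (fun b x => ?_) (fun b x => (hsol x b).2) hcrit
  obtain ⟨k₀, hk₀⟩ := exists_nat_gt (-⟪e, x⟫)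
  refine (hpos b ((k₀ : ℝ) • e + x) ?_).trans_le (ge_of_tendsto ((hvl b).tendsto_comp
    (hvc b).continuousAt (tendsto_const_nhds (x := x))) ?_)
  · rw [inner_add_right, hee]
    linarith
  · filter_upwards [(eventually_ge_atTop k₀).filter_mono Nat.hyperfilter_le_atTop] with k hk
    have hk' : (k₀ : ℝ) ≤ k := by exact_mod_cast hk
    refine (hu.monotone hn he hK b ((k₀ : ℝ) • e + x) (sub_nonneg.2 hk')).trans_eq ?_
    congr 1
    module

theorem exists_doubling {M : Euc n → ℝ} (hM : Continuous M) (h0 : ∀ x, 0 ≤ M x) {y : Euc n}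
    (hy : 0 < M y) {k : ℝ} (hk : 0 < k) :
    ∃ x, 0 < M x ∧ ∀ z, ‖z‖ ≤ k → M (x + (M x)⁻¹ • z) ≤ 2 * M x := by
  set ρ := 2 * k / M y with hρ
  have hρ0 : 0 < ρ := by positivity
  obtain ⟨x, hx, hmax⟩ := (isCompact_closedBall y ρ).exists_isMaxOn
    ⟨y, mem_closedBall_self hρ0.le⟩ (f := fun x => M x * (ρ - ‖x - y‖)) (by fun_prop)
  rw [mem_closedBall, dist_eq_norm] at hx
  have h1 : 2 * k ≤ M x * (ρ - ‖x - y‖) := by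
    have : M y * (ρ - ‖y - y‖) ≤ M x * (ρ - ‖x - y‖) := hmax (mem_closedBall_self hρ0.le)
    rw [sub_self, norm_zero, sub_zero, hρ, mul_div_cancel₀ _ hy.ne'] at this
    exact this
  set σ := ρ - ‖x - y‖ with hσ
  have hσ0 : 0 ≤ σ := sub_nonneg.2 hx
  have hMx : 0 < M x := by
    by_contra! h
    nlinarith
  have hσ' : 0 < σ := by
    by_contra! h
    nlinarith
  refine ⟨x, hMx, fun z hz => ?_⟩
  set w := x + (M x)⁻¹ • z with hw
  have hwx : ‖w - x‖ ≤ σ / 2 := by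
    rw [hw, add_sub_cancel_left, norm_smul, norm_inv, Real.norm_of_nonneg hMx.le,
      inv_mul_le_iff₀ hMx]
    linarith
  have hwy : ‖w - y‖ ≤ ‖w - x‖ + ‖x - y‖ := norm_sub_le_norm_sub_add_norm_sub _ _ _
  have h2 : M w * (ρ - ‖w - y‖) ≤ M x * σ :=
    hmax (mem_closedBall.2 (by rw [dist_eq_norm]; linarith))
  have h3 : M w * (σ / 2) ≤ M w * (ρ - ‖w - y‖) :=
    mul_le_mul_of_nonneg_left (by linarith) (h0 w)
  refine le_of_mul_le_mul_right (a := σ / 2) ?_ (by linarith)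
  linarith

theorem no_positive_solution (hn : 0 < n) {e : Euc n} (he : ‖e‖ = 1) {u : Bool → Euc n → ℝ}
    (hu : S.Sol e 0 u) (hpos : ∀ b x, 0 < ⟪e, x⟫ → 0 < u b x)
    {b : Bool} (hcrit : S.lam b / S.Lam b * ((n : ℝ) - 1) - 1 ≤ S.scal b) : False := by
  have hee : ∀ t : ℝ, ⟪e, t • e⟫ = t := fun t => by
    rw [inner_smul_right, real_inner_self_eq_norm_sq, he]
    ring
  set M : Euc n → ℝ := fun x => ∑ b, u b x ^ (S.scal b)⁻¹ with hMdef
  have hαi : ∀ b, 0 < (S.scal b)⁻¹ := fun b => inv_pos.2 (S.scal_pos b)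
  have hpw0 : ∀ b x, 0 ≤ u b x ^ (S.scal b)⁻¹ := fun b x => Real.rpow_nonneg (hu.nonneg b x) _
  have hMc : Continuous M := continuous_finsetSum _ fun b _ =>
    (hu.cont b).rpow_const fun _ => Or.inr (hαi b).le
  have hM0 : ∀ x, 0 ≤ M x := fun x => Finset.sum_nonneg fun b _ => hpw0 b x
  have hMe : 0 < M e := Finset.sum_pos (fun b _ => Real.rpow_pos_of_pos (hpos b e (by
    simp [he])) _) Finset.univ_nonempty
  choose x hx hdouble using fun k : ℕ => exists_doubling hMc hM0 hMe (k := (k : ℝ) + 1)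
    (by positivity)
  have hxe : ∀ k, 0 < ⟪e, x k⟫ := fun k => by
    by_contra! h
    refine (hx k).ne' (Finset.sum_eq_zero fun b _ => ?_)
    rw [hu.zero b _ (by linarith), Real.zero_rpow (hαi b).ne']
  set c : ℕ → ℝ := fun k => (M (x k))⁻¹ with hcdef
  have hc : ∀ k, 0 < c k := fun k => inv_pos.2 (hx k)
  have hU : ∀ k, S.Sol e ((0 + ⟪e, x k⟫) / c k)
      (fun b z => c k ^ S.scal b * u b (x k + c k • z)) := fun k =>
    hu.scale (fun b => Real.rpow_pos_of_pos (hc k) _) (hc k) fun b => by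
      rw [← Real.rpow_natCast, ← Real.rpow_add (hc k), ← Real.rpow_mul (hc k).le]
      congr 1
      push_cast
      linarith [S.scal_add_two b]
  set U : ℕ → Bool → Euc n → ℝ := fun k b z => c k ^ S.scal b * u b (x k + c k • z) with hUdef
  set d : ℕ → ℝ := fun k => (0 + ⟪e, x k⟫) / c k with hd
  have hd0 : ∀ k, 0 < d k := fun k => div_pos (by linarith [hxe k]) (hc k)
  have hUpow : ∀ k b z, U k b z ^ (S.scal b)⁻¹ = c k * u b (x k + c k • z) ^ (S.scal b)⁻¹ :=
    fun k b z => by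
      rw [hUdef, Real.mul_rpow (Real.rpow_nonneg (hc k).le _) (hu.nonneg _ _),
        Real.rpow_rpow_inv (hc k).le (S.scal_pos b).ne']
  have hUsum : ∀ k z, ∑ b, U k b z ^ (S.scal b)⁻¹ = c k * M (x k + c k • z) := fun k z => by
    simp only [hUpow, hMdef, Finset.mul_sum]
  obtain ⟨K, hK⟩ : ∃ K : ℝ, ∀ b, (2 : ℝ) ^ S.scal b ≤ K :=
    ⟨∑ b, (2 : ℝ) ^ S.scal b, fun b => Finset.single_le_sum (f := fun b => (2 : ℝ) ^ S.scal b)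
      (fun _ _ => by positivity) (Finset.mem_univ b)⟩
  have hUK : ∀ (k : ℕ) b z, ‖z‖ ≤ (k : ℝ) + 1 → U k b z ≤ K := fun k b z hz => by
    refine le_trans ?_ (hK b)
    have h1 : U k b z ^ (S.scal b)⁻¹ ≤ 2 := by
      refine (Finset.single_le_sum (f := fun b => U k b z ^ (S.scal b)⁻¹)
        (fun b _ => Real.rpow_nonneg ((hU k).nonneg b z) _) (Finset.mem_univ b)).trans ?_
      rw [hUsum, hcdef, inv_mul_le_iff₀ (hx k)]
      linarith [hdouble k z hz]
    have h2 := Real.rpow_le_rpow (Real.rpow_nonneg ((hU k).nonneg b z) _) h1 (S.scal_pos b).le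
    rwa [Real.rpow_inv_rpow ((hU k).nonneg b z) (S.scal_pos b).ne'] at h2
  set l : Ultrafilter ℕ := hyperfilter ℕ with hl
  have hbound : ∀ R : ℝ, ∀ᶠ k in l, ∀ b, ∀ x ∈ ball (0 : Euc n) R, U k b x ≤ K := fun R => by
    have : ∀ᶠ k : ℕ in atTop, ∀ b, ∀ x ∈ ball (0 : Euc n) R, U k b x ≤ K := by
      filter_upwards [tendsto_natCast_atTop_atTop.eventually_gt_atTop R] with k hk b x hx
      exact hUK k b x (by linarith [mem_ball_zero_iff.1 hx])
    exact this.filter_mono Nat.hyperfilter_le_atTop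
  obtain ⟨v, hvc, hv0, hvl, hvS⟩ := exists_limit (S := S) hn l he hU fun R => ⟨K, hbound R⟩
  have hpt : ∀ b x, Tendsto (fun k => U k b x) l (𝓝 (v b x)) := fun b x =>
    (hvl b).tendsto_comp (hvc b).continuousAt tendsto_const_nhds
  have hvK : ∀ b x, v b x ≤ K := fun b x => le_of_tendsto (hpt b x)
    ((hbound (‖x‖ + 1)).mono fun k hk => hk b x (mem_ball_zero_iff.2 (by linarith)))
  have hvpos : ∃ b, 0 < v b 0 := by
    by_contra! h
    have h1 : Tendsto (fun k => ∑ b, U k b 0 ^ (S.scal b)⁻¹) l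
        (𝓝 (∑ b, v b 0 ^ (S.scal b)⁻¹)) :=
      tendsto_finsetSum _ fun b _ => (hpt b 0).rpow_const (Or.inr (hαi b).le)
    have h2 : ∀ k, ∑ b, U k b 0 ^ (S.scal b)⁻¹ = 1 := fun k => by
      rw [hUsum, smul_zero, add_zero]
      exact inv_mul_cancel₀ (hx k).ne'
    simp only [h2] at h1
    have h3 := tendsto_nhds_unique h1 tendsto_const_nhds
    rw [Finset.sum_eq_zero fun b _ => by
      rw [le_antisymm (h b) (hv0 b 0), Real.zero_rpow (hαi b).ne']] at h3
    exact zero_ne_one h3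
  obtain ⟨b₀, hb₀⟩ := hvpos
  by_cases hbd : ∃ D, ∀ᶠ k in l, d k ≤ D
  · obtain ⟨D, hD⟩ := hbd
    obtain ⟨d', -, hdl⟩ := l.exists_tendsto_of_mem_compact (isCompact_Icc (a := 0) (b := D))
      (hD.mono fun k hk => ⟨(hd0 k).le, hk⟩)
    have hsol : S.Sol e d' v :=
      { cont := hvc
        nonneg := hv0
        zero := fun b x hx => by
          have h1 : Tendsto (fun k => x + (d' - d k) • e) l (𝓝 x) := by
            simpa using ((hdl.const_sub d').smul_const e).const_add x
          refine tendsto_nhds_unique ((hvl b).tendsto_comp (hvc b).continuousAt h1) ?_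
          have h2 : ∀ k, U k b (x + (d' - d k) • e) = 0 := fun k => (hU k).zero b _ (by
            rw [inner_add_right, hee]
            change _ ≤ -d k
            linarith)
          exact tendsto_const_nhds.congr fun k => (h2 k).symm
        solAt := fun x hx => hvS x ((⟪e, x⟫ + d') / 2) (by linarith) (by
          filter_upwards [hdl.eventually (lt_mem_nhds (show d' - (⟪e, x⟫ + d') / 2 < d' by
            linarith))] with k hk
          linarith) }
    have hsol' := hsol.translate (-d' • e)
    rw [hee, add_neg_cancel] at hsol'
    refine liouville_half_space hn he hsol' ?_ (fun b x => hvK b _) hcrit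
    refine pos_of_exists_pos (isOpen_halfspace e 0) (isPreconnected_halfspace e 0) hsol'.cont
      hsol'.nonneg (fun x hx => hsol'.solAt x (by simpa using hx)) ⟨b₀, d' • e, ?_, ?_⟩
    · by_contra h
      have h1 := hsol'.zero b₀ (d' • e) (by simpa using h)
      simp only [neg_smul, neg_add_cancel] at h1
      linarith
    · simpa using hb₀
  · push Not at hbd
    have hsol : ∀ x, S.SolAt v x := fun x => hvS x 1 one_pos (by
      filter_upwards [hbd (1 - ⟪e, x⟫)] with k hk
      change -d k + 1 < _
      linarith)
    have hv := pos_of_exists_pos isOpen_univ isPreconnected_univ hvc hv0 (fun x _ => hsol x)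
      ⟨b₀, 0, Set.mem_univ _, hb₀⟩
    exact liouville_whole_space hn hvc (fun b x => hv b x (Set.mem_univ x))
      (fun b x => (hsol x b).2) hcrit

end PucciSystem

theorem stmt5 (n : ℕ) (hn : 2 ≤ n)
    (lam1 Lam1 lam2 Lam2 : ℝ) (hlam1 : 0 < lam1) (hLam1 : lam1 ≤ Lam1)
    (hlam2 : 0 < lam2) (hLam2 : lam2 ≤ Lam2)
    (N1 N2 : ℝ) (hN1 : N1 = lam1 / Lam1 * ((n : ℝ) - 1) + 1)
    (hN2 : N2 = lam2 / Lam2 * ((n : ℝ) - 1) + 1)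
    (hN1' : 2 < N1) (hN2' : 2 < N2)
    (p q : ℝ) (hp : 1 < p) (hq : 1 < q)
    (hcrit : N1 - 2 ≤ 2 * (p + 1) / (p * q - 1) ∨ N2 - 2 ≤ 2 * (q + 1) / (p * q - 1))
    (u1 u2 : EuclideanSpace ℝ (Fin n) → ℝ)
    (hu1 : ContinuousOn u1 {x | 0 ≤ x ⟨n - 1, by omega⟩})
    (hu2 : ContinuousOn u2 {x | 0 ≤ x ⟨n - 1, by omega⟩})
    (hpos1 : ∀ x : EuclideanSpace ℝ (Fin n), 0 < x ⟨n - 1, by omega⟩ → 0 < u1 x)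
    (hpos2 : ∀ x : EuclideanSpace ℝ (Fin n), 0 < x ⟨n - 1, by omega⟩ → 0 < u2 x)
    (hbdry1 : ∀ x : EuclideanSpace ℝ (Fin n), x ⟨n - 1, by omega⟩ = 0 → u1 x = 0)
    (hbdry2 : ∀ x : EuclideanSpace ℝ (Fin n), x ⟨n - 1, by omega⟩ = 0 → u2 x = 0)
    (hsuper1 : PucciSupersol lam1 Lam1 {x | 0 < x ⟨n - 1, by omega⟩} u1 (fun x => u2 x ^ p))
    (hsub1 : PucciSubsol lam1 Lam1 {x | 0 < x ⟨n - 1, by omega⟩} u1 (fun x => u2 x ^ p))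
    (hsuper2 : PucciSupersol lam2 Lam2 {x | 0 < x ⟨n - 1, by omega⟩} u2 (fun x => u1 x ^ q))
    (hsub2 : PucciSubsol lam2 Lam2 {x | 0 < x ⟨n - 1, by omega⟩} u2 (fun x => u1 x ^ q)) :
    False := by
  set i₀ : Fin n := ⟨n - 1, by omega⟩ with hi₀
  let S : PucciSystem :=
    { lam := fun b => bif b then lam1 else lam2
      Lam := fun b => bif b then Lam1 else Lam2
      pw := fun b => bif b then p else q
      lam_pos := fun b => by cases b <;> assumption
      lam_le := fun b => by cases b <;> assumption
      one_lt_pw := fun b => by cases b <;> assumption }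
  set e : Euc n := EuclideanSpace.single i₀ 1 with he
  have hei : ∀ x : Euc n, ⟪e, x⟫ = x i₀ := fun x => by simp [he, EuclideanSpace.inner_single_left]
  set P : Euc n → Euc n := fun x => x + (max (x i₀) 0 - x i₀) • e with hP
  have hPi : ∀ x, P x i₀ = max (x i₀) 0 := fun x => by simp [hP, he]
  have hPc : Continuous P := by fun_prop
  have hPx : ∀ x : Euc n, 0 < x i₀ → P x = x := fun x hx => by simp [hP, max_eq_left hx.le]
  set u : Bool → Euc n → ℝ := fun b x => bif b then u1 (P x) else u2 (P x) with hu
  have hopen : IsOpen {x : Euc n | 0 < x i₀} := isOpen_lt continuous_const (by fun_prop)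
  have hnear : ∀ (w : Euc n → ℝ) x, 0 < x i₀ → w =ᶠ[𝓝 x] fun y => w (P y) := fun w x hx =>
    (hopen.eventually_mem hx).mono fun y hy => congrArg w (hPx y hy).symm
  have hPmem : ∀ x, P x ∈ {x : Euc n | 0 ≤ x i₀} := fun x => (le_max_right _ _).trans_eq (hPi x).symm
  have hpos : ∀ b x, 0 < ⟪e, x⟫ → 0 < u b x := fun b x hx => by
    rw [hei] at hx
    cases b
    · exact (hpos2 x hx).trans_eq (congrArg u2 (hPx x hx)).symm
    · exact (hpos1 x hx).trans_eq (congrArg u1 (hPx x hx)).symm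
  have hzero : ∀ b x, ⟪e, x⟫ ≤ 0 → u b x = 0 := fun b x hx => by
    have h : P x i₀ = 0 := by rw [hPi, max_eq_right (hei x ▸ hx)]
    cases b
    · exact hbdry2 _ h
    · exact hbdry1 _ h
  have hsol : S.Sol e 0 u :=
    { cont := fun b => by
        cases b
        · exact hu2.comp_continuous hPc hPmem
        · exact hu1.comp_continuous hPc hPmem
      nonneg := fun b x => by
        rcases le_or_gt ⟪e, x⟫ 0 with h | h
        · exact (hzero b x h).ge
        · exact (hpos b x h).le
      zero := fun b x hx => hzero b x (by simpa using hx)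
      solAt := fun x hx b => by
        rw [neg_zero, hei] at hx
        cases b
        · have h : u true x = u1 x := congrArg u1 (hPx x hx)
          change SubAt lam2 Lam2 _ x (u true x ^ q) ∧ SuperAt lam2 Lam2 _ x (u true x ^ q)
          rw [h]
          exact ⟨(hsub2.subAt hx).congr (hnear u2 x hx), (hsuper2.superAt hx).congr (hnear u2 x hx)⟩
        · have h : u false x = u2 x := congrArg u2 (hPx x hx)
          change SubAt lam1 Lam1 _ x (u false x ^ p) ∧ SuperAt lam1 Lam1 _ x (u false x ^ p)
          rw [h]
          exact ⟨(hsub1.subAt hx).congr (hnear u1 x hx), (hsuper1.superAt hx).congr (hnear u1 x hx)⟩ }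
  have he1 : ‖e‖ = 1 := by simp [he]
  rcases hcrit with h | h
  · refine PucciSystem.no_positive_solution (by omega) he1 hsol hpos (b := true) ?_
    change lam1 / Lam1 * ((n : ℝ) - 1) - 1 ≤ 2 * (p + 1) / (p * q - 1)
    linarith
  · refine PucciSystem.no_positive_solution (by omega) he1 hsol hpos (b := false) ?_
    change lam2 / Lam2 * ((n : ℝ) - 1) - 1 ≤ 2 * (q + 1) / (q * p - 1)
    rw [mul_comm q p]
    linarith
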